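/- arXiv:2411.01303 — 5 statements merged into one kernel-verified Lean document; each statement's English description precedes it below -/
import Mathlib

section
/- Let R be a skew-invertible Hecke symmetry on V = ℂ^N with parameter q (q ≠ 0, q ≠ ±1) and let L̂(R) be the associated modified reflection equation algebra with generating matrix L̂. For every n ≥ 1, Tr_{R(1…n)}( R_{n−1} R_{n−2} ⋯ R₁ · L̂_{\bar{1→n}} ) = Tr_R( L̂^n ), where L̂^n is the n-th matrix power of L̂ over L̂(R). -/
open scoped BigOperators

/-- Amplification of an operator on V⊗V to positions (k, k+1) (0-based) of V^{⊗n}. -/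
def ampl2 {A : Type*} [Semiring A] (N n : ℕ)
    (M : Matrix (Fin N × Fin N) (Fin N × Fin N) A) (k : ℕ) :
    Matrix (Fin n → Fin N) (Fin n → Fin N) A := fun i j =>
  if h : k + 1 < n then
    if ∀ m : Fin n, (m : ℕ) ≠ k → (m : ℕ) ≠ k + 1 → i m = j m then
      M (i ⟨k, Nat.lt_of_succ_lt h⟩, i ⟨k + 1, h⟩)
        (j ⟨k, Nat.lt_of_succ_lt h⟩, j ⟨k + 1, h⟩)
    else 0
  else 0

/-- Amplification of an operator on V to position k (0-based) of V^{⊗n}. -/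
def ampl1 {A : Type*} [Semiring A] (N n : ℕ)
    (X : Matrix (Fin N) (Fin N) A) (k : ℕ) :
    Matrix (Fin n → Fin N) (Fin n → Fin N) A := fun i j =>
  if h : k < n then
    if ∀ m : Fin n, (m : ℕ) ≠ k → i m = j m then
      X (i ⟨k, h⟩) (j ⟨k, h⟩)
    else 0
  else 0

/-- The R-trace of an N×N matrix over an algebra. -/
noncomputable def trR1 {A : Type*} [Ring A] [Algebra ℂ A] (N : ℕ)
    (C : Matrix (Fin N) (Fin N) ℂ) (X : Matrix (Fin N) (Fin N) A) : A :=
  ∑ i : Fin N, ∑ j : Fin N, algebraMap ℂ A (C i j) * X j i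

/-- The full R-trace over all n tensor positions. -/
noncomputable def trRn {A : Type*} [Ring A] [Algebra ℂ A] (N n : ℕ)
    (C : Matrix (Fin N) (Fin N) ℂ)
    (M : Matrix (Fin n → Fin N) (Fin n → Fin N) A) : A :=
  ∑ i : Fin n → Fin N, ∑ j : Fin n → Fin N,
    algebraMap ℂ A (∏ k : Fin n, C (i k) (j k)) * M j i

/-- The matrix L⊗I over the free algebra on N² generators. -/
noncomputable def L1F (N : ℕ) :
    Matrix (Fin N × Fin N) (Fin N × Fin N) (FreeAlgebra ℂ (Fin N × Fin N)) :=
  fun p r => if p.2 = r.2 then FreeAlgebra.ι ℂ (p.1, r.1) else 0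

/-- Defining relations of the reflection equation algebra. -/
inductive REArel (N : ℕ) (R : Matrix (Fin N × Fin N) (Fin N × Fin N) ℂ) :
    FreeAlgebra ℂ (Fin N × Fin N) → FreeAlgebra ℂ (Fin N × Fin N) → Prop
  | rel (p r : Fin N × Fin N) :
      REArel N R
        ((R.map (algebraMap ℂ (FreeAlgebra ℂ (Fin N × Fin N))) * L1F N *
            R.map (algebraMap ℂ (FreeAlgebra ℂ (Fin N × Fin N))) * L1F N) p r)
        ((L1F N * R.map (algebraMap ℂ (FreeAlgebra ℂ (Fin N × Fin N))) * L1F N *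
            R.map (algebraMap ℂ (FreeAlgebra ℂ (Fin N × Fin N)))) p r)

/-- The reflection equation algebra L(R). -/
abbrev REA (N : ℕ) (R : Matrix (Fin N × Fin N) (Fin N × Fin N) ℂ) := RingQuot (REArel N R)

/-- The generating matrix of the RE algebra. -/
noncomputable def Lgen (N : ℕ) (R : Matrix (Fin N × Fin N) (Fin N × Fin N) ℂ) :
    Matrix (Fin N) (Fin N) (REA N R) :=
  fun i j => RingQuot.mkAlgHom ℂ (REArel N R) (FreeAlgebra.ι ℂ (i, j))

/-- Defining relations of the modified reflection equation algebra. -/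
inductive MREArel (N : ℕ) (R : Matrix (Fin N × Fin N) (Fin N × Fin N) ℂ) :
    FreeAlgebra ℂ (Fin N × Fin N) → FreeAlgebra ℂ (Fin N × Fin N) → Prop
  | rel (p r : Fin N × Fin N) :
      MREArel N R
        ((R.map (algebraMap ℂ (FreeAlgebra ℂ (Fin N × Fin N))) * L1F N *
            R.map (algebraMap ℂ (FreeAlgebra ℂ (Fin N × Fin N))) * L1F N -
          L1F N * R.map (algebraMap ℂ (FreeAlgebra ℂ (Fin N × Fin N))) * L1F N *
            R.map (algebraMap ℂ (FreeAlgebra ℂ (Fin N × Fin N)))) p r)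
        ((R.map (algebraMap ℂ (FreeAlgebra ℂ (Fin N × Fin N))) * L1F N -
          L1F N * R.map (algebraMap ℂ (FreeAlgebra ℂ (Fin N × Fin N)))) p r)

/-- The modified reflection equation algebra L̂(R). -/
abbrev MREA (N : ℕ) (R : Matrix (Fin N × Fin N) (Fin N × Fin N) ℂ) := RingQuot (MREArel N R)

/-- The generating matrix of the modified RE algebra. -/
noncomputable def Lhatgen (N : ℕ) (R : Matrix (Fin N × Fin N) (Fin N × Fin N) ℂ) :
    Matrix (Fin N) (Fin N) (MREA N R) :=
  fun i j => RingQuot.mkAlgHom ℂ (MREArel N R) (FreeAlgebra.ι ℂ (i, j))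

/-- The matrices L_{\bar k}, 0-based: Lbar 0 = L₁, Lbar k = R_k Lbar (k-1) R_k⁻¹,
with R⁻¹ = R - (q - q⁻¹)I. -/
noncomputable def Lbar {A : Type*} [Ring A] [Algebra ℂ A] (N n : ℕ)
    (R : Matrix (Fin N × Fin N) (Fin N × Fin N) ℂ) (q : ℂ)
    (L : Matrix (Fin N) (Fin N) A) : ℕ → Matrix (Fin n → Fin N) (Fin n → Fin N) A
  | 0 => ampl1 N n L 0
  | k + 1 =>
      ampl2 N n (R.map (algebraMap ℂ A)) k * Lbar N n R q L k *
        ampl2 N n ((R - (q - q⁻¹) • 1).map (algebraMap ℂ A)) k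

/-- The ordered product L_{\bar 1} L_{\bar 2} ⋯ L_{\bar n}. -/
noncomputable def Ltot {A : Type*} [Ring A] [Algebra ℂ A] (N n : ℕ)
    (R : Matrix (Fin N × Fin N) (Fin N × Fin N) ℂ) (q : ℂ)
    (L : Matrix (Fin N) (Fin N) A) : Matrix (Fin n → Fin N) (Fin n → Fin N) A :=
  ((List.range n).map (Lbar N n R q L)).prod



section Aux

/-- The n-fold tensor power of C. -/
noncomputable def auxCC (N n : ℕ) (C : Matrix (Fin N) (Fin N) ℂ) :
    Matrix (Fin n → Fin N) (Fin n → Fin N) ℂ := fun i j => ∏ k : Fin n, C (i k) (j k)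

lemma aux_ampl2_map {A : Type*} [Ring A] [Algebra ℂ A] (N n : ℕ)
    (M : Matrix (Fin N × Fin N) (Fin N × Fin N) ℂ) (k : ℕ) :
    ampl2 N n (M.map (algebraMap ℂ A)) k = (ampl2 N n M k).map (algebraMap ℂ A) := by
  ext i j
  simp only [ampl2, Matrix.map_apply]
  split_ifs <;> simp

lemma aux_sum_snoc {A : Type*} [AddCommMonoid A] (N n : ℕ) (f : (Fin (n+1) → Fin N) → A) :
    ∑ i, f i = ∑ i : Fin n → Fin N, ∑ a : Fin N, f (Fin.snoc (α := fun _ => Fin N) i a) := by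
  rw [← (Fin.snocEquiv (fun _ : Fin (n+1) => Fin N)).sum_comp, Fintype.sum_prod_type,
    Finset.sum_comm]
  rfl

lemma aux_sum3' {A α β γ : Type*} [AddCommMonoid A] [Fintype α] [Fintype β] [Fintype γ]
    (f : α → β → γ → A) :
    ∑ a, ∑ b, ∑ c, f a b c = ∑ c, ∑ a, ∑ b, f a b c := by
  have h : ∑ p : α × β, ∑ r : γ, f p.1 p.2 r =
    ∑ r : γ, ∑ p : α × β, f p.1 p.2 r := Finset.sum_comm
  simpa only [Fintype.sum_prod_type] using h

lemma aux_sum4 {A α β γ δ : Type*} [AddCommMonoid A] [Fintype α] [Fintype β] [Fintype γ]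
    [Fintype δ] (f : α → β → γ → δ → A) :
    ∑ a, ∑ b, ∑ c, ∑ d, f a b c d = ∑ c, ∑ d, ∑ a, ∑ b, f a b c d := by
  have h : ∑ p : α × β, ∑ r : γ × δ, f p.1 p.2 r.1 r.2 =
    ∑ r : γ × δ, ∑ p : α × β, f p.1 p.2 r.1 r.2 := Finset.sum_comm
  simpa only [Fintype.sum_prod_type] using h

lemma aux_ampl2_last {A : Type*} [Semiring A] (N m : ℕ)
    (M : Matrix (Fin N × Fin N) (Fin N × Fin N) A) (i j : Fin m → Fin N) (a b c d : Fin N) :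
    ampl2 N (m+2) M m
      (Fin.snoc (α := fun _ => Fin N) (Fin.snoc (α := fun _ => Fin N) i a : Fin (m+1) → Fin N) b)
      (Fin.snoc (α := fun _ => Fin N) (Fin.snoc (α := fun _ => Fin N) j c : Fin (m+1) → Fin N) d)
     = if i = j then M (a, b) (c, d) else 0 := by
  have h1 : (⟨m, by omega⟩ : Fin (m+2)) = Fin.castSucc (Fin.last m) := rfl
  have h2 : (⟨m+1, by omega⟩ : Fin (m+2)) = Fin.last (m+1) := rfl
  unfold ampl2
  rw [dif_pos (by omega)]
  simp only [h1, h2, Fin.snoc_castSucc, Fin.snoc_last]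
  congr 1
  rw [eq_iff_iff]
  constructor
  · intro h
    funext x
    have := h (Fin.castSucc (Fin.castSucc x)) (by simp; omega) (by simp; omega)
    simpa using this
  · rintro rfl x hx hx'
    induction x using Fin.lastCases with
    | last => simp at hx'
    | cast x =>
      induction x using Fin.lastCases with
      | last => simp at hx
      | cast x => simp

lemma aux_snoc2_cases (N m : ℕ) {P : (Fin (m+2) → Fin N) → Prop}
    (h : ∀ (i : Fin m → Fin N) (a b : Fin N), P (Fin.snoc (α := fun _ => Fin N)
      (Fin.snoc (α := fun _ => Fin N) i a : Fin (m+1) → Fin N) b)) (x) : P x := by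
  have := h (Fin.init (Fin.init x)) (Fin.init x (Fin.last _)) (x (Fin.last _))
  rw [Fin.snoc_init_self, Fin.snoc_init_self] at this
  exact this

lemma aux_ampl2_mul (N m : ℕ) (M M' : Matrix (Fin N × Fin N) (Fin N × Fin N) ℂ) :
    ampl2 N (m+2) M m * ampl2 N (m+2) M' m = ampl2 N (m+2) (M * M') m := by
  ext x y
  induction x using aux_snoc2_cases with | h i a b
  induction y using aux_snoc2_cases with | h j c d
  rw [Matrix.mul_apply, aux_sum_snoc, aux_sum_snoc]
  simp only [aux_ampl2_last]
  simp [Matrix.mul_apply, Fintype.sum_prod_type]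

lemma aux_ampl2_one (N m : ℕ) :
    ampl2 N (m+2) (1 : Matrix (Fin N × Fin N) (Fin N × Fin N) ℂ) m = 1 := by
  ext x y
  induction x using aux_snoc2_cases with | h i a b
  induction y using aux_snoc2_cases with | h j c d
  rw [aux_ampl2_last, Matrix.one_apply, Matrix.one_apply]
  simp only [Fin.snoc_inj, Prod.mk.injEq, and_assoc]
  split_ifs <;> simp_all

lemma aux_comm_CC (N m : ℕ) (M : Matrix (Fin N × Fin N) (Fin N × Fin N) ℂ)
    (C : Matrix (Fin N) (Fin N) ℂ)
    (h : ∀ a b c d, ∑ s, ∑ t, M (a, b) (s, t) * (C s c * C t d) =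
      ∑ s, ∑ t, (C a s * C b t) * M (s, t) (c, d)) :
    ampl2 N (m+2) M m * auxCC N (m+2) C = auxCC N (m+2) C * ampl2 N (m+2) M m := by
  ext x y
  induction x using aux_snoc2_cases with | h i a b
  induction y using aux_snoc2_cases with | h j c d
  rw [Matrix.mul_apply, aux_sum_snoc, aux_sum_snoc, Matrix.mul_apply, aux_sum_snoc, aux_sum_snoc]
  simp only [aux_ampl2_last, auxCC, Fin.prod_univ_castSucc (n := m+1),
    Fin.prod_univ_castSucc (n := m), Fin.snoc_castSucc, Fin.snoc_last]
  simp only [ite_mul, zero_mul, mul_ite, mul_zero]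
  have e1 : ∀ k : Fin m → Fin N, ∑ s, ∑ t, (if i = k then
      M (a, b) (s, t) * ((∏ x, C (k x) (j x)) * C s c * C t d) else 0)
      = if i = k then (∏ x, C (k x) (j x)) * ∑ s, ∑ t, M (a, b) (s, t) * (C s c * C t d) else 0 := by
    intro k
    split_ifs
    · simp only [Finset.mul_sum]
      refine Finset.sum_congr rfl fun s _ => Finset.sum_congr rfl fun t _ => by ring
    · simp
  have e2 : ∀ k : Fin m → Fin N, ∑ s, ∑ t, (if k = j then
      ((∏ x, C (i x) (k x)) * C a s * C b t) * M (s, t) (c, d) else 0)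
      = if k = j then (∏ x, C (i x) (k x)) * ∑ s, ∑ t, (C a s * C b t) * M (s, t) (c, d) else 0 := by
    intro k
    split_ifs
    · simp only [Finset.mul_sum]
      refine Finset.sum_congr rfl fun s _ => Finset.sum_congr rfl fun t _ => by ring
    · simp
  simp only [e1, e2, h, Finset.sum_ite_eq, Finset.sum_ite_eq', Finset.mem_univ, if_true]

lemma aux_trRn {A : Type*} [Ring A] [Algebra ℂ A] (N n : ℕ)
    (C : Matrix (Fin N) (Fin N) ℂ) (M : Matrix (Fin n → Fin N) (Fin n → Fin N) A) :
    trRn N n C M = Matrix.trace ((auxCC N n C).map (algebraMap ℂ A) * M) := rfl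

lemma aux_trace_comm {A ι : Type*} [Ring A] [Algebra ℂ A] [Fintype ι] (Z : Matrix ι ι ℂ)
    (M : Matrix ι ι A) : Matrix.trace (Z.map (algebraMap ℂ A) * M) =
      Matrix.trace (M * Z.map (algebraMap ℂ A)) := by
  simp only [Matrix.trace, Matrix.diag, Matrix.mul_apply, Matrix.map_apply]
  rw [Finset.sum_comm]
  refine Finset.sum_congr rfl fun s _ => Finset.sum_congr rfl fun t _ => Algebra.commutes _ _

lemma aux_cyc {A : Type*} [Ring A] [Algebra ℂ A] (N m : ℕ)
    (M M' : Matrix (Fin N × Fin N) (Fin N × Fin N) ℂ) (C : Matrix (Fin N) (Fin N) ℂ)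
    (hM : M' * M = 1)
    (h : ∀ a b c d, ∑ s, ∑ t, M (a, b) (s, t) * (C s c * C t d) =
      ∑ s, ∑ t, (C a s * C b t) * M (s, t) (c, d))
    (Y : Matrix (Fin (m+2) → Fin N) (Fin (m+2) → Fin N) A) :
    trRn N (m+2) C (ampl2 N (m+2) (M.map (algebraMap ℂ A)) m * Y *
      ampl2 N (m+2) (M'.map (algebraMap ℂ A)) m) = trRn N (m+2) C Y := by
  have hc : (auxCC N (m+2) C).map (algebraMap ℂ A) * (ampl2 N (m+2) M m).map (algebraMap ℂ A) =
      (ampl2 N (m+2) M m).map (algebraMap ℂ A) * (auxCC N (m+2) C).map (algebraMap ℂ A) := by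
    rw [← Matrix.map_mul, ← Matrix.map_mul, aux_comm_CC N m M C h]
  have hm : (ampl2 N (m+2) M' m).map (algebraMap ℂ A) *
      (ampl2 N (m+2) M m).map (algebraMap ℂ A) = 1 := by
    rw [← Matrix.map_mul, aux_ampl2_mul, hM, aux_ampl2_one]
    simp
  rw [aux_trRn, aux_trRn, aux_ampl2_map, aux_ampl2_map, ← mul_assoc, ← aux_trace_comm,
    ← mul_assoc (Matrix.map (auxCC N (m+2) C) _), hc, mul_assoc (Matrix.map (ampl2 N (m+2) M m) _),
    ← mul_assoc, hm, one_mul]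

/-- Embedding into one more tensor factor. -/
def auxE {A : Type*} [Ring A] (N n : ℕ) :
    Matrix (Fin n → Fin N) (Fin n → Fin N) A →*
      Matrix (Fin (n+1) → Fin N) (Fin (n+1) → Fin N) A where
  toFun X := Matrix.of fun i j => if i (Fin.last n) = j (Fin.last n) then X (Fin.init i) (Fin.init j) else 0
  map_one' := by
    ext i j
    rw [← Fin.snoc_init_self i, ← Fin.snoc_init_self j]
    simp only [Matrix.of_apply, Matrix.one_apply, Fin.snoc_inj, Fin.snoc_last, Fin.init_snoc]
    split_ifs <;> simp_all
  map_mul' X Y := by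
    ext i j
    rw [Matrix.mul_apply, aux_sum_snoc]
    simp only [Matrix.of_apply, Matrix.mul_apply, Fin.snoc_last, Fin.init_snoc]
    simp

lemma auxE_apply {A : Type*} [Ring A] (N n : ℕ) (X : Matrix (Fin n → Fin N) (Fin n → Fin N) A)
    (i j : Fin n → Fin N) (a b : Fin N) :
    auxE N n X (Fin.snoc (α := fun _ => Fin N) i a) (Fin.snoc (α := fun _ => Fin N) j b) =
      if a = b then X i j else 0 := by
  simp [auxE]

lemma auxE_ampl2 {A : Type*} [Ring A] (N n k : ℕ) (hk : k + 1 < n)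
    (M : Matrix (Fin N × Fin N) (Fin N × Fin N) A) :
    auxE N n (ampl2 N n M k) = ampl2 N (n+1) M k := by
  ext i j
  simp only [auxE, MonoidHom.coe_mk, OneHom.coe_mk, Matrix.of_apply, ampl2]
  rw [dif_pos hk, dif_pos (by omega), ← ite_and]
  congr 1
  rw [eq_iff_iff]
  constructor
  · rintro ⟨h1, h2⟩ x hx hx'
    induction x using Fin.lastCases with
    | last => exact h1
    | cast x => exact h2 x hx hx'
  · intro h
    exact ⟨h _ (by simp; omega) (by simp; omega), fun x hx hx' => h x.castSucc hx hx'⟩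

lemma auxE_ampl1 {A : Type*} [Ring A] (N n k : ℕ) (hk : k < n)
    (M : Matrix (Fin N) (Fin N) A) :
    auxE N n (ampl1 N n M k) = ampl1 N (n+1) M k := by
  ext i j
  simp only [auxE, MonoidHom.coe_mk, OneHom.coe_mk, Matrix.of_apply, ampl1]
  rw [dif_pos hk, dif_pos (by omega), ← ite_and]
  congr 1
  rw [eq_iff_iff]
  constructor
  · rintro ⟨h1, h2⟩ x hx
    induction x using Fin.lastCases with
    | last => exact h1
    | cast x => exact h2 x hx
  · intro h
    exact ⟨h _ (by simp; omega), fun x hx => h x.castSucc hx⟩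

lemma auxE_Lbar {A : Type*} [Ring A] [Algebra ℂ A] (N n : ℕ)
    (R : Matrix (Fin N × Fin N) (Fin N × Fin N) ℂ) (q : ℂ)
    (L : Matrix (Fin N) (Fin N) A) (k : ℕ) (hk : k < n) :
    auxE N n (Lbar N n R q L k) = Lbar N (n+1) R q L k := by
  induction k with
  | zero => exact auxE_ampl1 N n 0 hk L
  | succ k ih =>
    simp only [Lbar, map_mul]
    rw [ih (by omega), auxE_ampl2 _ _ _ hk, auxE_ampl2 _ _ _ hk]

lemma aux_partial {A : Type*} [Ring A] [Algebra ℂ A] (N m : ℕ)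
    (R : Matrix (Fin N × Fin N) (Fin N × Fin N) ℂ) (C : Matrix (Fin N) (Fin N) ℂ)
    (h : ∀ i j, ∑ a, ∑ b, C b a * R (i, a) (j, b) = if i = j then 1 else 0)
    (X Y : Matrix (Fin (m+1) → Fin N) (Fin (m+1) → Fin N) A) :
    trRn N (m+2) C (auxE N (m+1) X * ampl2 N (m+2) (R.map (algebraMap ℂ A)) m * auxE N (m+1) Y) =
      trRn N (m+1) C (X * Y) := by
  have key : ∀ k l : Fin (m+1) → Fin N, ∑ a, ∑ b, C b a * ampl2 N (m+2) R m
      (Fin.snoc (α := fun _ => Fin N) k a) (Fin.snoc (α := fun _ => Fin N) l b) =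
      if k = l then 1 else 0 := by
    intro k l
    rw [← Fin.snoc_init_self k, ← Fin.snoc_init_self l]
    simp only [aux_ampl2_last, Fin.snoc_inj]
    by_cases hk : Fin.init k = Fin.init l
    · simp only [hk, if_true, true_and]
      exact h _ _
    · simp [hk]
  have ent : ∀ (i j : Fin (m+1) → Fin N) (a b : Fin N),
      (auxE N (m+1) X * ampl2 N (m+2) (R.map (algebraMap ℂ A)) m * auxE N (m+1) Y)
        (Fin.snoc (α := fun _ => Fin N) i a) (Fin.snoc (α := fun _ => Fin N) j b) =
      ∑ k, ∑ l, ampl2 N (m+2) R m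
      (Fin.snoc (α := fun _ => Fin N) k a) (Fin.snoc (α := fun _ => Fin N) l b) • (X i k * Y l j) := by
    intro i j a b
    rw [Matrix.mul_apply, aux_sum_snoc, Finset.sum_comm]
    simp only [Matrix.mul_apply (M := auxE N (m+1) X), aux_sum_snoc (n := m+1), auxE_apply,
      aux_ampl2_map, Matrix.map_apply]
    simp only [ite_mul, zero_mul, mul_ite, mul_zero, Finset.sum_ite_eq, Finset.sum_ite_eq',
      Finset.mem_univ, if_true, Finset.sum_mul]
    simp only [Finset.sum_ite_irrel, Finset.sum_const_zero, Finset.sum_ite_eq, Finset.sum_ite_eq',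
      Finset.mem_univ, if_true]
    rw [Finset.sum_comm' (t' := Finset.univ) (s' := fun _ => Finset.univ) (by simp)]
    refine Finset.sum_congr rfl fun k _ => Finset.sum_congr rfl fun l _ => ?_
    rw [← Algebra.commutes, Algebra.smul_def, mul_assoc]
  unfold trRn
  rw [aux_sum_snoc]
  refine Finset.sum_congr rfl fun i _ => ?_
  have e0 : ∀ a, ∑ j', algebraMap ℂ A (∏ k : Fin (m+2),
      C ((Fin.snoc (α := fun _ => Fin N) i a : Fin (m+2) → Fin N) k) (j' k)) *
      (auxE N (m+1) X * ampl2 N (m+2) (R.map (algebraMap ℂ A)) m * auxE N (m+1) Y) j'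
        (Fin.snoc (α := fun _ => Fin N) i a) = _ := fun a => aux_sum_snoc N (m+1) _
  simp only [e0]
  simp only [ent, Fin.prod_univ_castSucc (n := m+1), Fin.snoc_castSucc,
    Fin.snoc_last, ← Algebra.smul_def, Matrix.mul_apply, Finset.smul_sum, smul_smul]
  rw [Finset.sum_comm]
  refine Finset.sum_congr rfl fun j _ => ?_
  have e1 : ∀ k, (∏ x, C (i x) (j x)) • (X j k * Y k i) =
    ∑ l, ((∏ x, C (i x) (j x)) * (∑ a, ∑ b, C b a * ampl2 N (m+2) R m
      (Fin.snoc (α := fun _ => Fin N) k a) (Fin.snoc (α := fun _ => Fin N) l b))) •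
        (X j k * Y l i) := by
    intro k
    simp only [key]
    simp
  simp only [e1, Finset.mul_sum, Finset.sum_smul]
  rw [Finset.sum_comm, aux_sum4]
  simp only [mul_assoc]

lemma aux_main {A : Type*} [Ring A] [Algebra ℂ A] (N : ℕ) (q : ℂ)
    (R : Matrix (Fin N × Fin N) (Fin N × Fin N) ℂ) (C : Matrix (Fin N) (Fin N) ℂ)
    (h : ∀ i j, ∑ a, ∑ b, C b a * R (i, a) (j, b) = if i = j then 1 else 0)
    (hinv : (R - (q - q⁻¹) • 1) * R = 1)
    (hc : ∀ a b c d, ∑ s, ∑ t, R (a, b) (s, t) * (C s c * C t d) =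
      ∑ s, ∑ t, (C a s * C b t) * R (s, t) (c, d))
    (L : Matrix (Fin N) (Fin N) A) (n : ℕ) : ∀ m : ℕ,
    trRn N (n+1) C ((((List.range n).reverse.map
          (fun k => ampl2 N (n+1) (R.map (algebraMap ℂ A)) k)).prod) *
          ((List.range n).map (Lbar N (n+1) R q L)).prod * Lbar N (n+1) R q L n ^ m) =
      trR1 N C (L ^ (n + m)) := by
  induction n with
  | zero =>
    intro m
    have e : ∀ m : ℕ, (ampl1 N 1 L 0) ^ m = Matrix.of fun i j => (L ^ m) (i 0) (j 0) := by
      intro m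
      induction m with
      | zero =>
        ext i j
        simp [Matrix.one_apply, funext_iff]
      | succ m ih =>
        rw [pow_succ, ih]
        ext i j
        rw [Matrix.mul_apply, Matrix.of_apply, pow_succ, Matrix.mul_apply,
          ← (Equiv.funUnique (Fin 1) (Fin N)).sum_comp]
        simp [ampl1]
    simp only [Lbar, e, List.range_zero, List.reverse_nil, List.map_nil, List.prod_nil, one_mul,
      zero_add]
    unfold trRn trR1
    rw [← (Equiv.funUnique (Fin 1) (Fin N)).sum_comp]
    refine Finset.sum_congr rfl fun i _ => ?_
    rw [← (Equiv.funUnique (Fin 1) (Fin N)).sum_comp]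
    refine Finset.sum_congr rfl fun j _ => ?_
    simp
  | succ n ih =>
    intro m
    set Rl := ampl2 N (n+2) (R.map (algebraMap ℂ A)) n with hRl
    set Rm := ampl2 N (n+2) ((R - (q - q⁻¹) • 1).map (algebraMap ℂ A)) n with hRm
    have hRR : Rm * Rl = 1 := by
      rw [hRl, hRm, aux_ampl2_map, aux_ampl2_map, ← Matrix.map_mul, aux_ampl2_mul, hinv,
        aux_ampl2_one]
      simp
    have hRR' : Rl * Rm = 1 := by
      rw [hRl, hRm, aux_ampl2_map, aux_ampl2_map, ← Matrix.map_mul, aux_ampl2_mul,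
        mul_eq_one_comm.mp hinv, aux_ampl2_one]
      simp
    set U := ((List.range n).reverse.map
          (fun k => ampl2 N (n+1) (R.map (algebraMap ℂ A)) k)).prod with hU
    set P := ((List.range n).map (Lbar N (n+1) R q L)).prod with hP
    have eU : ((List.range (n+1)).reverse.map
          (fun k => ampl2 N (n+2) (R.map (algebraMap ℂ A)) k)).prod = Rl * auxE N (n+1) U := by
      rw [List.range_succ, List.reverse_append, List.map_append, List.prod_append, hU,
        map_list_prod, List.map_map]
      congr 1
      · simp [hRl]
      · congr 1
        apply List.map_congr_left
        intro k hk
        simp at hk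
        simp only [Function.comp]
        rw [auxE_ampl2 _ _ _ (by omega)]
    have eP : ((List.range (n+1)).map (Lbar N (n+2) R q L)).prod =
        auxE N (n+1) (P * Lbar N (n+1) R q L n) := by
      rw [List.range_succ, List.map_append, List.prod_append, map_mul, hP,
        map_list_prod, List.map_map, auxE_Lbar _ _ _ _ _ _ (by omega)]
      congr 1
      · congr 1
        apply List.map_congr_left
        intro k hk
        simp at hk
        simp only [Function.comp]
        rw [auxE_Lbar _ _ _ _ _ _ (by omega)]
      · simp
    have eL : ∀ m : ℕ, Lbar N (n+2) R q L (n+1) ^ m =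
        Rl * auxE N (n+1) (Lbar N (n+1) R q L n ^ m) * Rm := by
      intro m
      induction m with
      | zero => simp [hRR']
      | succ m ihm =>
        rw [pow_succ, ihm, pow_succ, map_mul, auxE_Lbar _ _ _ _ _ n (by omega)]
        simp only [Lbar]
        rw [← hRl, ← hRm]
        simp only [mul_assoc]
        rw [← mul_assoc Rm Rl, hRR, one_mul]
    rw [eU, eP, eL]
    have e : Rl * auxE N (n+1) U * auxE N (n+1) (P * Lbar N (n+1) R q L n) *
        (Rl * auxE N (n+1) (Lbar N (n+1) R q L n ^ m) * Rm) =
        Rl * (auxE N (n+1) (U * (P * Lbar N (n+1) R q L n)) * Rl *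
          auxE N (n+1) (Lbar N (n+1) R q L n ^ m)) * Rm := by
      simp only [map_mul, mul_assoc]
    rw [e, hRl, hRm, aux_cyc N n R _ C hinv hc, aux_partial N n R C h]
    have := ih (m+1)
    rw [show n + 1 + m = n + (m+1) by ring, ← this, pow_succ']
    simp only [mul_assoc]

lemma aux_inv (N : ℕ) (q : ℂ) (hq0 : q ≠ 0) (R : Matrix (Fin N × Fin N) (Fin N × Fin N) ℂ)
    (hHecke : (q • (1 : Matrix (Fin N × Fin N) (Fin N × Fin N) ℂ) - R) * (q⁻¹ • 1 + R) = 0) :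
    (R - (q - q⁻¹) • 1) * R = 1 := by
  have e : (R - (q - q⁻¹) • 1) * R - 1 =
      -((q • (1 : Matrix (Fin N × Fin N) (Fin N × Fin N) ℂ) - R) * (q⁻¹ • 1 + R)) := by
    simp only [sub_mul, mul_add, smul_mul_assoc, mul_smul_comm, one_mul, mul_one, sub_smul,
      smul_add, smul_smul, inv_mul_cancel₀ hq0, mul_inv_cancel₀ hq0, one_smul]
    rw [smul_sub, smul_smul, inv_mul_cancel₀ hq0, one_smul]
    abel
  rw [← sub_eq_zero, e, hHecke, neg_zero]

lemma aux_sum3 {A : Type*} [AddCommMonoid A] (N : ℕ) (f : (Fin 3 → Fin N) → A) :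
    ∑ i, f i = ∑ a : Fin N, ∑ b : Fin N, ∑ c : Fin N, f ![a, b, c] := by
  rw [← (Fin.consEquiv (fun _ : Fin 3 => Fin N)).sum_comp, Fintype.sum_prod_type]
  refine Finset.sum_congr rfl fun a _ => ?_
  rw [← (Fin.consEquiv (fun _ : Fin 2 => Fin N)).sum_comp, Fintype.sum_prod_type]
  refine Finset.sum_congr rfl fun b _ => ?_
  rw [← (Equiv.funUnique (Fin 1) (Fin N)).symm.sum_comp]
  refine Finset.sum_congr rfl fun c _ => ?_
  congr 1
  ext x
  fin_cases x <;> rfl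

lemma aux_30 (N : ℕ) (M : Matrix (Fin N × Fin N) (Fin N × Fin N) ℂ) (a b c d e f : Fin N) :
    ampl2 N 3 M 0 ![a, b, c] ![d, e, f] = if c = f then M (a, b) (d, e) else 0 := by
  simp [ampl2, Fin.forall_fin_succ]

lemma aux_31 (N : ℕ) (M : Matrix (Fin N × Fin N) (Fin N × Fin N) ℂ) (a b c d e f : Fin N) :
    ampl2 N 3 M 1 ![a, b, c] ![d, e, f] = if a = d then M (b, c) (e, f) else 0 := by
  simp [ampl2, Fin.forall_fin_succ]

/-- Fact A: the partial R-trace of a conjugation. -/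
lemma aux_factA (N : ℕ) (R S T : Matrix (Fin N × Fin N) (Fin N × Fin N) ℂ) 
    (Ψ : Matrix (Fin N × Fin N) (Fin N × Fin N) ℂ)
    (hΨ' : ∀ a b c d : Fin N, ∑ k : Fin N, ∑ m : Fin N,
        Ψ (a, k) (b, m) * R (m, d) (k, c) = if a = c ∧ b = d then 1 else 0)
    (C : Matrix (Fin N) (Fin N) ℂ)
    (h : ∀ i j, ∑ a, ∑ b, C b a * R (i, a) (j, b) = if i = j then 1 else 0)
    (hST : T * S = 1)
    (hb : ampl2 N 3 S 1 * ampl2 N 3 R 0 * ampl2 N 3 T 1 =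
      ampl2 N 3 T 0 * ampl2 N 3 R 1 * ampl2 N 3 S 0) (i j x y : Fin N) :
    ∑ b, ∑ c, C c b * ∑ s, S (i, b) (x, s) * T (y, s) (j, c) = if i = j then C y x else 0 := by
  have hcomp : ∀ p b r c, ∑ x, ∑ y, R (p, x) (r, y) * ∑ s, S (i, b) (x, s) * T (y, s) (j, c) =
      ∑ u, ∑ v, ∑ w, T (p, i) (u, v) * S (u, w) (r, j) * R (v, b) (w, c) := by
    intro p b r c
    have := congrFun (congrFun hb ![p, i, b]) ![r, j, c]
    simp only [Matrix.mul_apply, aux_sum3, aux_30, aux_31] at this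
    simp only [ite_mul, zero_mul, mul_ite, mul_zero, Finset.sum_ite_eq, Finset.sum_ite_eq',
      Finset.mem_univ, if_true, Finset.sum_mul, Finset.sum_ite_irrel, Finset.sum_const_zero] at this
    rw [aux_sum3'] at this
    simp only [Finset.mul_sum]
    refine Eq.trans ?_ (this.trans ?_)
    · refine Finset.sum_congr rfl fun _ _ => Finset.sum_congr rfl fun _ _ =>
        Finset.sum_congr rfl fun _ _ => by ring
    · refine Finset.sum_congr rfl fun _ _ => ?_
      rw [Finset.sum_comm]
      refine Finset.sum_congr rfl fun _ _ => Finset.sum_congr rfl fun _ _ => by ring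
  have h1 : ∀ p r, ∑ x, ∑ y, R (p, x) (r, y) *
      ∑ b, ∑ c, C c b * ∑ s, S (i, b) (x, s) * T (y, s) (j, c) =
      if p = r ∧ i = j then 1 else 0 := by
    intro p r
    have e1 : ∑ b, ∑ c, C c b * ∑ x, ∑ y, R (p, x) (r, y) *
        ∑ s, S (i, b) (x, s) * T (y, s) (j, c) = ∑ x, ∑ y, R (p, x) (r, y) *
      ∑ b, ∑ c, C c b * ∑ s, S (i, b) (x, s) * T (y, s) (j, c) := by
      simp only [Finset.mul_sum]
      rw [aux_sum4]
      refine Finset.sum_congr rfl fun _ _ => Finset.sum_congr rfl fun _ _ =>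
        Finset.sum_congr rfl fun _ _ => Finset.sum_congr rfl fun _ _ =>
        Finset.sum_congr rfl fun _ _ => by ring
    rw [← e1]
    simp only [hcomp]
    have e2 : ∑ b, ∑ c, C c b * ∑ u, ∑ v, ∑ w, T (p, i) (u, v) * S (u, w) (r, j) *
        R (v, b) (w, c) = ∑ u, ∑ v, ∑ w, T (p, i) (u, v) * S (u, w) (r, j) *
          ∑ b, ∑ c, C c b * R (v, b) (w, c) := by
      simp only [Finset.mul_sum]
      rw [aux_sum4]
      refine Finset.sum_congr rfl fun _ _ => Finset.sum_congr rfl fun _ _ => ?_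
      rw [aux_sum3']
      refine Finset.sum_congr rfl fun _ _ => Finset.sum_congr rfl fun _ _ =>
        Finset.sum_congr rfl fun _ _ => by ring
    rw [e2]
    simp only [h]
    have := congrFun (congrFun hST (p, i)) (r, j)
    simp only [Matrix.mul_apply, Fintype.sum_prod_type, Matrix.one_apply, Prod.mk.injEq] at this
    simpa using this
  have h2 : ∀ p r, ∑ x, ∑ y, R (p, x) (r, y) * (if i = j then C y x else 0) =
      if p = r ∧ i = j then 1 else 0 := by
    intro p r
    by_cases hij : i = j
    · simp only [hij, if_true, and_true, ← h]
      simp only [mul_comm]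
    · simp [hij]
  have h3 : ∀ F : Fin N → Fin N → ℂ, F x y = ∑ r, ∑ p, Ψ (y, r) (x, p) *
      ∑ x, ∑ y, R (p, x) (r, y) * F x y := by
    intro F
    simp only [Finset.mul_sum]
    rw [aux_sum4]
    simp only [← mul_assoc, ← Finset.sum_mul, hΨ']
    simp [ite_and]
  rw [h3 (fun x y => ∑ b, ∑ c, C c b * ∑ s, S (i, b) (x, s) * T (y, s) (j, c)),
    h3 (fun x y => if i = j then C y x else 0)]
  simp only [h1, h2]

end Aux

/-- Tr_{R(1…n)}( R_{n−1} ⋯ R₁ · L̂_{\bar{1→n}} ) = Tr_R( L̂ⁿ ) in the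
modified RE algebra L̂(R). -/
theorem statement_9 (N : ℕ) (hN : 1 ≤ N) (q : ℂ) (hq0 : q ≠ 0) (hq1 : q ≠ 1) (hqm1 : q ≠ -1)
    (R : Matrix (Fin N × Fin N) (Fin N × Fin N) ℂ)
    (hbraid : ampl2 N 3 R 0 * ampl2 N 3 R 1 * ampl2 N 3 R 0 =
      ampl2 N 3 R 1 * ampl2 N 3 R 0 * ampl2 N 3 R 1)
    (hHecke : (q • (1 : Matrix (Fin N × Fin N) (Fin N × Fin N) ℂ) - R) * (q⁻¹ • 1 + R) = 0)
    (Ψ : Matrix (Fin N × Fin N) (Fin N × Fin N) ℂ)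
    (hΨ : ∀ i j k m : Fin N, ∑ a : Fin N, ∑ b : Fin N,
        R (i, b) (j, a) * Ψ (a, k) (b, m) = if i = m ∧ k = j then 1 else 0)
    (C : Matrix (Fin N) (Fin N) ℂ)
    (hC : ∀ i j : Fin N, C i j = ∑ k : Fin N, Ψ (i, k) (j, k))
    (n : ℕ) (hn : 1 ≤ n) :
    trRn N n C
      ((((List.range (n - 1)).reverse.map
          (fun k => ampl2 N n (R.map (algebraMap ℂ (MREA N R))) k)).prod) *
        Ltot N n R q (Lhatgen N R)) =
      trR1 N C (Lhatgen N R ^ n) := by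
  obtain ⟨n, rfl⟩ : ∃ k, n = k + 1 := ⟨n - 1, by omega⟩
  have hinv := aux_inv N q hq0 R hHecke
  have h : ∀ i j, ∑ a, ∑ b, C b a * R (i, a) (j, b) = if i = j then 1 else 0 := by
    intro i j
    have h1 : ∑ k, ∑ a : Fin N, ∑ b : Fin N, R (i, b) (j, a) * Ψ (a, k) (b, k) =
        ∑ k, if i = k ∧ k = j then 1 else 0 := Finset.sum_congr rfl fun k _ => hΨ i j k k
    have h2 : (∑ k, if i = k ∧ k = j then (1 : ℂ) else 0) = if i = j then 1 else 0 := by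
      simp [ite_and]
    rw [← h2, ← h1]
    simp only [hC, Finset.sum_mul]
    rw [Finset.sum_comm]
    refine Eq.trans ?_ (aux_sum3' _)
    refine Finset.sum_congr rfl fun a _ => Finset.sum_congr rfl fun b _ =>
      Finset.sum_congr rfl fun k _ => mul_comm _ _
  have hΨ' : ∀ a b c d : Fin N, ∑ k : Fin N, ∑ m : Fin N,
        Ψ (a, k) (b, m) * R (m, d) (k, c) = if a = c ∧ b = d then 1 else 0 := by
    let Rt : Matrix (Fin N × Fin N) (Fin N × Fin N) ℂ := Matrix.of fun p r => R (p.1, r.2) (p.2, r.1)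
    let Ps : Matrix (Fin N × Fin N) (Fin N × Fin N) ℂ := Matrix.of fun p r => Ψ (p.1, r.2) (p.2, r.1)
    have h1 : Rt * Ps = 1 := by
      ext ⟨i, j⟩ ⟨m, k⟩
      simp only [Matrix.mul_apply, Fintype.sum_prod_type, Rt, Ps, Matrix.of_apply, hΨ,
        Matrix.one_apply, Prod.mk.injEq, eq_comm]
    have h2 := mul_eq_one_comm.mp h1
    intro a b c d
    have h3 := congrFun (congrFun h2 (a, b)) (c, d)
    simp only [Matrix.mul_apply, Fintype.sum_prod_type, Rt, Ps, Matrix.of_apply,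
        Matrix.one_apply, Prod.mk.injEq] at h3
    rw [Finset.sum_comm, h3]
  set Q := R - (q - q⁻¹) • 1 with hQ
  have hinv' := mul_eq_one_comm.mp hinv
  have a1 := aux_ampl2_mul N 1 Q R
  have a2 := aux_ampl2_mul N 1 R Q
  rw [hinv, aux_ampl2_one] at a1
  rw [hinv', aux_ampl2_one] at a2
  have b1 := congrArg (auxE N 2) (aux_ampl2_mul N 0 Q R)
  have b2 := congrArg (auxE N 2) (aux_ampl2_mul N 0 R Q)
  rw [hinv, aux_ampl2_one, map_mul, map_one, auxE_ampl2 _ _ _ (by omega),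
    auxE_ampl2 _ _ _ (by omega)] at b1
  rw [hinv', aux_ampl2_one, map_mul, map_one, auxE_ampl2 _ _ _ (by omega),
    auxE_ampl2 _ _ _ (by omega)] at b2
  simp only [Nat.reduceAdd, zero_add] at a1 a2 b1 b2
  have hp : ampl2 N 3 R 1 * ampl2 N 3 R 0 * ampl2 N 3 Q 1 =
      ampl2 N 3 Q 0 * ampl2 N 3 R 1 * ampl2 N 3 R 0 := by
    generalize ampl2 N 3 R 0 = r0 at *
    generalize ampl2 N 3 R 1 = r1 at *
    generalize ampl2 N 3 Q 0 = q0 at *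
    generalize ampl2 N 3 Q 1 = q1 at *
    calc r1 * r0 * q1 = (q0 * r0) * (r1 * r0 * q1) := by rw [b1, one_mul]
      _ = q0 * (r0 * r1 * r0) * q1 := by simp only [mul_assoc]
      _ = q0 * r1 * r0 * (r1 * q1) := by rw [hbraid]; simp only [mul_assoc]
      _ = q0 * r1 * r0 := by rw [a2, mul_one]
  have hm : ampl2 N 3 Q 1 * ampl2 N 3 R 0 * ampl2 N 3 R 1 =
      ampl2 N 3 R 0 * ampl2 N 3 R 1 * ampl2 N 3 Q 0 := by
    generalize ampl2 N 3 R 0 = r0 at *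
    generalize ampl2 N 3 R 1 = r1 at *
    generalize ampl2 N 3 Q 0 = q0 at *
    generalize ampl2 N 3 Q 1 = q1 at *
    calc q1 * r0 * r1 = (q1 * r0 * r1) * (r0 * q0) := by rw [b2, mul_one]
      _ = q1 * (r0 * r1 * r0) * q0 := by simp only [mul_assoc]
      _ = (q1 * r1) * r0 * r1 * q0 := by rw [hbraid]; simp only [mul_assoc]
      _ = r0 * r1 * q0 := by rw [a1, one_mul]
  have hA := aux_factA N R R Q Ψ hΨ' C h hinv hp
  have hB := aux_factA N R Q R Ψ hΨ' C h hinv' hm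
  have hA' : ∀ y s j b, ∑ c, Q (y, s) (j, c) * C c b = ∑ x, C y x * Ψ (s, x) (b, j) := by
    intro y s j b
    have e1 : ∑ x, ∑ i, Ψ (s, x) (b, i) * ∑ b', ∑ c, C c b' * ∑ s', R (i, b') (x, s') *
        Q (y, s') (j, c) = ∑ x, C y x * Ψ (s, x) (b, j) := by
      simp only [hA]
      simp [mul_comm]
    rw [← e1]
    have e2 : ∀ x i, ∑ b', ∑ c, C c b' * ∑ s', R (i, b') (x, s') * Q (y, s') (j, c) =
        ∑ b', ∑ s', R (i, b') (x, s') * ∑ c, Q (y, s') (j, c) * C c b' := by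
      intro x i
      simp only [Finset.mul_sum]
      refine Finset.sum_congr rfl fun b' _ => ?_
      rw [Finset.sum_comm]
      refine Finset.sum_congr rfl fun _ _ => Finset.sum_congr rfl fun _ _ => by ring
    simp only [e2]
    have h3 : ∀ F : Fin N → Fin N → ℂ, ∑ x, ∑ i, Ψ (s, x) (b, i) *
        ∑ b', ∑ s', R (i, b') (x, s') * F b' s' = F b s := by
      intro F
      simp only [Finset.mul_sum]
      rw [aux_sum4]
      simp only [← mul_assoc, ← Finset.sum_mul, hΨ']
      simp [ite_and]
    exact (h3 (fun b' s' => ∑ c, Q (y, s') (j, c) * C c b')).symm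
  have hB' : ∀ c i x s, ∑ b, C c b * Q (i, b) (x, s) = ∑ y, Ψ (c, i) (s, y) * C y x := by
    intro c i x s
    have e1 : ∑ j, ∑ y, Ψ (c, j) (s, y) * ∑ b, ∑ c', C c' b * ∑ s', Q (i, b) (x, s') *
        R (y, s') (j, c') = ∑ y, Ψ (c, i) (s, y) * C y x := by
      simp only [hB]
      simp [Finset.sum_ite_irrel]
    rw [← e1]
    have e2 : ∀ j y, ∑ b, ∑ c', C c' b * ∑ s', Q (i, b) (x, s') * R (y, s') (j, c') =
        ∑ s', ∑ c', R (y, s') (j, c') * ∑ b, C c' b * Q (i, b) (x, s') := by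
      intro j y
      simp only [Finset.mul_sum]
      rw [aux_sum3']
      refine Finset.sum_congr rfl fun _ _ => ?_
      rw [Finset.sum_comm]
      refine Finset.sum_congr rfl fun _ _ => Finset.sum_congr rfl fun _ _ => by ring
    simp only [e2]
    have h3 : ∀ F : Fin N → Fin N → ℂ, ∑ j, ∑ y, Ψ (c, j) (s, y) *
        ∑ s', ∑ c', R (y, s') (j, c') * F s' c' = F s c := by
      intro F
      simp only [Finset.mul_sum]
      rw [aux_sum4]
      simp only [← mul_assoc, ← Finset.sum_mul, hΨ']
      simp [ite_and]
    exact (h3 (fun s' c' => ∑ b, C c' b * Q (i, b) (x, s'))).symm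
  let K : Matrix (Fin N × Fin N) (Fin N × Fin N) ℂ := Matrix.of fun p r => C p.1 r.1 * C p.2 r.2
  have hQK : Q * K = K * Q := by
    ext ⟨a, b⟩ ⟨c, d⟩
    simp only [Matrix.mul_apply, Fintype.sum_prod_type, K, Matrix.of_apply]
    have e1 : ∀ s, ∑ t, Q (a, b) (s, t) * (C s c * C t d) =
        C s c * ∑ x, C a x * Ψ (b, x) (d, s) := by
      intro s
      rw [← hA', Finset.mul_sum]
      exact Finset.sum_congr rfl fun t _ => by ring
    have e2 : ∀ s, ∑ t, C a s * C b t * Q (s, t) (c, d) =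
        C a s * ∑ y, Ψ (b, s) (d, y) * C y c := by
      intro s
      rw [← hB', Finset.mul_sum]
      exact Finset.sum_congr rfl fun t _ => by ring
    simp only [e1, e2, Finset.mul_sum]
    rw [Finset.sum_comm]
    refine Finset.sum_congr rfl fun _ _ => Finset.sum_congr rfl fun _ _ => by ring
  have hRK : R * K = K * R := by
    calc R * K = R * K * (Q * R) := by rw [hinv, mul_one]
      _ = R * (K * Q) * R := by simp only [mul_assoc]
      _ = (R * Q) * K * R := by rw [← hQK]; simp only [mul_assoc]
      _ = K * R := by rw [hinv', one_mul]
  have hc : ∀ a b c d, ∑ s, ∑ t, R (a, b) (s, t) * (C s c * C t d) =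
      ∑ s, ∑ t, (C a s * C b t) * R (s, t) (c, d) := by
    intro a b c d
    have := congrFun (congrFun hRK (a, b)) (c, d)
    simpa only [Matrix.mul_apply, Fintype.sum_prod_type, K, Matrix.of_apply] using this
  have := aux_main N q R C h hinv hc (Lhatgen N R) n 1
  rw [← this, Ltot, List.range_succ, List.map_append, List.prod_append]
  simp [mul_assoc]
end

section
/- Let R be a skew-invertible Hecke symmetry on V = ℂ^N with parameter q (q ≠ 0, q ≠ ±1) and let L(R) be the associated reflection equation algebra with generating matrix L. For every n ≥ 2, Tr_{R(1…n)}( L_{\bar{1→n}} · R₁ R₂ ⋯ R_{n−1} ) = Tr_R( L^n ); in particular the weight system of L(R) takes the same value on the Hecke algebra elements τ₁τ₂⋯τ_{n−1} and τ_{n−1}⋯τ₂τ₁. -/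
open scoped BigOperators

set_option linter.unusedSectionVars false
set_option linter.unusedDecidableInType false
section AmpSection
open Classical in
/-- Amplification of an operator along a map of positions. -/
noncomputable def amp {A : Type*} [Semiring A] {ι κ α : Type*} (e : ι → κ)
    (M : Matrix (ι → α) (ι → α) A) : Matrix (κ → α) (κ → α) A := fun i j =>
  if ∀ m, m ∉ Set.range e → i m = j m then M (fun x => i (e x)) (fun x => j (e x)) else 0

variable {A : Type*} [Semiring A] {ι κ μ α : Type*} [Fintype ι] [Fintype κ] [Fintype μ] [Fintype α]
  [DecidableEq ι] [DecidableEq κ] [DecidableEq μ] [DecidableEq α]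

open Classical in
lemma sum_off {e : ι → κ} (he : Function.Injective e) (l : κ → α) (F : (κ → α) → A) :
    (∑ j : κ → α, if ∀ m, m ∉ Set.range e → j m = l m then F j else 0) =
      ∑ j' : ι → α, F (Function.extend e j' l) := by
  rw [← Finset.sum_filter]
  symm
  refine Finset.sum_bij (fun j' _ => Function.extend e j' l) ?_ ?_ ?_ ?_
  · intro j' _
    simp only [Finset.mem_filter, Finset.mem_univ, true_and]
    intro m hm
    exact Function.extend_apply' _ _ _ (fun ⟨a, ha⟩ => hm ⟨a, ha⟩)
  · intro a _ b _ h
    funext x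
    have := congrFun h (e x)
    simpa [he.extend_apply] using this
  · intro b hb
    simp only [Finset.mem_filter, Finset.mem_univ, true_and] at hb
    refine ⟨fun x => b (e x), Finset.mem_univ _, ?_⟩
    funext m
    by_cases hm : m ∈ Set.range e
    · obtain ⟨x, rfl⟩ := hm
      rw [he.extend_apply]
    · rw [hb m hm]
      exact Function.extend_apply' _ _ _ (fun ⟨a, ha⟩ => hm ⟨a, ha⟩)
  · intros; rfl

lemma ext_off {e : ι → κ} (l : κ → α) (j' : ι → α) {m : κ} (hm : m ∉ Set.range e) :
    Function.extend e j' l m = l m :=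
  Function.extend_apply' _ _ _ (fun ⟨a, ha⟩ => hm ⟨a, ha⟩)

/-- right multiplication by an amplified matrix -/
lemma mul_amp {e : ι → κ} (he : Function.Injective e) (X : Matrix (κ → α) (κ → α) A)
    (M : Matrix (ι → α) (ι → α) A) (i l : κ → α) :
    (X * amp e M) i l = ∑ j' : ι → α, X i (Function.extend e j' l) * M j' (fun x => l (e x)) := by
  classical
  rw [Matrix.mul_apply]
  simp only [amp, mul_ite, mul_zero]
  rw [sum_off he]
  simp [he.extend_apply]

lemma amp_mul' {e : ι → κ} (he : Function.Injective e) (X : Matrix (κ → α) (κ → α) A)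
    (M : Matrix (ι → α) (ι → α) A) (i l : κ → α) :
    (amp e M * X) i l = ∑ j' : ι → α, M (fun x => i (e x)) j' * X (Function.extend e j' i) l := by
  classical
  rw [Matrix.mul_apply]
  simp only [amp, ite_mul, zero_mul, eq_comm (a := i _)]
  rw [sum_off he]
  simp [he.extend_apply]

lemma amp_mul {e : ι → κ} (he : Function.Injective e) (M M' : Matrix (ι → α) (ι → α) A) :
    amp e (M * M') = amp e M * amp e M' := by
  classical
  ext i l
  rw [mul_amp he]
  unfold amp
  have : ∀ j' : ι → α, (∀ m, m ∉ Set.range e → i m = Function.extend e j' l m) ↔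
      (∀ m, m ∉ Set.range e → i m = l m) := fun j' =>
    forall₂_congr fun m hm => by rw [ext_off _ _ hm]
  simp only [this, he.extend_apply]
  split_ifs
  · rw [Matrix.mul_apply]
  · simp

lemma amp_one {e : ι → κ} : amp e (1 : Matrix (ι → α) (ι → α) A) = 1 := by
  classical
  ext i l
  unfold amp
  by_cases h : i = l
  · subst h; simp
  · rw [Matrix.one_apply_ne h]
    split_ifs with h1
    · rw [Matrix.one_apply_ne]
      intro h2
      apply h
      funext m
      by_cases hm : m ∈ Set.range e
      · obtain ⟨x, rfl⟩ := hm
        exact congrFun h2 x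
      · exact h1 m hm
    · rfl

lemma amp_amp (e : ι → κ) (f : κ → μ) (hf : Function.Injective f) (M : Matrix (ι → α) (ι → α) A) :
    amp f (amp e M) = amp (fun x => f (e x)) M := by
  classical
  ext i l
  unfold amp
  by_cases h : ∀ m, m ∉ Set.range (fun x => f (e x)) → i m = l m
  · rw [if_pos h, if_pos, if_pos]
    · intro m hm
      apply h
      rintro ⟨x, hx⟩
      exact hm ⟨x, hf hx⟩
    · intro m hm
      apply h
      rintro ⟨x, hx⟩
      exact hm ⟨_, hx⟩
  · rw [if_neg h]
    split_ifs with h1 h2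
    · exfalso
      apply h
      intro m hm
      by_cases hmf : m ∈ Set.range f
      · obtain ⟨x, rfl⟩ := hmf
        apply h2
        rintro ⟨y, rfl⟩
        exact hm ⟨y, rfl⟩
      · exact h1 m hmf
    · rfl
    · rfl

lemma amp_comm {ι' : Type*} [Fintype ι'] [DecidableEq ι'] {e : ι → κ} {f : ι' → κ}
    (he : Function.Injective e) (hf : Function.Injective f)
    (hd : ∀ x y, e x ≠ f y) (X : Matrix (ι → α) (ι → α) A) (Y : Matrix (ι' → α) (ι' → α) A)
    (hXY : ∀ i j k l, X i j * Y k l = Y k l * X i j) :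
    amp e X * amp f Y = amp f Y * amp e X := by
  classical
  have nf : ∀ x, f x ∉ Set.range e := fun x ⟨y, hy⟩ => hd y x hy
  ext i l
  rw [mul_amp hf, mul_amp he]
  have key : ∀ (x : ι' → α), amp e X i (Function.extend f x l) * Y x (fun x => l (f x)) =
      if x = (fun y => i (f y)) then
        (if ∀ m, m ∉ Set.range e → m ∉ Set.range f → i m = l m then
        X (fun x => i (e x)) (fun x => l (e x)) * Y (fun x => i (f x)) (fun x => l (f x)) else 0)
      else 0 := by
    intro x
    unfold amp
    by_cases hx : x = (fun y => i (f y))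
    · subst hx
      rw [if_pos rfl, ite_mul, zero_mul]
      have e1 : (fun x => Function.extend f (fun y => i (f y)) l (e x)) = fun x => l (e x) := by
        funext x
        exact ext_off _ _ (fun ⟨y, hy⟩ => hd x y hy.symm)
      rw [e1]
      congr 1
      apply propext
      refine forall₂_congr fun m hm => ?_
      by_cases hmf : m ∈ Set.range f
      · obtain ⟨y, rfl⟩ := hmf
        simp [hf.extend_apply]
      · rw [ext_off _ _ hmf]
        simp only [hmf, not_false_eq_true, true_imp_iff]
    · rw [if_neg hx, if_neg, zero_mul]
      intro h
      apply hx
      funext y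
      rw [h _ (nf y), hf.extend_apply]
  have nf' : ∀ x, e x ∉ Set.range f := fun x ⟨y, hy⟩ => hd x y hy.symm
  have key' : ∀ (x : ι → α), amp f Y i (Function.extend e x l) * X x (fun x => l (e x)) =
      if x = (fun y => i (e y)) then
        (if ∀ m, m ∉ Set.range e → m ∉ Set.range f → i m = l m then
        X (fun x => i (e x)) (fun x => l (e x)) * Y (fun x => i (f x)) (fun x => l (f x)) else 0)
      else 0 := by
    intro x
    unfold amp
    by_cases hx : x = (fun y => i (e y))
    · subst hx
      rw [if_pos rfl, ite_mul, zero_mul, hXY]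
      have e1 : (fun x => Function.extend e (fun y => i (e y)) l (f x)) = fun x => l (f x) := by
        funext x
        exact ext_off _ _ (fun ⟨y, hy⟩ => hd y x hy)
      rw [e1]
      congr 1
      apply propext
      refine forall_congr' fun m => ?_
      by_cases hmf : m ∈ Set.range e
      · obtain ⟨y, rfl⟩ := hmf
        simp [he.extend_apply]
      · rw [ext_off _ _ hmf]
        simp only [hmf, not_false_eq_true, true_imp_iff]
    · rw [if_neg hx, if_neg, zero_mul]
      intro h
      apply hx
      funext y
      rw [h _ (nf' y), he.extend_apply]
  simp only [key, key', Finset.sum_ite_eq', Finset.mem_univ, if_true]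

end AmpSection

/-- Tensor power of C. -/
def Cpow {ι α : Type*} [Fintype ι] (C : Matrix α α ℂ) : Matrix (ι → α) (ι → α) ℂ :=
  fun i j => ∏ k, C (i k) (j k)

lemma Cpow_split {ι κ α : Type*} [Fintype ι] [Fintype κ] [DecidableEq κ] {e : ι → κ}
    (he : Function.Injective e) (C : Matrix α α ℂ) (i j : κ → α) :
    Cpow C i j = (∏ m ∈ Finset.univ \ Finset.univ.map ⟨e, he⟩, C (i m) (j m)) *
      Cpow C (fun x => i (e x)) (fun x => j (e x)) := by
  unfold Cpow
  rw [← Finset.prod_sdiff (Finset.subset_univ (Finset.univ.map ⟨e, he⟩)), Finset.prod_map]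
  rfl

lemma Cpow_comm {ι κ α : Type*} [Fintype ι] [Fintype κ] [Fintype α] [DecidableEq ι]
    [DecidableEq κ] [DecidableEq α] {e : ι → κ}
    (he : Function.Injective e) (C : Matrix α α ℂ) (M : Matrix (ι → α) (ι → α) ℂ)
    (h : Cpow C * M = M * Cpow C) :
    Cpow C * amp e M = amp e M * Cpow C := by
  classical
  ext i l
  rw [mul_amp he, amp_mul' he]
  have h1 : ∀ j', Cpow C i (Function.extend e j' l) =
      (∏ m ∈ Finset.univ \ Finset.univ.map ⟨e, he⟩, C (i m) (l m)) *
      Cpow C (fun x => i (e x)) j' := by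
    intro j'
    rw [Cpow_split he]
    simp only [he.extend_apply]
    congr 1
    refine Finset.prod_congr rfl fun m hm => ?_
    rw [ext_off]
    rintro ⟨x, rfl⟩
    simp at hm
  have h2 : ∀ j', Cpow C (Function.extend e j' i) l =
      (∏ m ∈ Finset.univ \ Finset.univ.map ⟨e, he⟩, C (i m) (l m)) *
      Cpow C j' (fun x => l (e x)) := by
    intro j'
    rw [Cpow_split he]
    simp only [he.extend_apply]
    congr 1
    refine Finset.prod_congr rfl fun m hm => ?_
    rw [ext_off]
    rintro ⟨x, rfl⟩
    simp at hm
  have h3 := congrFun (congrFun h (fun x => i (e x))) (fun x => l (e x))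
  rw [Matrix.mul_apply, Matrix.mul_apply] at h3
  simp only [h1, h2, mul_assoc, mul_left_comm _ (Finset.prod _ _)]
  rw [← Finset.mul_sum, ← Finset.mul_sum, h3]

section IndexSection
variable {N : ℕ}

lemma sum_fin3 {β : Type*} [AddCommMonoid β] (F : (Fin 3 → Fin N) → β) :
    ∑ j, F j = ∑ a, ∑ b, ∑ c, F ![a, b, c] := by
  rw [← (Fin.consEquiv (fun _ => Fin N)).sum_comp, Fintype.sum_prod_type]
  refine Finset.sum_congr rfl fun a _ => ?_
  rw [← (Fin.consEquiv (fun _ => Fin N)).sum_comp, Fintype.sum_prod_type]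
  refine Finset.sum_congr rfl fun b _ => ?_
  rw [← (Fin.consEquiv (fun _ => Fin N)).sum_comp, Fintype.sum_prod_type]
  refine Finset.sum_congr rfl fun c _ => ?_
  rw [Fintype.sum_unique]
  rfl

lemma ampl2_30 (M : Matrix (Fin N × Fin N) (Fin N × Fin N) ℂ) (a b c d e f : Fin N) :
    ampl2 N 3 M 0 ![a, b, c] ![d, e, f] = if c = f then M (a, b) (d, e) else 0 := by
  unfold ampl2
  simp [Fin.forall_fin_succ]

lemma ampl2_31 (M : Matrix (Fin N × Fin N) (Fin N × Fin N) ℂ) (a b c d e f : Fin N) :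
    ampl2 N 3 M 1 ![a, b, c] ![d, e, f] = if a = d then M (b, c) (e, f) else 0 := by
  unfold ampl2
  simp [Fin.forall_fin_succ]

lemma prod_010 (M P Q : Matrix (Fin N × Fin N) (Fin N × Fin N) ℂ) (a b c d e f : Fin N) :
    (ampl2 N 3 M 0 * ampl2 N 3 P 1 * ampl2 N 3 Q 0) ![a, b, c] ![d, e, f] =
      ∑ x, ∑ y, ∑ z, M (a, b) (x, y) * P (y, c) (z, f) * Q (x, z) (d, e) := by
  simp only [Matrix.mul_apply, sum_fin3, ampl2_30, ampl2_31]
  simp [Finset.sum_mul]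
  refine Finset.sum_congr rfl fun x _ => ?_
  rw [Finset.sum_comm]

lemma prod_101 (M P Q : Matrix (Fin N × Fin N) (Fin N × Fin N) ℂ) (a b c d e f : Fin N) :
    (ampl2 N 3 M 1 * ampl2 N 3 P 0 * ampl2 N 3 Q 1) ![a, b, c] ![d, e, f] =
      ∑ x, ∑ y, ∑ z, M (b, c) (x, y) * P (a, x) (d, z) * Q (z, y) (e, f) := by
  simp only [Matrix.mul_apply, sum_fin3, ampl2_30, ampl2_31]
  simp [Finset.sum_mul]
  rw [Finset.sum_comm_cycle]
  refine Finset.sum_congr rfl fun x _ => ?_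
  rw [Finset.sum_comm]

lemma skew_inj (R Ψ : Matrix (Fin N × Fin N) (Fin N × Fin N) ℂ)
    (hΨ : ∀ i j k m : Fin N, ∑ a : Fin N, ∑ b : Fin N,
        R (i, b) (j, a) * Ψ (a, k) (b, m) = if i = m ∧ k = j then 1 else 0)
    (F G : Fin N → Fin N → ℂ)
    (h : ∀ i j, ∑ a, ∑ b, R (i, b) (j, a) * F a b = ∑ a, ∑ b, R (i, b) (j, a) * G a b) (a b) :
    F a b = G a b := by
  let M : Matrix (Fin N × Fin N) (Fin N × Fin N) ℂ := fun p r => R (p.1, r.2) (p.2, r.1)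
  let P : Matrix (Fin N × Fin N) (Fin N × Fin N) ℂ := fun p r => Ψ (p.1, r.2) (p.2, r.1)
  have h1 : M * P = 1 := by
    ext ⟨i, j⟩ ⟨m, k⟩
    rw [Matrix.mul_apply, Fintype.sum_prod_type, Matrix.one_apply]
    simp only [M, P]
    rw [hΨ]
    simp [Prod.ext_iff, eq_comm]
  have h2 : P * M = 1 := mul_eq_one_comm.mp h1
  have h3 : M.mulVec (fun p => F p.1 p.2) = M.mulVec (fun p => G p.1 p.2) := by
    funext ⟨i, j⟩
    simpa [Matrix.mulVec, dotProduct, Fintype.sum_prod_type, M] using h i j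
  have h4 := congrArg P.mulVec h3
  rw [Matrix.mulVec_mulVec, Matrix.mulVec_mulVec, h2, Matrix.one_mulVec, Matrix.one_mulVec] at h4
  exact congrFun h4 (a, b)

lemma trC (R Ψ : Matrix (Fin N × Fin N) (Fin N × Fin N) ℂ)
    (hΨ : ∀ i j k m : Fin N, ∑ a : Fin N, ∑ b : Fin N,
        R (i, b) (j, a) * Ψ (a, k) (b, m) = if i = m ∧ k = j then 1 else 0)
    (C : Matrix (Fin N) (Fin N) ℂ)
    (hC : ∀ i j : Fin N, C i j = ∑ k : Fin N, Ψ (i, k) (j, k)) (i j : Fin N) :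
    ∑ a, ∑ b, R (i, b) (j, a) * C a b = if i = j then 1 else 0 := by
  simp only [hC, Finset.mul_sum]
  rw [Finset.sum_comm_cycle]
  simp only [hΨ]
  simp only [ite_and]
  simp

/-- the contraction identity behind the partial trace formulas -/
lemma contr (R Ψ : Matrix (Fin N × Fin N) (Fin N × Fin N) ℂ)
    (hΨ : ∀ i j k m : Fin N, ∑ a : Fin N, ∑ b : Fin N,
        R (i, b) (j, a) * Ψ (a, k) (b, m) = if i = m ∧ k = j then 1 else 0)
    (C : Matrix (Fin N) (Fin N) ℂ)
    (hC : ∀ i j : Fin N, C i j = ∑ k : Fin N, Ψ (i, k) (j, k))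
    (X Y : Matrix (Fin N × Fin N) (Fin N × Fin N) ℂ)
    (X' Y' : Matrix (Fin N × Fin N) (Fin N × Fin N) ℂ) (hXY : X' * Y' = 1)
    (hb : ampl2 N 3 X 1 * ampl2 N 3 R 0 * ampl2 N 3 Y 1 =
      ampl2 N 3 X' 0 * ampl2 N 3 R 1 * ampl2 N 3 Y' 0) (i j u v : Fin N) :
    ∑ x, ∑ y, ∑ z, C x y * X (i, y) (u, z) * Y (v, z) (j, x) = if i = j then C v u else 0 := by
  refine skew_inj R Ψ hΨ (fun v u => ∑ x, ∑ y, ∑ z, C x y * X (i, y) (u, z) * Y (v, z) (j, x))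
    (fun v u => if i = j then C v u else 0) ?_ v u
  intro k l
  have key : ∑ x, ∑ y, C x y * (ampl2 N 3 X 1 * ampl2 N 3 R 0 * ampl2 N 3 Y 1) ![k, i, y] ![l, j, x]
    = ∑ x, ∑ y, C x y * (ampl2 N 3 X' 0 * ampl2 N 3 R 1 * ampl2 N 3 Y' 0) ![k, i, y] ![l, j, x] := by
    rw [hb]
  have rhs : ∑ x, ∑ y, C x y *
      (ampl2 N 3 X' 0 * ampl2 N 3 R 1 * ampl2 N 3 Y' 0) ![k, i, y] ![l, j, x] =
      if k = l then (if i = j then 1 else 0) else 0 := by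
    simp only [prod_010]
    calc _ = ∑ a, ∑ b, ∑ c, X' (k, i) (a, b) * (∑ x, ∑ y, R (b, y) (c, x) * C x y) *
          Y' (a, c) (l, j) := by
          simp only [Finset.mul_sum, Finset.sum_mul]
          simp only [← Fintype.sum_prod_type']
          refine Fintype.sum_equiv
            ⟨fun p => (p.2.2.1, p.2.2.2.1, p.2.2.2.2, p.1, p.2.1),
              fun p => (p.2.2.2.1, p.2.2.2.2, p.1, p.2.1, p.2.2.1), fun _ => rfl, fun _ => rfl⟩ _ _ ?_
          rintro ⟨x, y, a, b, c⟩
          simp only [Equiv.coe_fn_mk]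
          ring
      _ = (X' * Y') (k, i) (l, j) := by
          simp only [trC R Ψ hΨ C hC]
          simp [Matrix.mul_apply, Fintype.sum_prod_type]
      _ = _ := by
          rw [hXY, Matrix.one_apply]
          simp [Prod.ext_iff, ite_and]
  rw [rhs] at key
  have r2 : ∑ a, ∑ b, R (k, b) (l, a) * (if i = j then C a b else 0) =
      if k = l then (if i = j then 1 else 0) else 0 := by
    split_ifs with h1 h2 h2
    · rw [trC R Ψ hΨ C hC, if_pos h2]
    · rw [trC R Ψ hΨ C hC, if_neg h2]
    · simp
    · simp
  rw [r2, ← key]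
  simp only [prod_101, Finset.mul_sum]
  simp only [← Fintype.sum_prod_type']
  refine Fintype.sum_equiv
    ⟨fun p => (p.2.2.1, p.2.2.2.1, p.2.1, p.2.2.2.2, p.1),
     fun p => (p.2.2.2.2, p.2.2.1, p.1, p.2.1, p.2.2.2.1), fun _ => rfl, fun _ => rfl⟩ _ _ ?_
  rintro ⟨a, b, x, y, z⟩
  simp only [Equiv.coe_fn_mk]
  ring

lemma CC_comm (R S Ψ : Matrix (Fin N × Fin N) (Fin N × Fin N) ℂ)
    (hΨ : ∀ i j k m : Fin N, ∑ a : Fin N, ∑ b : Fin N,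
        R (i, b) (j, a) * Ψ (a, k) (b, m) = if i = m ∧ k = j then 1 else 0)
    (C : Matrix (Fin N) (Fin N) ℂ)
    (hC : ∀ i j : Fin N, C i j = ∑ k : Fin N, Ψ (i, k) (j, k))
    (hRS : R * S = 1) (hSR : S * R = 1)
    (hb1 : ampl2 N 3 R 1 * ampl2 N 3 R 0 * ampl2 N 3 S 1 =
      ampl2 N 3 S 0 * ampl2 N 3 R 1 * ampl2 N 3 R 0)
    (hb2 : ampl2 N 3 S 1 * ampl2 N 3 R 0 * ampl2 N 3 R 1 =
      ampl2 N 3 R 0 * ampl2 N 3 R 1 * ampl2 N 3 S 0) :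
    (Matrix.of fun p r : Fin N × Fin N => C p.1 r.1 * C p.2 r.2) * S =
      S * (Matrix.of fun p r : Fin N × Fin N => C p.1 r.1 * C p.2 r.2) := by
  have ha : ∀ v z j m, ∑ y, S (v, z) (j, y) * C y m = ∑ k, C v k * Ψ (z, k) (m, j) := by
    intro v z j m
    refine skew_inj R Ψ hΨ (fun z m => ∑ y, S (v, z) (j, y) * C y m)
      (fun z m => ∑ k, C v k * Ψ (z, k) (m, j)) ?_ z m
    intro i u
    trans (if i = j then C v u else 0)
    · rw [← contr R Ψ hΨ C hC R S S R hSR hb1 i j u v]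
      simp only [Finset.mul_sum]
      simp only [← Fintype.sum_prod_type']
      refine Fintype.sum_equiv
        ⟨fun p => (p.2.2, p.2.1, p.1), fun p => (p.2.2, p.2.1, p.1), fun _ => rfl, fun _ => rfl⟩ _ _ ?_
      rintro ⟨a, b, x⟩
      simp only [Equiv.coe_fn_mk]
      ring
    · have : ∀ k, C v k * (∑ a, ∑ b, R (i, b) (u, a) * Ψ (a, k) (b, j)) =
        if k = u then (if i = j then C v u else 0) else 0 := by
        intro k
        rw [hΨ]
        by_cases h1 : k = u
        · subst h1; by_cases h2 : i = j <;> simp [h2]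
        · simp [h1]
      trans (∑ k, C v k * (∑ a, ∑ b, R (i, b) (u, a) * Ψ (a, k) (b, j)))
      · simp [this]
      · simp only [Finset.mul_sum]
        rw [Finset.sum_comm_cycle, Finset.sum_comm_cycle]
        rw [Finset.sum_comm_cycle]
        rw [← Finset.sum_comm_cycle]
        refine Finset.sum_congr rfl fun a _ => Finset.sum_congr rfl fun b _ =>
          Finset.sum_congr rfl fun c _ => ?_
        ring
  have hbb : ∀ y i u z, ∑ m, C y m * S (i, m) (u, z) = ∑ m, Ψ (y, i) (z, m) * C m u := by
    intro y i u z
    refine skew_inj R Ψ hΨ (fun y z => ∑ m, C y m * S (i, m) (u, z))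
      (fun y z => ∑ m, Ψ (y, i) (z, m) * C m u) ?_ y z
    intro v j
    trans (if i = j then C v u else 0)
    · rw [← contr R Ψ hΨ C hC S R R S hRS hb2 i j u v]
      simp only [Finset.mul_sum]
      simp only [← Fintype.sum_prod_type']
      refine Fintype.sum_equiv
        ⟨fun p => (p.1, p.2.2, p.2.1), fun p => (p.1, p.2.2, p.2.1), fun _ => rfl, fun _ => rfl⟩ _ _ ?_
      rintro ⟨a, b, x⟩
      simp only [Equiv.coe_fn_mk]
      ring
    · have : ∀ m, (∑ a, ∑ b, R (v, b) (j, a) * Ψ (a, i) (b, m)) * C m u =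
        if v = m then (if i = j then C v u else 0) else 0 := by
        intro m
        rw [hΨ]
        by_cases h1 : v = m
        · subst h1; by_cases h2 : i = j <;> simp [h2]
        · simp [h1]
      trans (∑ m, (∑ a, ∑ b, R (v, b) (j, a) * Ψ (a, i) (b, m)) * C m u)
      · simp [this]
      · simp only [Finset.mul_sum, Finset.sum_mul]
        simp only [← Fintype.sum_prod_type']
        refine Fintype.sum_equiv
          ⟨fun p => (p.2.1, p.2.2, p.1), fun p => (p.2.2, p.1, p.2.1), fun _ => rfl, fun _ => rfl⟩ _ _ ?_
        rintro ⟨a, b, x⟩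
        simp only [Equiv.coe_fn_mk]
        ring
  ext ⟨i, y⟩ ⟨u, z⟩
  simp only [Matrix.mul_apply, Fintype.sum_prod_type, Matrix.of_apply]
  calc _ = ∑ k, C i k * ∑ m, C y m * S (k, m) (u, z) := by
        simp only [Finset.mul_sum, mul_assoc]
    _ = ∑ k, C i k * ∑ m, Ψ (y, k) (z, m) * C m u := by simp only [hbb]
    _ = ∑ m, (∑ k, C i k * Ψ (y, k) (z, m)) * C m u := by
        simp only [Finset.mul_sum, Finset.sum_mul]
        rw [Finset.sum_comm]
        simp only [mul_assoc]
    _ = ∑ m, (∑ y', S (i, y) (m, y') * C y' z) * C m u := by simp only [ha]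
    _ = _ := by
        simp only [Finset.sum_mul]
        refine Finset.sum_congr rfl fun a _ => Finset.sum_congr rfl fun b _ => ?_
        ring

end IndexSection

section TransportSection

/-- Shifted inclusion of positions. -/
def shiftPos (m n k : ℕ) (h : k + m ≤ n) : Fin m → Fin n := fun x => ⟨k + x, by omega⟩

lemma shiftPos_inj (m n k : ℕ) (h : k + m ≤ n) : Function.Injective (shiftPos m n k h) := by
  intro x y hxy
  simp only [shiftPos, Fin.mk.injEq] at hxy
  exact Fin.ext (by omega)

variable {A : Type*} [Semiring A] {N : ℕ}

/-- A two-site operator as a matrix indexed by functions. -/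
def toFn2 (M : Matrix (Fin N × Fin N) (Fin N × Fin N) A) :
    Matrix (Fin 2 → Fin N) (Fin 2 → Fin N) A :=
  M.submatrix (finTwoArrowEquiv (Fin N)) (finTwoArrowEquiv (Fin N))

/-- A one-site operator as a matrix indexed by functions. -/
def toFn1 (M : Matrix (Fin N) (Fin N) A) :
    Matrix (Fin 1 → Fin N) (Fin 1 → Fin N) A := fun i j => M (i 0) (j 0)

lemma ampl2_eq (n k : ℕ) (h : k + 2 ≤ n) (M : Matrix (Fin N × Fin N) (Fin N × Fin N) A) :
    ampl2 N n M k = amp (shiftPos 2 n k h) (toFn2 M) := by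
  classical
  ext i j
  unfold ampl2 amp
  rw [dif_pos (by omega)]
  congr 1
  apply propext
  refine forall_congr' fun m => ?_
  have : m ∉ Set.range (shiftPos 2 n k h) ↔ ((m : ℕ) ≠ k ∧ (m : ℕ) ≠ k + 1) := by
    simp only [Set.mem_range, not_exists, shiftPos, Fin.forall_fin_two, Fin.ext_iff]
    simp [eq_comm]
  rw [this]
  tauto

lemma ampl1_eq (n : ℕ) (h : 0 + 1 ≤ n) (M : Matrix (Fin N) (Fin N) A) :
    ampl1 N n M 0 = amp (shiftPos 1 n 0 h) (toFn1 M) := by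
  classical
  ext i j
  unfold ampl1 amp
  rw [dif_pos (by omega)]
  congr 1
  apply propext
  refine forall_congr' fun m => ?_
  have : m ∉ Set.range (shiftPos 1 n 0 h) ↔ ((m : ℕ) ≠ 0) := by
    simp only [Set.mem_range, not_exists, shiftPos, Fin.forall_fin_one, Fin.ext_iff]
    simp [eq_comm]
  rw [this]

lemma ampl2_zero (n k : ℕ) (h : ¬ k + 2 ≤ n) (M : Matrix (Fin N × Fin N) (Fin N × Fin N) A) :
    ampl2 N n M k = 0 := by
  ext i j
  unfold ampl2
  rw [dif_neg (by omega)]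
  rfl

lemma amp_ampl2 (m n k l : ℕ) (h : k + m ≤ n) (hl : l + 2 ≤ m)
    (M : Matrix (Fin N × Fin N) (Fin N × Fin N) A) :
    amp (shiftPos m n k h) (ampl2 N m M l) = ampl2 N n M (k + l) := by
  rw [ampl2_eq m l hl, amp_amp _ _ (shiftPos_inj _ _ _ _), ampl2_eq n (k + l) (by omega)]
  congr 1
  funext x
  simp only [shiftPos, Fin.mk.injEq]
  omega

lemma amp_ampl1 (m n : ℕ) (h : 0 + m ≤ n) (hm : 1 ≤ m)
    (M : Matrix (Fin N) (Fin N) A) :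
    amp (shiftPos m n 0 h) (ampl1 N m M 0) = ampl1 N n M 0 := by
  rw [ampl1_eq m (by omega), amp_amp _ _ (shiftPos_inj _ _ _ _), ampl1_eq n (by omega)]
  congr 1
  funext x
  simp only [shiftPos, Fin.mk.injEq]
  omega

lemma ampl2_mul (n k : ℕ) (M M' : Matrix (Fin N × Fin N) (Fin N × Fin N) A) :
    ampl2 N n (M * M') k = ampl2 N n M k * ampl2 N n M' k := by
  by_cases h : k + 2 ≤ n
  · rw [ampl2_eq n k h, ampl2_eq n k h, ampl2_eq n k h, ← amp_mul (shiftPos_inj _ _ _ _)]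
    congr 1
    exact (Matrix.submatrix_mul_equiv _ _ _ _ _).symm
  · simp [ampl2_zero n k h]

lemma ampl2_one (n k : ℕ) (h : k + 2 ≤ n) :
    ampl2 N n (1 : Matrix (Fin N × Fin N) (Fin N × Fin N) A) k = 1 := by
  rw [ampl2_eq n k h]
  have : toFn2 (1 : Matrix (Fin N × Fin N) (Fin N × Fin N) A) = 1 :=
    Matrix.submatrix_one_equiv _
  rw [this, amp_one]

lemma ampl2_map {B : Type*} [Semiring B] (f : A →+* B) (n k : ℕ)
    (M : Matrix (Fin N × Fin N) (Fin N × Fin N) A) :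
    ampl2 N n (M.map f) k = (ampl2 N n M k).map f := by
  ext i j
  simp only [ampl2, Matrix.map_apply]
  split_ifs <;> simp

lemma ampl2_far (n k l : ℕ) (hkl : k + 2 ≤ l) (M M' : Matrix (Fin N × Fin N) (Fin N × Fin N) A)
    (hM : ∀ i j x, M i j * x = x * M i j) :
    ampl2 N n M k * ampl2 N n M' l = ampl2 N n M' l * ampl2 N n M k := by
  by_cases h : l + 2 ≤ n
  · rw [ampl2_eq n l h, ampl2_eq n k (by omega)]
    apply amp_comm (shiftPos_inj _ _ _ _) (shiftPos_inj _ _ _ _)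
    · intro x y hxy
      simp only [shiftPos, Fin.mk.injEq] at hxy
      omega
    · intro i j k l
      exact hM _ _ _
  · simp [ampl2_zero n l h]

lemma ampl1_far (n l : ℕ) (hkl : 1 ≤ l) (L : Matrix (Fin N) (Fin N) A)
    (M' : Matrix (Fin N × Fin N) (Fin N × Fin N) A)
    (hM : ∀ i j x, M' i j * x = x * M' i j) :
    ampl1 N n L 0 * ampl2 N n M' l = ampl2 N n M' l * ampl1 N n L 0 := by
  by_cases h : l + 2 ≤ n
  · rw [ampl2_eq n l h, ampl1_eq n (by omega)]
    apply amp_comm (shiftPos_inj _ _ _ _) (shiftPos_inj _ _ _ _)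
    · intro x y hxy
      simp only [shiftPos, Fin.mk.injEq] at hxy
      omega
    · intro i j k l
      exact (hM _ _ _).symm
  · simp [ampl2_zero n l h]

lemma ampl1_as_ampl2 (n : ℕ) (hn : 2 ≤ n) (L : Matrix (Fin N) (Fin N) A) :
    ampl1 N n L 0 = ampl2 N n (fun p r => if p.2 = r.2 then L p.1 r.1 else 0) 0 := by
  ext i j
  unfold ampl1 ampl2
  rw [dif_pos (by omega), dif_pos (by omega)]
  dsimp only
  rw [← ite_and]
  congr 1
  apply propext
  constructor
  · intro h
    exact ⟨fun m h0 h1 => h m h0, h _ (by simp)⟩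
  · rintro ⟨h1, h2⟩ m hm
    by_cases hm1 : (m : ℕ) = 0 + 1
    · have : m = ⟨0 + 1, by omega⟩ := Fin.ext hm1
      rw [this]; exact h2
    · exact h1 m hm hm1

end TransportSection

section TraceSection
variable {A : Type*} [Ring A] [Algebra ℂ A] {N : ℕ}

lemma trRn_eq (n : ℕ) (C : Matrix (Fin N) (Fin N) ℂ) (M : Matrix (Fin n → Fin N) (Fin n → Fin N) A) :
    trRn N n C M = Matrix.trace ((Cpow C).map (algebraMap ℂ A) * M) := by
  simp only [trRn, Matrix.trace, Matrix.diag, Matrix.mul_apply, Matrix.map_apply, Cpow]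

lemma trRn_cyc (n : ℕ) (C : Matrix (Fin N) (Fin N) ℂ)
    (X : Matrix (Fin n → Fin N) (Fin n → Fin N) A) (Y : Matrix (Fin n → Fin N) (Fin n → Fin N) ℂ)
    (h : Cpow C * Y = Y * Cpow C) :
    trRn N n C (X * Y.map (algebraMap ℂ A)) = trRn N n C (Y.map (algebraMap ℂ A) * X) := by
  rw [trRn_eq, trRn_eq, ← mul_assoc, ← mul_assoc, ← Matrix.map_mul, h, Matrix.map_mul,
    mul_assoc (Y.map (algebraMap ℂ A))]
  generalize (Cpow C).map (algebraMap ℂ A) * X = Z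
  simp only [Matrix.trace, Matrix.diag, Matrix.mul_apply, Matrix.map_apply]
  rw [Finset.sum_comm]
  refine Finset.sum_congr rfl fun i _ => Finset.sum_congr rfl fun j _ => ?_
  exact (Algebra.commutes _ _).symm

lemma sum_snoc {β : Type*} [AddCommMonoid β] (p : ℕ) (F : (Fin (p + 1) → Fin N) → β) :
    ∑ j, F j = ∑ i : Fin p → Fin N, ∑ a : Fin N, F (Fin.snoc (α := fun _ => Fin N) i a) := by
  rw [← (Fin.snocEquiv (fun _ => Fin N)).sum_comp, Fintype.sum_prod_type, Finset.sum_comm]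
  rfl

lemma ext_snoc (n : ℕ) (X : Matrix (Fin n → Fin N) (Fin n → Fin N) A) (i j : Fin n → Fin N)
    (a b : Fin N) :
    amp (shiftPos n (n + 1) 0 (by omega)) X (Fin.snoc (α := fun _ => Fin N) i a)
      (Fin.snoc (α := fun _ => Fin N) j b) = if a = b then X i j else 0 := by
  classical
  unfold amp
  have e : shiftPos n (n + 1) 0 (by omega) = Fin.castSucc := by
    funext x; apply Fin.ext; simp [shiftPos]
  rw [e]
  simp only [Fin.snoc_castSucc]
  congr 1
  apply propext
  constructor
  · intro h
    have := h (Fin.last n) (by rintro ⟨x, hx⟩; exact (Fin.castSucc_lt_last x).ne hx)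
    simpa using this
  · intro h m
    induction m using Fin.lastCases with
    | last => intro _; simpa using h
    | cast m => intro hm; exact absurd ⟨m, rfl⟩ hm

lemma Cpow_snoc (n : ℕ) (C : Matrix (Fin N) (Fin N) ℂ) (i j : Fin n → Fin N)
    (a b : Fin N) :
    (∏ k : Fin (n + 1), C (Fin.snoc (α := fun _ => Fin N) i a k)
      (Fin.snoc (α := fun _ => Fin N) j b k)) = (∏ k, C (i k) (j k)) * C a b := by
  rw [Fin.prod_univ_castSucc]
  simp

lemma ampl2_snoc (p : ℕ) (R : Matrix (Fin N × Fin N) (Fin N × Fin N) ℂ) (C : Matrix (Fin N) (Fin N) ℂ)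
    (hRC : ∀ i j, ∑ a, ∑ b, R (i, b) (j, a) * C a b = if i = j then 1 else 0)
    (k l : Fin (p + 1) → Fin N) :
    ∑ a, ∑ b, C a b * ampl2 N (p + 2) R p (Fin.snoc (α := fun _ => Fin N) k b)
      (Fin.snoc (α := fun _ => Fin N) l a) = if k = l then 1 else 0 := by
  have h0 : ∀ a b, ampl2 N (p + 2) R p (Fin.snoc (α := fun _ => Fin N) k b)
      (Fin.snoc (α := fun _ => Fin N) l a) =
      if ∀ m : Fin p, k m.castSucc = l m.castSucc then
        R (k (Fin.last p), b) (l (Fin.last p), a) else 0 := by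
    intro a b
    unfold ampl2
    rw [dif_pos (by omega)]
    have e1 : (⟨p, by omega⟩ : Fin (p + 2)) = (Fin.last p).castSucc := rfl
    have e2 : (⟨p + 1, by omega⟩ : Fin (p + 2)) = Fin.last (p + 1) := rfl
    rw [e1, e2]
    simp only [Fin.snoc_castSucc, Fin.snoc_last]
    congr 1
    apply propext
    constructor
    · intro h m
      have := h m.castSucc.castSucc (by simp; omega) (by simp; omega)
      simpa only [Fin.snoc_castSucc] using this
    · intro h m h1 h2
      induction m using Fin.lastCases with
      | last => simp at h2
      | cast m =>
        induction m using Fin.lastCases with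
        | last => simp at h1
        | cast m => simpa only [Fin.snoc_castSucc] using h m
  simp only [h0]
  by_cases h : ∀ m : Fin p, k m.castSucc = l m.castSucc
  · simp only [if_pos h]
    have := hRC (k (Fin.last p)) (l (Fin.last p))
    simp only [mul_comm (C _ _)]
    rw [this]
    congr 1
    apply propext
    constructor
    · intro h'
      funext m
      induction m using Fin.lastCases with
      | last => exact h'
      | cast m => exact h m
    · intro h'; rw [h']
  · simp only [if_neg h]
    rw [if_neg]
    · simp
    · rintro rfl; exact h fun _ => rfl

lemma trRn_partial (p : ℕ) (R : Matrix (Fin N × Fin N) (Fin N × Fin N) ℂ)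
    (C : Matrix (Fin N) (Fin N) ℂ)
    (hRC : ∀ i j, ∑ a, ∑ b, R (i, b) (j, a) * C a b = if i = j then 1 else 0)
    (X Y : Matrix (Fin (p + 1) → Fin N) (Fin (p + 1) → Fin N) A) :
    trRn N (p + 2) C (amp (shiftPos (p + 1) (p + 2) 0 (by omega)) X *
      ampl2 N (p + 2) (R.map (algebraMap ℂ A)) p *
      amp (shiftPos (p + 1) (p + 2) 0 (by omega)) Y) = trRn N (p + 1) C (X * Y) := by
  rw [ampl2_map]
  unfold trRn
  simp only [Matrix.mul_apply, Matrix.map_apply]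
  simp only [sum_snoc (p + 1), ext_snoc, Cpow_snoc]
  simp only [ite_mul, zero_mul, mul_ite, mul_zero, Finset.sum_ite_eq, Finset.sum_ite_eq',
    Finset.mem_univ, if_true]
  refine Finset.sum_congr rfl fun i _ => ?_
  rw [Finset.sum_comm]
  refine Finset.sum_congr rfl fun j _ => ?_
  calc _ = ∑ k, ∑ l, algebraMap ℂ A (∏ x, C (i x) (j x)) * (X j l *
        algebraMap ℂ A (∑ a, ∑ b, C a b * ampl2 N (p + 2) R p (Fin.snoc (α := fun _ => Fin N) l b)
          (Fin.snoc (α := fun _ => Fin N) k a)) * Y k i) := by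
        simp only [map_sum, Finset.mul_sum, Finset.sum_mul]
        simp only [← Fintype.sum_prod_type']
        refine Fintype.sum_equiv
          ⟨fun p => (p.2.2.1, p.2.2.2, p.1, p.2.1), fun p => (p.2.2.1, p.2.2.2, p.1, p.2.1),
            fun _ => rfl, fun _ => rfl⟩ _ _ ?_
        rintro ⟨a, b, k, l⟩
        simp only [Equiv.coe_fn_mk, map_mul]
        rw [mul_assoc, mul_assoc, mul_assoc]
        congr 1
        simp only [mul_assoc]
        rw [Algebra.left_comm (X j l), Algebra.left_comm (X j l), Algebra.left_comm (X j l)]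
    _ = _ := by
        simp only [ampl2_snoc p R C hRC]
        simp [Finset.mul_sum]

lemma trRn_one (C : Matrix (Fin N) (Fin N) ℂ) (X : Matrix (Fin N) (Fin N) A) :
    trRn N 1 C (ampl1 N 1 X 0) = trR1 N C X := by
  unfold trRn trR1
  rw [← (Equiv.funUnique (Fin 1) (Fin N)).symm.sum_comp]
  refine Finset.sum_congr rfl fun i _ => ?_
  rw [← (Equiv.funUnique (Fin 1) (Fin N)).symm.sum_comp]
  refine Finset.sum_congr rfl fun j _ => ?_
  simp [ampl1]

lemma ampl1_pow_one (X : Matrix (Fin N) (Fin N) A) (m : ℕ) :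
    ampl1 N 1 X 0 ^ m = ampl1 N 1 (X ^ m) 0 := by
  have hmul : ∀ X Y : Matrix (Fin N) (Fin N) A, ampl1 N 1 (X * Y) 0 = ampl1 N 1 X 0 * ampl1 N 1 Y 0 := by
    intro X Y
    ext i j
    rw [Matrix.mul_apply, ← (Equiv.funUnique (Fin 1) (Fin N)).symm.sum_comp]
    simp [ampl1, Matrix.mul_apply]
  induction m with
  | zero =>
    ext i j
    simp only [pow_zero, ampl1]
    by_cases h : i = j
    · subst h; simp
    · have : ¬ i 0 = j 0 := fun h' => h (by funext x; rw [Subsingleton.elim x 0]; exact h')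
      rw [Matrix.one_apply_ne h]
      have h2 : (1 : Matrix (Fin N) (Fin N) A) (i ⟨0, Nat.one_pos⟩) (j ⟨0, Nat.one_pos⟩) = 0 :=
        Matrix.one_apply_ne this
      simp [h2]
  | succ m ih => rw [pow_succ, pow_succ, ih, hmul]

end TraceSection

section AbstractSection
variable {G : Type*} [Monoid G]

/-- abstract version of the matrices Lbar -/
def lbarAbs (r s : ℕ → G) (l0 : G) : ℕ → G
  | 0 => l0
  | k + 1 => r k * lbarAbs r s l0 k * s k

/-- Relations of braid type. -/
structure BraidData (n : ℕ) (r s : ℕ → G) (l0 : G) : Prop where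
  rs : ∀ k, k + 2 ≤ n → r k * s k = 1
  sr : ∀ k, k + 2 ≤ n → s k * r k = 1
  far_rr : ∀ k l, k + 2 ≤ l → Commute (r k) (r l)
  far_sr : ∀ k l, k + 2 ≤ l → Commute (s k) (r l)
  far_rs : ∀ k l, k + 2 ≤ l → Commute (r k) (s l)
  far_l : ∀ l, 1 ≤ l → Commute l0 (r l)
  far_ls : ∀ l, 1 ≤ l → Commute l0 (s l)
  far_ss : ∀ k l, k + 2 ≤ l → Commute (s k) (s l)
  braid : ∀ k, r k * r (k + 1) * r k = r (k + 1) * r k * r (k + 1)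
  re : r 0 * l0 * r 0 * l0 = l0 * r 0 * l0 * r 0

variable {n : ℕ} {r s : ℕ → G} {l0 : G}

lemma BraidData.braid_a (H : BraidData n r s l0) (k : ℕ) (hk : k + 3 ≤ n) :
    s k * (r (k + 1) * r k) = r (k + 1) * (r k * s (k + 1)) := by
  have h1 := H.sr k (by omega)
  have h2 := H.rs (k + 1) (by omega)
  calc s k * (r (k + 1) * r k) = s k * (r (k + 1) * r k * r (k + 1)) * s (k + 1) := by
        simp only [mul_assoc, h2, mul_one]
    _ = (s k * r k) * (r (k + 1) * (r k * s (k + 1))) := by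
        rw [← H.braid k]; simp only [mul_assoc]
    _ = _ := by rw [h1, one_mul]

lemma BraidData.braid_b (H : BraidData n r s l0) (k : ℕ) (hk : k + 3 ≤ n) :
    s (k + 1) * (s k * r (k + 1)) = r k * (s (k + 1) * s k) := by
  have h1 := H.sr (k + 1) (by omega)
  have h2 := H.rs k (by omega)
  have h3 := H.sr k (by omega)
  have h4 := H.rs (k + 1) (by omega)
  calc s (k + 1) * (s k * r (k + 1))
      = s (k + 1) * (s k * (r (k + 1) * (r k * s k))) := by rw [h2, mul_one]
    _ = s (k + 1) * ((s k * (r (k + 1) * r k)) * s k) := by simp only [mul_assoc]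
    _ = (s (k + 1) * r (k + 1)) * (r k * (s (k + 1) * s k)) := by
        rw [H.braid_a k hk]; simp only [mul_assoc]
    _ = _ := by rw [h1, one_mul]

lemma BraidData.braid_c (H : BraidData n r s l0) (k : ℕ) (hk : k + 3 ≤ n) :
    r (k + 1) * (s k * s (k + 1)) = s k * (s (k + 1) * r k) := by
  have h1 := H.sr (k + 1) (by omega)
  have h2 := H.rs k (by omega)
  have h3 := H.sr k (by omega)
  have h4 := H.rs (k + 1) (by omega)
  have hb : r k * (r (k + 1) * r k) = r (k + 1) * (r k * r (k + 1)) := by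
    simpa only [mul_assoc] using H.braid k
  calc r (k + 1) * (s k * s (k + 1))
      = s k * (s (k + 1) * ((r (k + 1) * (r k * r (k + 1))) * (s k * s (k + 1)))) := by
        simp only [← mul_assoc]
        rw [mul_assoc (s k), h1, mul_one, h3, one_mul]
    _ = s k * (s (k + 1) * (r k * (r (k + 1) * ((r k * s k) * s (k + 1))))) := by
        rw [← hb]; simp only [mul_assoc]
    _ = _ := by rw [h2, one_mul, h4, mul_one]

/-- `r l` and `s l` commute with `lbar j` for `j < l` -/
lemma BraidData.lo (H : BraidData n r s l0) (j : ℕ) : ∀ l, j < l →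
    Commute (lbarAbs r s l0 j) (r l) ∧ Commute (lbarAbs r s l0 j) (s l) := by
  induction j with
  | zero => intro l hl; exact ⟨H.far_l l hl, H.far_ls l hl⟩
  | succ j ih =>
    intro l hl
    have := ih l (by omega)
    exact ⟨((H.far_rr j l (by omega)).mul_left this.1).mul_left (H.far_sr j l (by omega)),
      ((H.far_rs j l (by omega)).mul_left this.2).mul_left (H.far_ss j l (by omega))⟩

lemma BraidData.hi (H : BraidData n r s l0) (k j : ℕ) (hj : k + 2 ≤ j) (hn : j + 1 ≤ n) :
    Commute (r k) (lbarAbs r s l0 j) := by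
  induction j, hj using Nat.le_induction with
  | base =>
    have c := H.lo k (k + 1) (by omega)
    have hb : r k * (r (k + 1) * r k) = r (k + 1) * (r k * r (k + 1)) := by
      simpa only [mul_assoc] using H.braid k
    show r k * (r (k + 1) * (r k * lbarAbs r s l0 k * s k) * s (k + 1)) =
      (r (k + 1) * (r k * lbarAbs r s l0 k * s k) * s (k + 1)) * r k
    set l := lbarAbs r s l0 k
    calc _ = (r k * (r (k + 1) * r k)) * l * s k * s (k + 1) := by simp only [mul_assoc]
      _ = r (k + 1) * r k * (l * r (k + 1)) * s k * s (k + 1) := by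
        rw [hb, c.1.eq]; simp only [mul_assoc]
      _ = r (k + 1) * r k * l * (r (k + 1) * (s k * s (k + 1))) := by simp only [mul_assoc]
      _ = _ := by rw [H.braid_c k (by omega)]; simp only [mul_assoc]
  | succ j hj ih =>
    exact ((H.far_rr k j hj).mul_right (ih (by omega))).mul_right (H.far_rs k j hj)

lemma BraidData.reK (H : BraidData n r s l0) (k : ℕ) (hk : k + 2 ≤ n) :
    r k * lbarAbs r s l0 k * r k * lbarAbs r s l0 k =
      lbarAbs r s l0 k * r k * lbarAbs r s l0 k * r k := by
  induction k with
  | zero => exact H.re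
  | succ k ih =>
    have ih := ih (by omega)
    have c := H.lo k (k + 1) (by omega)
    simp only [lbarAbs]
    set l := lbarAbs r s l0 k
    have hb : r k * (r (k + 1) * r k) = r (k + 1) * (r k * r (k + 1)) := by
      simpa only [mul_assoc] using H.braid k
    calc r (k + 1) * (r k * l * s k) * r (k + 1) * (r k * l * s k)
        = r (k + 1) * r k * l * (s k * (r (k + 1) * r k)) * l * s k := by simp only [mul_assoc]
      _ = r (k + 1) * r k * (l * r (k + 1)) * r k * (s (k + 1) * l) * s k := by
        rw [H.braid_a k (by omega)]; simp only [mul_assoc]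
      _ = (r (k + 1) * (r k * r (k + 1))) * l * r k * l * s (k + 1) * s k := by
        rw [c.1.eq, ← c.2.eq]; simp only [mul_assoc]
      _ = r k * r (k + 1) * (r k * l * r k * l) * s (k + 1) * s k := by
        rw [← hb]; simp only [mul_assoc]
      _ = r k * r (k + 1) * l * r k * l * (r k * (s (k + 1) * s k)) := by
        rw [ih]; simp only [mul_assoc]
      _ = r k * (r (k + 1) * l) * r k * (l * s (k + 1)) * s k * r (k + 1) := by
        rw [← H.braid_b k (by omega)]; simp only [mul_assoc]
      _ = r k * l * (r (k + 1) * (r k * s (k + 1))) * l * s k * r (k + 1) := by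
        rw [← c.1.eq, c.2.eq]; simp only [mul_assoc]
      _ = _ := by rw [← H.braid_a k (by omega)]; simp only [mul_assoc]

lemma BraidData.pair (H : BraidData n r s l0) (k : ℕ) (hk : k + 2 ≤ n) :
    Commute (r k) (lbarAbs r s l0 k * lbarAbs r s l0 (k + 1)) := by
  have h := H.reK k hk
  have h1 := H.rs k hk
  show r k * (lbarAbs r s l0 k * (r k * lbarAbs r s l0 k * s k)) =
    (lbarAbs r s l0 k * (r k * lbarAbs r s l0 k * s k)) * r k
  set l := lbarAbs r s l0 k
  calc _ = (r k * l * r k * l) * s k := by simp only [mul_assoc]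
    _ = l * r k * l * (r k * s k) := by rw [h]; simp only [mul_assoc]
    _ = l * r k * l * (s k * r k) := by rw [h1, H.sr k hk]
    _ = _ := by simp only [mul_assoc]

lemma BraidData.tot (H : BraidData n r s l0) (k : ℕ) (m : ℕ) (hm : k + 2 ≤ m) (hn : m ≤ n) :
    Commute (r k) ((List.range m).map (lbarAbs r s l0)).prod := by
  induction m, hm using Nat.le_induction with
  | base =>
    rw [List.range_succ, List.range_succ]
    simp only [List.map_append, List.prod_append, List.map_cons, List.map_nil, List.prod_cons,
      List.prod_nil, mul_one, mul_assoc]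
    refine Commute.mul_right ?_ (H.pair k (by omega))
    apply Commute.list_prod_right
    intro x hx
    simp only [List.mem_map, List.mem_range] at hx
    obtain ⟨a, ha, rfl⟩ := hx
    exact (H.lo a k ha).1.symm
  | succ m hm ih =>
    rw [List.range_succ]
    simp only [List.map_append, List.prod_append, List.map_cons, List.map_nil, List.prod_cons,
      List.prod_nil, mul_one]
    exact (ih (by omega)).mul_right (H.hi k m hm (by omega))

/-- Coxeter elements have equal values under a tracial functional. -/
lemma coxeter_trace {β : Type*} (m : ℕ) (r : ℕ → G) (T : G → β)
    (hT : ∀ (x : G) k, k < m → T (x * r k) = T (r k * x))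
    (hfar : ∀ k l, k + 2 ≤ l → Commute (r k) (r l)) :
    T (((List.range m).map r).prod) = T (((List.range m).reverse.map r).prod) := by
  have hT' : ∀ (l : List ℕ), (∀ k ∈ l, k < m) → ∀ x : G,
      T (x * (l.map r).prod) = T ((l.map r).prod * x) := by
    intro l
    induction l with
    | nil => intro _ x; simp
    | cons a l ih =>
      intro hl x
      simp only [List.map_cons, List.prod_cons]
      rw [← mul_assoc, ih (fun k hk => hl k (List.mem_cons_of_mem _ hk)), ← mul_assoc,
        hT _ a (hl a List.mem_cons_self), mul_assoc]
  -- intermediate words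
  have key : ∀ j, j ≤ m → T (((List.range m).map r).prod) =
      T (((List.range (m - j)).map r).prod * ((List.range' (m - j) j).reverse.map r).prod) := by
    intro j
    induction j with
    | zero => intro _; simp
    | succ j ih =>
      intro hj
      rw [ih (by omega)]
      obtain ⟨k, hk⟩ : ∃ k, m - j = k + 1 := ⟨m - j - 1, by omega⟩
      have hk' : m - (j + 1) = k := by omega
      rw [hk, hk', List.range_succ, List.range'_succ]
      simp only [List.map_append, List.prod_append, List.map_cons, List.map_nil, List.prod_cons,
        List.prod_nil, mul_one, List.reverse_cons]
      set a := ((List.range k).map r).prod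
      set b := ((List.range' (k + 1) j).reverse.map r).prod with hb
      have hab : Commute a b := by
        apply Commute.list_prod_left
        intro x hx
        apply Commute.list_prod_right
        intro y hy
        simp only [List.mem_map, List.mem_range, List.mem_reverse, List.mem_range'_1] at hx hy
        obtain ⟨u, hu, rfl⟩ := hx
        obtain ⟨v, hv, rfl⟩ := hy
        exact hfar u v (by omega)
      rw [← mul_assoc a b, hab.eq, mul_assoc b, hb, hT']
      intro v hv
      simp only [List.mem_reverse, List.mem_range'_1] at hv
      omega
  rw [key m le_rfl]
  simp [List.range_eq_range']

end AbstractSection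

section FinalSection
variable {A : Type*} [Ring A] [Algebra ℂ A] {N : ℕ}

/-- amplification as a monoid homomorphism -/
noncomputable def ampHom {ι κ : Type*} [Fintype ι] [Fintype κ] [DecidableEq ι] [DecidableEq κ]
    (e : ι → κ) (he : Function.Injective e) :
    Matrix (ι → Fin N) (ι → Fin N) A →* Matrix (κ → Fin N) (κ → Fin N) A where
  toFun := amp e
  map_one' := amp_one
  map_mul' := amp_mul he

lemma ampHom_apply {ι κ : Type*} [Fintype ι] [Fintype κ] [DecidableEq ι] [DecidableEq κ]
    (e : ι → κ) (he : Function.Injective e) (M : Matrix (ι → Fin N) (ι → Fin N) A) :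
    ampHom e he M = amp e M := rfl

lemma amp_Lbar (p : ℕ) (R : Matrix (Fin N × Fin N) (Fin N × Fin N) ℂ) (q : ℂ)
    (L : Matrix (Fin N) (Fin N) A) (k : ℕ) (hk : k ≤ p) :
    amp (shiftPos (p + 1) (p + 2) 0 (by omega)) (Lbar N (p + 1) R q L k) =
      Lbar N (p + 2) R q L k := by
  induction k with
  | zero => exact amp_ampl1 (p + 1) (p + 2) (by omega) (by omega) L
  | succ k ih =>
    simp only [Lbar]
    rw [amp_mul (shiftPos_inj _ _ _ _), amp_mul (shiftPos_inj _ _ _ _), ih (by omega),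
      amp_ampl2 _ _ _ _ _ (by omega), amp_ampl2 _ _ _ _ _ (by omega), Nat.zero_add]

lemma rev_trace (R : Matrix (Fin N × Fin N) (Fin N × Fin N) ℂ) (q : ℂ)
    (hSR : (R - (q - q⁻¹) • 1) * R = 1) (C : Matrix (Fin N) (Fin N) ℂ)
    (hRC : ∀ i j, ∑ a, ∑ b, R (i, b) (j, a) * C a b = if i = j then 1 else 0)
    (L : Matrix (Fin N) (Fin N) A) (p : ℕ) : ∀ m : ℕ,
    trRn N (p + 1) C (((List.range p).map (Lbar N (p + 1) R q L)).prod *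
      Lbar N (p + 1) R q L p ^ m *
      ((List.range p).reverse.map (fun k => ampl2 N (p + 1) (R.map (algebraMap ℂ A)) k)).prod) =
    trR1 N C (L ^ (p + m)) := by
  induction p with
  | zero =>
    intro m
    simp only [List.range_zero, List.map_nil, List.prod_nil, one_mul, List.reverse_nil, mul_one,
      Lbar, zero_add]
    rw [ampl1_pow_one, trRn_one]
  | succ p ih =>
    intro m
    have h1 : ampl2 N (p + 2) ((R - (q - q⁻¹) • 1).map (algebraMap ℂ A)) p *
        ampl2 N (p + 2) (R.map (algebraMap ℂ A)) p = 1 := by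
      rw [← ampl2_mul, ← Matrix.map_mul, hSR, Matrix.map_one _ (map_zero _) (map_one _),
        ampl2_one _ _ (by omega)]
    have h2 : Lbar N (p + 2) R q L (p + 1) ^ m * ampl2 N (p + 2) (R.map (algebraMap ℂ A)) p =
        ampl2 N (p + 2) (R.map (algebraMap ℂ A)) p * Lbar N (p + 2) R q L p ^ m := by
      have : SemiconjBy (ampl2 N (p + 2) (R.map (algebraMap ℂ A)) p) (Lbar N (p + 2) R q L p)
          (Lbar N (p + 2) R q L (p + 1)) := by
        unfold SemiconjBy
        simp only [Lbar]
        rw [mul_assoc _ _ (ampl2 N (p + 2) (R.map (algebraMap ℂ A)) p), h1, mul_one]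
      exact (this.pow_right m).symm
    have h3 := trRn_partial p R C hRC
      (((List.range (p + 1)).map (Lbar N (p + 1) R q L)).prod)
      (Lbar N (p + 1) R q L p ^ m * ((List.range p).reverse.map
        (fun k => ampl2 N (p + 1) (R.map (algebraMap ℂ A)) k)).prod)
    have h4 : amp (shiftPos (p + 1) (p + 2) 0 (by omega))
        (((List.range (p + 1)).map (Lbar N (p + 1) R q L)).prod) =
        ((List.range (p + 1)).map (Lbar N (p + 2) R q L)).prod := by
      rw [← ampHom_apply _ (shiftPos_inj _ _ _ _), map_list_prod, List.map_map]
      congr 1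
      apply List.map_congr_left
      intro k hk
      rw [List.mem_range] at hk
      exact amp_Lbar p R q L k (by omega)
    have h5 : amp (shiftPos (p + 1) (p + 2) 0 (by omega))
        (Lbar N (p + 1) R q L p ^ m * ((List.range p).reverse.map
        (fun k => ampl2 N (p + 1) (R.map (algebraMap ℂ A)) k)).prod) =
        (Lbar N (p + 2) R q L p ^ m * ((List.range p).reverse.map
        (fun k => ampl2 N (p + 2) (R.map (algebraMap ℂ A)) k)).prod) := by
      rw [← ampHom_apply _ (shiftPos_inj _ _ _ _), map_mul, map_pow, map_list_prod, List.map_map,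
        ampHom_apply, amp_Lbar p R q L p le_rfl]
      congr 2
      apply List.map_congr_left
      intro k hk
      rw [List.mem_reverse, List.mem_range] at hk
      have := amp_ampl2 (p + 1) (p + 2) 0 k (by omega) (by omega) (R.map (algebraMap ℂ A))
      rw [Nat.zero_add k] at this
      exact this
    rw [h4, h5] at h3
    have h6 := ih (m + 1)
    rw [show p + 1 + m = p + (m + 1) by omega, ← h6]
    trans (trRn N (p + 2) C (((List.range (p + 1)).map (Lbar N (p + 2) R q L)).prod *
      ampl2 N (p + 2) (R.map (algebraMap ℂ A)) p *
      (Lbar N (p + 2) R q L p ^ m * ((List.range p).reverse.map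
        (fun k => ampl2 N (p + 2) (R.map (algebraMap ℂ A)) k)).prod)))
    · congr 1
      have e1 : (List.range (p + 1)).reverse = p :: (List.range p).reverse := by
        rw [List.range_succ]; simp
      rw [e1, List.map_cons, List.prod_cons]
      rw [mul_assoc, ← mul_assoc (_ ^ m), h2]
      simp only [mul_assoc]
    · rw [h3]
      congr 1
      rw [List.range_succ, List.map_append, List.prod_append]
      simp only [List.map_cons, List.map_nil, List.prod_cons, List.prod_nil, mul_one, pow_succ']
      simp only [mul_assoc]

lemma braid_n (n : ℕ) (R : Matrix (Fin N × Fin N) (Fin N × Fin N) ℂ)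
    (hbraid : ampl2 N 3 R 0 * ampl2 N 3 R 1 * ampl2 N 3 R 0 =
      ampl2 N 3 R 1 * ampl2 N 3 R 0 * ampl2 N 3 R 1) (k : ℕ) :
    ampl2 N n (R.map (algebraMap ℂ A)) k * ampl2 N n (R.map (algebraMap ℂ A)) (k + 1) *
      ampl2 N n (R.map (algebraMap ℂ A)) k =
    ampl2 N n (R.map (algebraMap ℂ A)) (k + 1) * ampl2 N n (R.map (algebraMap ℂ A)) k *
      ampl2 N n (R.map (algebraMap ℂ A)) (k + 1) := by
  by_cases h : k + 3 ≤ n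
  · have h1 := congrArg (amp (shiftPos 3 n k h)) hbraid
    simp only [amp_mul (shiftPos_inj _ _ _ _)] at h1
    rw [amp_ampl2 _ _ _ _ _ (by omega), amp_ampl2 _ _ _ _ _ (by omega), Nat.add_zero] at h1
    have h2 := congrArg (fun M => Matrix.map M (algebraMap ℂ A)) h1
    simp only [Matrix.map_mul] at h2
    simpa only [ampl2_map] using h2
  · simp [ampl2_zero n (k + 1) (by omega)]

lemma re_n (n : ℕ) (hn : 2 ≤ n) (R : Matrix (Fin N × Fin N) (Fin N × Fin N) ℂ) :
    ampl2 N n (R.map (algebraMap ℂ (REA N R))) 0 * ampl1 N n (Lgen N R) 0 *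
      ampl2 N n (R.map (algebraMap ℂ (REA N R))) 0 * ampl1 N n (Lgen N R) 0 =
    ampl1 N n (Lgen N R) 0 * ampl2 N n (R.map (algebraMap ℂ (REA N R))) 0 *
      ampl1 N n (Lgen N R) 0 * ampl2 N n (R.map (algebraMap ℂ (REA N R))) 0 := by
  let φ := RingQuot.mkAlgHom ℂ (REArel N R)
  have hR : R.map (algebraMap ℂ (REA N R)) =
      (R.map (algebraMap ℂ (FreeAlgebra ℂ (Fin N × Fin N)))).map φ := by
    ext i j
    simp only [Matrix.map_apply]
    exact (φ.commutes _).symm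
  have hL : (fun p r : Fin N × Fin N => if p.2 = r.2 then Lgen N R p.1 r.1 else 0) =
      (L1F N).map φ := by
    funext p r
    simp only [Matrix.map_apply, L1F, Lgen]
    split_ifs
    · rfl
    · exact (map_zero φ).symm
  have hL' : ampl1 N n (Lgen N R) 0 = ampl2 N n ((L1F N).map φ) 0 := by
    rw [ampl1_as_ampl2 n hn]
    exact congrArg (fun M => ampl2 N n M 0) hL
  rw [hR, hL']
  simp only [← ampl2_mul, ← Matrix.map_mul]
  congr 1
  ext p r
  simp only [Matrix.map_apply]
  exact RingQuot.mkAlgHom_rel ℂ (REArel.rel p r)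

end FinalSection

/-- Tr_{R(1…n)}( L_{\bar{1→n}} · R₁ R₂ ⋯ R_{n−1} ) = Tr_R( Lⁿ ) in L(R);
in particular the weight system takes the same value on τ₁⋯τ_{n−1} and τ_{n−1}⋯τ₁. -/
theorem statement_10 (N : ℕ) (hN : 1 ≤ N) (q : ℂ) (hq0 : q ≠ 0) (hq1 : q ≠ 1) (hqm1 : q ≠ -1)
    (R : Matrix (Fin N × Fin N) (Fin N × Fin N) ℂ)
    (hbraid : ampl2 N 3 R 0 * ampl2 N 3 R 1 * ampl2 N 3 R 0 =
      ampl2 N 3 R 1 * ampl2 N 3 R 0 * ampl2 N 3 R 1)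
    (hHecke : (q • (1 : Matrix (Fin N × Fin N) (Fin N × Fin N) ℂ) - R) * (q⁻¹ • 1 + R) = 0)
    (Ψ : Matrix (Fin N × Fin N) (Fin N × Fin N) ℂ)
    (hΨ : ∀ i j k m : Fin N, ∑ a : Fin N, ∑ b : Fin N,
        R (i, b) (j, a) * Ψ (a, k) (b, m) = if i = m ∧ k = j then 1 else 0)
    (C : Matrix (Fin N) (Fin N) ℂ)
    (hC : ∀ i j : Fin N, C i j = ∑ k : Fin N, Ψ (i, k) (j, k))
    (n : ℕ) (hn : 2 ≤ n) :
    trRn N n C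
      (Ltot N n R q (Lgen N R) *
        (((List.range (n - 1)).map
          (fun k => ampl2 N n (R.map (algebraMap ℂ (REA N R))) k)).prod)) =
        trR1 N C (Lgen N R ^ n) ∧
    trRn N n C
      (Ltot N n R q (Lgen N R) *
        (((List.range (n - 1)).map
          (fun k => ampl2 N n (R.map (algebraMap ℂ (REA N R))) k)).prod)) =
      trRn N n C
        (Ltot N n R q (Lgen N R) *
          (((List.range (n - 1)).reverse.map
            (fun k => ampl2 N n (R.map (algebraMap ℂ (REA N R))) k)).prod)) := by
  have hqq : q * q⁻¹ = 1 := mul_inv_cancel₀ hq0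
  have hR2 : R * R = 1 + (q - q⁻¹) • R := by
    have h := hHecke
    simp only [sub_mul, mul_add, smul_mul_assoc, mul_smul_comm, one_mul, mul_one, smul_smul,
      smul_sub, mul_comm q⁻¹ q, hqq, one_smul] at h
    have h' : R * R = 1 + q • R - q⁻¹ • R := by
      rw [← sub_eq_zero, ← neg_eq_zero, ← h]
      abel
    rw [h', sub_smul]
    abel
  have hSR : (R - (q - q⁻¹) • 1) * R = 1 := by
    rw [sub_mul, smul_mul_assoc, one_mul, hR2]; abel
  have hRS : R * (R - (q - q⁻¹) • 1) = 1 := mul_eq_one_comm.mp hSR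
  have hRC := trC R Ψ hΨ C hC
  set S := R - (q - q⁻¹) • (1 : Matrix (Fin N × Fin N) (Fin N × Fin N) ℂ) with hS
  have hrs3 : ∀ k, k + 2 ≤ 3 → ampl2 N 3 R k * ampl2 N 3 S k = 1 := fun k hk => by
    rw [← ampl2_mul, hRS, ampl2_one _ _ hk]
  have hsr3 : ∀ k, k + 2 ≤ 3 → ampl2 N 3 S k * ampl2 N 3 R k = 1 := fun k hk => by
    rw [← ampl2_mul, hSR, ampl2_one _ _ hk]
  have hCS := CC_comm R S Ψ hΨ C hC hRS hSR
    (by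
      calc _ = (ampl2 N 3 S 0 * ampl2 N 3 R 0) * ampl2 N 3 R 1 * ampl2 N 3 R 0 *
            ampl2 N 3 S 1 := by rw [hsr3 0 (by omega), one_mul]
        _ = ampl2 N 3 S 0 * (ampl2 N 3 R 0 * ampl2 N 3 R 1 * ampl2 N 3 R 0) *
            ampl2 N 3 S 1 := by simp only [mul_assoc]
        _ = ampl2 N 3 S 0 * ampl2 N 3 R 1 * ampl2 N 3 R 0 *
            (ampl2 N 3 R 1 * ampl2 N 3 S 1) := by rw [hbraid]; simp only [mul_assoc]
        _ = _ := by rw [hrs3 1 (by omega), mul_one])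
    (by
      calc _ = ampl2 N 3 S 1 * ampl2 N 3 R 0 * ampl2 N 3 R 1 *
            (ampl2 N 3 R 0 * ampl2 N 3 S 0) := by rw [hrs3 0 (by omega), mul_one]
        _ = ampl2 N 3 S 1 * (ampl2 N 3 R 0 * ampl2 N 3 R 1 * ampl2 N 3 R 0) *
            ampl2 N 3 S 0 := by simp only [mul_assoc]
        _ = (ampl2 N 3 S 1 * ampl2 N 3 R 1) * ampl2 N 3 R 0 * ampl2 N 3 R 1 *
            ampl2 N 3 S 0 := by rw [hbraid]; simp only [mul_assoc]
        _ = _ := by rw [hsr3 1 (by omega), one_mul])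
  have hCR : (Matrix.of fun p r : Fin N × Fin N => C p.1 r.1 * C p.2 r.2) * R =
      R * (Matrix.of fun p r : Fin N × Fin N => C p.1 r.1 * C p.2 r.2) := by
    have hR' : R = S + (q - q⁻¹) • 1 := by rw [hS]; abel
    rw [hR', mul_add, add_mul, hCS]
    simp
  have hC2 : Cpow C * toFn2 R = toFn2 R * Cpow C := by
    have e : (Cpow C : Matrix (Fin 2 → Fin N) (Fin 2 → Fin N) ℂ) =
        toFn2 (Matrix.of fun p r : Fin N × Fin N => C p.1 r.1 * C p.2 r.2) := by
      ext i j
      simp [Cpow, toFn2, Fin.prod_univ_two]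
    rw [e]
    unfold toFn2
    rw [Matrix.submatrix_mul_equiv, Matrix.submatrix_mul_equiv, hCR]
  have hCn : ∀ k, k + 2 ≤ n → Cpow C * ampl2 N n R k = ampl2 N n R k * Cpow C := by
    intro k hk
    rw [ampl2_eq n k hk]
    exact Cpow_comm (shiftPos_inj _ _ _ _) C _ hC2
  have cen : ∀ (M : Matrix (Fin N × Fin N) (Fin N × Fin N) ℂ) i j (x : REA N R),
      M.map (algebraMap ℂ (REA N R)) i j * x = x * M.map (algebraMap ℂ (REA N R)) i j :=
    fun M i j x => by rw [Matrix.map_apply]; exact Algebra.commutes _ _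
  have H : BraidData n (fun k => ampl2 N n (R.map (algebraMap ℂ (REA N R))) k)
      (fun k => ampl2 N n (S.map (algebraMap ℂ (REA N R))) k) (ampl1 N n (Lgen N R) 0) :=
    { rs := fun k hk => by
        rw [← ampl2_mul, ← Matrix.map_mul, hRS, Matrix.map_one _ (map_zero _) (map_one _),
          ampl2_one _ _ hk]
      sr := fun k hk => by
        rw [← ampl2_mul, ← Matrix.map_mul, hSR, Matrix.map_one _ (map_zero _) (map_one _),
          ampl2_one _ _ hk]
      far_rr := fun k l h => ampl2_far n k l h _ _ (cen _)
      far_sr := fun k l h => ampl2_far n k l h _ _ (cen _)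
      far_rs := fun k l h => ampl2_far n k l h _ _ (cen _)
      far_ss := fun k l h => ampl2_far n k l h _ _ (cen _)
      far_l := fun l h => ampl1_far n l h _ _ (cen _)
      far_ls := fun l h => ampl1_far n l h _ _ (cen _)
      braid := fun k => braid_n n R hbraid k
      re := re_n n hn R }
  have hLb : Lbar N n R q (Lgen N R) =
      lbarAbs (fun k => ampl2 N n (R.map (algebraMap ℂ (REA N R))) k)
      (fun k => ampl2 N n (S.map (algebraMap ℂ (REA N R))) k) (ampl1 N n (Lgen N R) 0) := by
    funext k
    induction k with
    | zero => rfl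
    | succ k ih => simp only [Lbar, lbarAbs, ih, hS]
  have hcom : ∀ k, k + 2 ≤ n → Commute (ampl2 N n (R.map (algebraMap ℂ (REA N R))) k)
      (Ltot N n R q (Lgen N R)) := by
    intro k hk
    unfold Ltot
    rw [hLb]
    exact H.tot k n hk le_rfl
  have hsecond := coxeter_trace (n - 1) (fun k => ampl2 N n (R.map (algebraMap ℂ (REA N R))) k)
    (fun x => trRn N n C (Ltot N n R q (Lgen N R) * x))
    (by
      intro x k hk
      rw [← mul_assoc, ampl2_map, trRn_cyc n C _ _ (hCn k (by omega)), ← ampl2_map, ← mul_assoc,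
        (hcom k (by omega)).eq, mul_assoc])
    H.far_rr
  refine ⟨?_, hsecond⟩
  refine Eq.trans hsecond ?_
  obtain ⟨p, rfl⟩ : ∃ p, n = p + 1 := ⟨n - 1, by omega⟩
  have h := rev_trace R q hSR C hRC (Lgen N R) p 1
  rw [← h]
  congr 1
  unfold Ltot
  rw [List.range_succ, List.map_append, List.prod_append]
  simp
end

section
/- Let R be a skew-invertible Hecke symmetry on V = ℂ^N with parameter q (q ≠ 0, q ≠ ±1) and let L(R) be the associated reflection equation algebra with generating matrix L. Then Tr_{R(123)}( L_{\bar{1→3}} · R₂ R₁ R₂ ) = Tr_R( L ) · Tr_R( L² ) + (q − q⁻¹) · Tr_R( L³ ), an identity in L(R). -/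
open scoped BigOperators

namespace REAproof

/-- M ⊗ 1 on an extra last factor. -/
def amp {A : Type*} [Semiring A] {J I : Type*} [DecidableEq I] (M : Matrix J J A) :
    Matrix (J × I) (J × I) A := fun p r => if p.2 = r.2 then M p.1 r.1 else 0

/-- Operator in positions 2, 3. -/
def A23 {A : Type*} [Semiring A] {I : Type*} [DecidableEq I] (M : Matrix (I × I) (I × I) A) :
    Matrix ((I × I) × I) ((I × I) × I) A :=
  fun p r => if p.1.1 = r.1.1 then M (p.1.2, p.2) (r.1.2, r.2) else 0

/-- Partial trace over the last factor. -/
noncomputable def pt {A : Type*} [Ring A] [Algebra ℂ A] {J I : Type*} [Fintype I]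
    (C : Matrix I I ℂ) (M : Matrix (J × I) (J × I) A) : Matrix J J A :=
  fun i j => ∑ a, ∑ b, algebraMap ℂ A (C a b) * M (i, b) (j, a)

/-- The relabelling of indices. -/
def e3 (N : ℕ) : (Fin N × Fin N) × Fin N ≃ (Fin 3 → Fin N) where
  toFun p := ![p.1.1, p.1.2, p.2]
  invFun f := ((f 0, f 1), f 2)
  left_inv p := by simp
  right_inv f := by ext i; fin_cases i <;> rfl

set_option linter.unusedSimpArgs false
set_option linter.unusedSectionVars false
section
variable {A : Type*} [Ring A] [Algebra ℂ A] {J I : Type*} [Fintype I] [DecidableEq I]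
  [Fintype J] [DecidableEq J]


lemma amp_mul (M M' : Matrix J J A) : (amp (M * M') : Matrix (J × I) (J × I) A) = amp M * amp M' := by
  ext p r
  simp only [amp, Matrix.mul_apply, Fintype.sum_prod_type]
  simp only [ite_mul, mul_ite, zero_mul, mul_zero, Finset.sum_ite_eq, Finset.mem_univ, if_true]
  split_ifs with h <;> simp [h]

lemma amp_one : (amp (1 : Matrix J J A) : Matrix (J × I) (J × I) A) = 1 := by
  ext p r
  simp only [amp, Matrix.one_apply, Prod.ext_iff]
  split_ifs <;> simp_all

lemma A23_mul (M M' : Matrix (I × I) (I × I) A) : A23 (M * M') = A23 M * A23 M' := by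
  ext p r
  simp only [A23, Matrix.mul_apply, Fintype.sum_prod_type]
  simp only [ite_mul, mul_ite, zero_mul, mul_zero, Finset.sum_ite_irrel, Finset.sum_const_zero,
    Finset.sum_ite_eq, Finset.mem_univ, if_true]
  split_ifs with h <;> simp [h]

lemma A23_one : A23 (1 : Matrix (I × I) (I × I) A) = 1 := by
  ext p r
  simp only [A23, Matrix.one_apply, Prod.ext_iff]
  split_ifs <;> simp_all

lemma amp_A23_comm (X : Matrix I I A) (M : Matrix (I × I) (I × I) ℂ) :
    amp (amp X) * A23 (M.map (algebraMap ℂ A)) = A23 (M.map (algebraMap ℂ A)) * amp (amp X) := by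
  ext p r
  simp only [A23, amp, Matrix.mul_apply, Fintype.sum_prod_type, Matrix.map_apply]
  simp only [ite_mul, mul_ite, zero_mul, mul_zero, Finset.sum_ite_irrel, Finset.sum_const_zero,
    Finset.sum_ite_eq, Finset.sum_ite_eq', Finset.mem_univ, if_true]
  exact (Algebra.commutes _ _).symm

lemma pt_amp_mul (C : Matrix I I ℂ) (M : Matrix J J A) (X : Matrix (J × I) (J × I) A) :
    pt C (amp M * X) = M * pt C X := by
  ext i j
  simp only [amp, pt, Matrix.mul_apply, Fintype.sum_prod_type]
  simp only [ite_mul, zero_mul, Finset.sum_ite_eq, Finset.mem_univ, if_true, Finset.mul_sum]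
  rw [Finset.sum_comm' (t' := Finset.univ) (s' := fun _ => Finset.univ) (by simp)]
  conv_rhs => rw [Finset.sum_comm]
  conv_lhs => rw [Finset.sum_comm]
  refine Finset.sum_congr rfl fun a _ => ?_
  rw [Finset.sum_comm]
  refine Finset.sum_congr rfl fun a _ => Finset.sum_congr rfl fun b _ => ?_
  rw [← mul_assoc, ← mul_assoc, Algebra.commutes]

lemma pt_mul_amp (C : Matrix I I ℂ) (M : Matrix J J A) (X : Matrix (J × I) (J × I) A) :
    pt C (X * amp M) = pt C X * M := by
  ext i j
  simp only [amp, pt, Matrix.mul_apply, Fintype.sum_prod_type]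
  simp only [mul_ite, mul_zero, Finset.sum_ite_eq', Finset.mem_univ, if_true, Finset.mul_sum,
    Finset.sum_mul]
  conv_rhs => rw [Finset.sum_comm]
  refine Finset.sum_congr rfl fun a _ => ?_
  rw [Finset.sum_comm]
  refine Finset.sum_congr rfl fun a _ => Finset.sum_congr rfl fun b _ => ?_
  rw [← mul_assoc]

lemma pt_A23 (C : Matrix I I ℂ) (M : Matrix (I × I) (I × I) A) (h : pt C M = 1) :
    pt C (A23 M) = 1 := by
  ext i j
  have := congrFun (congrFun h i.2) j.2
  simp only [pt, A23] at this ⊢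
  by_cases h1 : i.1 = j.1
  · simp only [h1, if_true, this, Matrix.one_apply, Prod.ext_iff, true_and]
  · simp [h1, Matrix.one_apply, Prod.ext_iff]

end

lemma S_ampl0 {A : Type*} [Semiring A] (N : ℕ) (M : Matrix (Fin N × Fin N) (Fin N × Fin N) A) :
    (ampl2 N 3 M 0).submatrix (e3 N) (e3 N) = amp M := by
  ext p r
  simp [ampl2, amp, e3, Fin.forall_fin_succ]

lemma S_ampl1 {A : Type*} [Semiring A] (N : ℕ) (M : Matrix (Fin N × Fin N) (Fin N × Fin N) A) :
    (ampl2 N 3 M 1).submatrix (e3 N) (e3 N) = A23 M := by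
  ext p r
  simp [ampl2, A23, e3, Fin.forall_fin_succ]

lemma S_ampl {A : Type*} [Semiring A] (N : ℕ) (X : Matrix (Fin N) (Fin N) A) :
    (ampl1 N 3 X 0).submatrix (e3 N) (e3 N) = amp (amp X) := by
  ext p r
  by_cases h1 : p.1.2 = r.1.2 <;> by_cases h2 : p.2 = r.2 <;>
    simp [ampl1, amp, e3, Fin.forall_fin_succ, h1, h2]

lemma trRn_eq {A : Type*} [Ring A] [Algebra ℂ A] (N : ℕ) (C : Matrix (Fin N) (Fin N) ℂ)
    (M : Matrix (Fin 3 → Fin N) (Fin 3 → Fin N) A) :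
    trRn N 3 C M = trR1 N C (pt C (pt C (M.submatrix (e3 N) (e3 N)))) := by
  simp only [trRn, trR1, pt, Matrix.submatrix_apply]
  rw [← (e3 N).sum_comp]
  simp_rw [← (e3 N).sum_comp, Fintype.sum_prod_type]
  simp only [Finset.mul_sum]
  refine Finset.sum_congr rfl fun a _ => ?_
  conv_lhs =>
    enter [2, b]
    rw [Finset.sum_comm]
  rw [Finset.sum_comm]
  refine Finset.sum_congr rfl fun a' _ => ?_
  refine Finset.sum_congr rfl fun b _ => ?_
  rw [Finset.sum_comm]
  refine Finset.sum_congr rfl fun b' _ => ?_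
  refine Finset.sum_congr rfl fun c _ => ?_
  refine Finset.sum_congr rfl fun c' _ => ?_
  simp [e3, Fin.prod_univ_succ, mul_assoc]

lemma ring_id {B : Type*} [Ring B] (r1 s1 r2 s2 l : B) (h1 : r1 * s1 = 1) (h1' : s1 * r1 = 1)
    (h2 : r2 * s2 = 1) (h2' : s2 * r2 = 1) (hb : r1 * r2 * r1 = r2 * r1 * r2)
    (hl : l * r2 = r2 * l) :
    l * (r1 * l * s1) * (r2 * (r1 * l * s1) * s2) * r2 * r1 * r2 = l * r1 * l * r2 * (r1 * l) := by
  have key : s1 * r2 * r1 = r2 * r1 * s2 := by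
    calc s1 * r2 * r1 = s1 * (r2 * r1 * r2) * s2 := by
          simp only [mul_assoc, h2, mul_one]
      _ = (s1 * r1) * r2 * r1 * s2 := by rw [← hb]; simp only [mul_assoc]
      _ = _ := by rw [h1', one_mul]
  have k2 : s2 * l * r2 = l := by rw [mul_assoc, hl, ← mul_assoc, h2', one_mul]
  calc _ = l * r1 * l * (s1 * r2 * r1) * l * (s1 * ((s2 * r2) * r1)) * r2 := by
        simp only [mul_assoc]
    _ = l * r1 * l * r2 * r1 * (s2 * l * r2) := by
        rw [h2', one_mul, h1', key]; simp only [mul_assoc, one_mul]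
    _ = _ := by rw [k2]; simp only [mul_assoc]

lemma perm5 {A I : Type*} [AddCommMonoid A] [Fintype I] (F : I → I → I → I → I → A) :
    ∑ a, ∑ b, ∑ e, ∑ d, ∑ c, F a b e d c = ∑ e, ∑ c, ∑ a, ∑ b, ∑ d, F a b e d c := by
  calc _ = ∑ a, ∑ e, ∑ b, ∑ d, ∑ c, F a b e d c :=
        Finset.sum_congr rfl fun a _ => Finset.sum_comm
    _ = ∑ e, ∑ a, ∑ b, ∑ d, ∑ c, F a b e d c := Finset.sum_comm
    _ = ∑ e, ∑ a, ∑ b, ∑ c, ∑ d, F a b e d c :=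
        Finset.sum_congr rfl fun e _ => Finset.sum_congr rfl fun a _ =>
          Finset.sum_congr rfl fun b _ => Finset.sum_comm
    _ = ∑ e, ∑ a, ∑ c, ∑ b, ∑ d, F a b e d c :=
        Finset.sum_congr rfl fun e _ => Finset.sum_congr rfl fun a _ => Finset.sum_comm
    _ = _ := Finset.sum_congr rfl fun e _ => Finset.sum_comm

/-- The key property of the R-trace. -/
lemma pt_conj_scalar {I : Type*} [Fintype I] [DecidableEq I]
    (R Q Ψ : Matrix (I × I) (I × I) ℂ) (C : Matrix I I ℂ)
    (hRQ : R * Q = 1) (hQR : Q * R = 1)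
    (hb : amp R * A23 R * amp R = A23 R * amp R * A23 R)
    (hΨ : ∀ i j k m : I, ∑ a, ∑ b, R (i, b) (j, a) * Ψ (a, k) (b, m) = if i = m ∧ k = j then 1 else 0)
    (hpt : pt C R = 1) (i j c e : I) :
    ∑ a, ∑ b, ∑ d, C a b * R (i, b) (c, d) * Q (e, d) (j, a) = if i = j then C e c else 0 := by
  -- the slices of R span
  let Rh : Matrix (I × I) (I × I) ℂ := fun x y => R (x.1, y.2) (x.2, y.1)
  let Ph : Matrix (I × I) (I × I) ℂ := fun y z => Ψ (y.1, z.2) (y.2, z.1)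
  have hRP : Rh * Ph = 1 := by
    ext x z
    rw [Matrix.mul_apply, Fintype.sum_prod_type]
    refine (hΨ x.1 x.2 z.2 z.1).trans ?_
    simp only [Matrix.one_apply, Prod.ext_iff, eq_comm]
  have hPR : Ph * Rh = 1 := mul_eq_one_comm.mp hRP
  have hconj : pt C (A23 R * amp R * A23 Q) = 1 := by
    have h23 : A23 R * A23 Q = 1 := by rw [← A23_mul, hRQ, A23_one]
    have h12 : (amp Q : Matrix ((I × I) × I) ((I × I) × I) ℂ) * amp R = 1 := by
      rw [← amp_mul, hQR, amp_one]
    have : A23 R * amp R * A23 Q = amp Q * (A23 R * amp R) := by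
      calc A23 R * amp R * A23 Q = (amp Q * amp R) * A23 R * amp R * A23 Q := by
            rw [h12, one_mul]
        _ = amp Q * (amp R * A23 R * amp R) * A23 Q := by simp only [mul_assoc]
        _ = amp Q * (A23 R * amp R) * (A23 R * A23 Q) := by rw [hb]; simp only [mul_assoc]
        _ = _ := by rw [h23, mul_one]
    rw [this, pt_amp_mul, pt_mul_amp, pt_A23 C R hpt, one_mul, hQR]
  let T : I × I → ℂ := fun y => ∑ a, ∑ b, ∑ d, C a b * R (i, b) (y.2, d) * Q (y.1, d) (j, a)
    - if i = j then C y.1 y.2 else 0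
  have hT : Rh.mulVec T = 0 := by
    ext x
    have h1 := congrFun (congrFun hconj (x.1, i)) (x.2, j)
    have h2 := congrFun (congrFun hpt x.1) x.2
    simp only [pt, Matrix.mul_apply, A23, amp, Fintype.sum_prod_type] at h1
    simp only [ite_mul, mul_ite, zero_mul, mul_zero, Finset.sum_ite_irrel, Finset.sum_const_zero,
      Finset.sum_ite_eq, Finset.sum_ite_eq', Finset.mem_univ, if_true] at h1
    simp only [pt] at h2
    simp only [Matrix.mulVec, dotProduct, Fintype.sum_prod_type, Rh, T, mul_sub,
      Finset.sum_sub_distrib, Pi.zero_apply]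
    simp only [Algebra.algebraMap_self, RingHom.id_apply] at h1 h2
    have h3 : (∑ e, ∑ c, R (x.1, c) (x.2, e) *
        ∑ a, ∑ b, ∑ d, C a b * R (i, b) (c, d) * Q (e, d) (j, a)) =
        (1 : Matrix (I × I) (I × I) ℂ) (x.1, i) (x.2, j) := by
      rw [← h1]
      simp only [Finset.mul_sum, Finset.sum_mul]
      conv_rhs => rw [perm5]
      refine Finset.sum_congr rfl fun e _ => Finset.sum_congr rfl fun c _ =>
        Finset.sum_congr rfl fun a _ => Finset.sum_congr rfl fun b _ =>
        Finset.sum_congr rfl fun d _ => ?_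
      ring
    rw [h3]
    by_cases hij : i = j
    · subst hij
      simp only [if_true]
      simp only [mul_comm (R _ _), h2, Matrix.one_apply, Prod.ext_iff, and_true, sub_self]
    · simp [hij, Matrix.one_apply, Prod.ext_iff]
  have hT0 : T = 0 := by
    have := congrArg Ph.mulVec hT
    rwa [Matrix.mulVec_mulVec, hPR, Matrix.one_mulVec, Matrix.mulVec_zero] at this
  have := congrFun hT0 (e, c)
  simp only [T, Pi.zero_apply] at this
  exact sub_eq_zero.mp this

lemma pt_conj {A : Type*} [Ring A] [Algebra ℂ A] (N : ℕ)
    (R Q : Matrix (Fin N × Fin N) (Fin N × Fin N) ℂ) (C : Matrix (Fin N) (Fin N) ℂ)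
    (h : ∀ i j c e : Fin N,
      ∑ a, ∑ b, ∑ d, C a b * R (i, b) (c, d) * Q (e, d) (j, a) = if i = j then C e c else 0)
    (X : Matrix (Fin N) (Fin N) A) :
    pt C (R.map (algebraMap ℂ A) * amp X * Q.map (algebraMap ℂ A)) =
      Matrix.diagonal (fun _ => trR1 N C X) := by
  ext i j
  have : pt C (R.map (algebraMap ℂ A) * amp X * Q.map (algebraMap ℂ A)) i j =
      ∑ e, ∑ c, algebraMap ℂ A (∑ a, ∑ b, ∑ d, C a b * R (i, b) (c, d) * Q (e, d) (j, a)) * X c e := by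
    simp only [pt, Matrix.mul_apply, amp, Fintype.sum_prod_type, Matrix.map_apply]
    simp only [mul_ite, mul_zero, Finset.sum_ite_eq', Finset.sum_ite_eq, Finset.mem_univ, if_true]
    simp only [map_sum, Finset.sum_mul, Finset.mul_sum, map_mul]
    rw [perm5]
    refine Finset.sum_congr rfl fun e _ => Finset.sum_congr rfl fun c _ =>
      Finset.sum_congr rfl fun a _ => Finset.sum_congr rfl fun b _ =>
      Finset.sum_congr rfl fun d _ => ?_
    rw [mul_assoc (algebraMap ℂ A (R _ _)), ← Algebra.commutes (Q (e, d) (j, a))]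
    simp only [mul_assoc]
  rw [this]
  simp only [h, Matrix.diagonal_apply, trR1]
  split_ifs <;> simp

lemma trR1_diag {A : Type*} [Ring A] [Algebra ℂ A] (N : ℕ) (C : Matrix (Fin N) (Fin N) ℂ)
    (x : A) (X : Matrix (Fin N) (Fin N) A) :
    trR1 N C (Matrix.diagonal (fun _ => x) * X) = x * trR1 N C X := by
  simp only [trR1, Matrix.diagonal_mul, Finset.mul_sum]
  refine Finset.sum_congr rfl fun a _ => Finset.sum_congr rfl fun b _ => ?_
  rw [← mul_assoc, ← mul_assoc, Algebra.commutes]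

lemma RE (N : ℕ) (R : Matrix (Fin N × Fin N) (Fin N × Fin N) ℂ) :
    R.map (algebraMap ℂ (REA N R)) * amp (Lgen N R) * R.map (algebraMap ℂ (REA N R)) * amp (Lgen N R)
    = amp (Lgen N R) * R.map (algebraMap ℂ (REA N R)) * amp (Lgen N R) *
      R.map (algebraMap ℂ (REA N R)) := by
  let φ := RingQuot.mkAlgHom ℂ (REArel N R)
  have hR : R.map (algebraMap ℂ (REA N R)) =
      (R.map (algebraMap ℂ (FreeAlgebra ℂ (Fin N × Fin N)))).map φ := by
    ext p r
    exact (φ.commutes _).symm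
  have hL : amp (Lgen N R) = (L1F N).map φ := by
    ext p r
    simp only [amp, L1F, Matrix.map_apply, Lgen]
    split_ifs <;> simp [φ]
  rw [hR, hL]
  simp only [← Matrix.map_mul]
  ext p r
  exact RingQuot.mkAlgHom_rel ℂ (REArel.rel p r)

end REAproof
/-- Tr_{R(123)}( L_{\bar{1→3}} · R₂R₁R₂ ) =
Tr_R(L)·Tr_R(L²) + (q − q⁻¹)·Tr_R(L³) in L(R). -/
theorem statement_12 (N : ℕ) (hN : 1 ≤ N) (q : ℂ) (hq0 : q ≠ 0) (hq1 : q ≠ 1) (hqm1 : q ≠ -1)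
    (R : Matrix (Fin N × Fin N) (Fin N × Fin N) ℂ)
    (hbraid : ampl2 N 3 R 0 * ampl2 N 3 R 1 * ampl2 N 3 R 0 =
      ampl2 N 3 R 1 * ampl2 N 3 R 0 * ampl2 N 3 R 1)
    (hHecke : (q • (1 : Matrix (Fin N × Fin N) (Fin N × Fin N) ℂ) - R) * (q⁻¹ • 1 + R) = 0)
    (Ψ : Matrix (Fin N × Fin N) (Fin N × Fin N) ℂ)
    (hΨ : ∀ i j k m : Fin N, ∑ a : Fin N, ∑ b : Fin N,
        R (i, b) (j, a) * Ψ (a, k) (b, m) = if i = m ∧ k = j then 1 else 0)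
    (C : Matrix (Fin N) (Fin N) ℂ)
    (hC : ∀ i j : Fin N, C i j = ∑ k : Fin N, Ψ (i, k) (j, k)) :
    trRn N 3 C
      (Ltot N 3 R q (Lgen N R) *
        ampl2 N 3 (R.map (algebraMap ℂ (REA N R))) 1 *
        ampl2 N 3 (R.map (algebraMap ℂ (REA N R))) 0 *
        ampl2 N 3 (R.map (algebraMap ℂ (REA N R))) 1) =
      trR1 N C (Lgen N R) * trR1 N C (Lgen N R ^ 2) +
        algebraMap ℂ (REA N R) (q - q⁻¹) * trR1 N C (Lgen N R ^ 3) := by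

  have hHR : R * R = (q - q⁻¹) • R + 1 := by
    have h := hHecke
    simp only [sub_mul, mul_add, Matrix.smul_mul, Matrix.mul_smul, one_mul, mul_one, smul_smul,
      mul_inv_cancel₀ hq0, inv_mul_cancel₀ hq0, one_smul] at h
    rw [sub_smul]
    rw [← sub_eq_zero, ← neg_eq_zero, ← h]
    abel
  obtain ⟨Q, hQ⟩ : ∃ Q, Q = R - (q - q⁻¹) • (1 : Matrix (Fin N × Fin N) (Fin N × Fin N) ℂ) :=
    ⟨_, rfl⟩
  have hRQ : R * Q = 1 := by
    rw [hQ, mul_sub, hHR, Matrix.mul_smul, mul_one]; abel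
  have hQR : Q * R = 1 := mul_eq_one_comm.mp hRQ
  have hb : REAproof.amp R * REAproof.A23 R * REAproof.amp R =
      REAproof.A23 R * REAproof.amp R * REAproof.A23 R := by
    have h := congrArg (fun M => M.submatrix (REAproof.e3 N) (REAproof.e3 N)) hbraid
    simpa only [← Matrix.submatrix_mul_equiv _ _ _ (REAproof.e3 N), REAproof.S_ampl0,
      REAproof.S_ampl1] using h
  have hpt : REAproof.pt C R = 1 := by
    ext i j
    have h : ∑ k, ∑ a, ∑ b, R (i, b) (j, a) * Ψ (a, k) (b, k) =
        ∑ k, if i = k ∧ k = j then (1 : ℂ) else 0 :=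
      Finset.sum_congr rfl fun k _ => hΨ i j k k
    simp only [ite_and, Finset.sum_ite_eq, Finset.mem_univ, if_true] at h
    rw [Matrix.one_apply, ← h, Finset.sum_comm]
    simp only [REAproof.pt]
    refine Finset.sum_congr rfl fun a _ => ?_
    rw [Finset.sum_comm]
    refine Finset.sum_congr rfl fun b _ => ?_
    rw [hC, ← Finset.mul_sum, mul_comm]; rfl
  have hconj := REAproof.pt_conj_scalar R Q Ψ C hRQ hQR hb hΨ hpt
  have hX := REAproof.pt_conj (A := REA N R) N R Q C hconj (Lgen N R)
  have hre := REAproof.RE N R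
  have hRQ' : R.map (algebraMap ℂ (REA N R)) * Q.map (algebraMap ℂ (REA N R)) = 1 := by
    rw [← Matrix.map_mul, hRQ, Matrix.map_one _ (map_zero _) (map_one _)]
  have hQR' : Q.map (algebraMap ℂ (REA N R)) * R.map (algebraMap ℂ (REA N R)) = 1 := by
    rw [← Matrix.map_mul, hQR, Matrix.map_one _ (map_zero _) (map_one _)]
  have hpt' : REAproof.pt C (R.map (algebraMap ℂ (REA N R))) = 1 := by
    ext i j
    have h := congrArg (algebraMap ℂ (REA N R)) (congrFun (congrFun hpt i) j)
    simp only [REAproof.pt, map_sum, map_mul] at h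
    simp only [REAproof.pt, Matrix.map_apply]
    refine h.trans ?_
    simp only [Matrix.one_apply]
    split_ifs <;> simp
  have hb' : REAproof.amp (R.map (algebraMap ℂ (REA N R))) *
      REAproof.A23 (R.map (algebraMap ℂ (REA N R))) * REAproof.amp (R.map (algebraMap ℂ (REA N R))) =
      REAproof.A23 (R.map (algebraMap ℂ (REA N R))) * REAproof.amp (R.map (algebraMap ℂ (REA N R))) *
      REAproof.A23 (R.map (algebraMap ℂ (REA N R))) := by
    have h1 : (REAproof.amp (R.map (algebraMap ℂ (REA N R))) :
        Matrix ((Fin N × Fin N) × Fin N) ((Fin N × Fin N) × Fin N) (REA N R)) =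
        (REAproof.amp R).map (algebraMap ℂ (REA N R)) := by
      ext p r; simp only [REAproof.amp, Matrix.map_apply]; split_ifs <;> simp
    have h2 : REAproof.A23 (R.map (algebraMap ℂ (REA N R))) =
        (REAproof.A23 R).map (algebraMap ℂ (REA N R)) := by
      ext p r; simp only [REAproof.A23, Matrix.map_apply]; split_ifs <;> simp
    rw [h1, h2]
    simp only [← Matrix.map_mul, hb]
  have hRsplit : R.map (algebraMap ℂ (REA N R)) = Q.map (algebraMap ℂ (REA N R)) +
      Matrix.diagonal (fun _ => algebraMap ℂ (REA N R) (q - q⁻¹)) := by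
    ext p r
    simp only [hQ, Matrix.map_apply, Matrix.add_apply, Matrix.sub_apply, Matrix.smul_apply,
      Matrix.one_apply, Matrix.diagonal_apply]
    split_ifs <;> simp
  have htot : (Ltot N 3 R q (Lgen N R)) = ampl1 N 3 (Lgen N R) 0 *
      (ampl2 N 3 (R.map (algebraMap ℂ (REA N R))) 0 * ampl1 N 3 (Lgen N R) 0 *
        ampl2 N 3 (Q.map (algebraMap ℂ (REA N R))) 0) *
      (ampl2 N 3 (R.map (algebraMap ℂ (REA N R))) 1 *
        (ampl2 N 3 (R.map (algebraMap ℂ (REA N R))) 0 * ampl1 N 3 (Lgen N R) 0 *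
        ampl2 N 3 (Q.map (algebraMap ℂ (REA N R))) 0) *
        ampl2 N 3 (Q.map (algebraMap ℂ (REA N R))) 1) := by
    rw [hQ]
    simp [Ltot, List.range_succ, Lbar, mul_assoc]
  rw [REAproof.trRn_eq, htot]
  simp only [← Matrix.submatrix_mul_equiv _ _ _ (REAproof.e3 N), REAproof.S_ampl0,
      REAproof.S_ampl1, REAproof.S_ampl]
  rw [REAproof.ring_id _ _ _ _ _
    (by rw [← REAproof.amp_mul, hRQ', REAproof.amp_one])
    (by rw [← REAproof.amp_mul, hQR', REAproof.amp_one])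
    (by rw [← REAproof.A23_mul, hRQ', REAproof.A23_one])
    (by rw [← REAproof.A23_mul, hQR', REAproof.A23_one]) hb'
    (REAproof.amp_A23_comm _ _)]
  simp only [← REAproof.amp_mul]
  rw [REAproof.pt_mul_amp, REAproof.pt_amp_mul, REAproof.pt_A23 _ _ hpt', mul_one, ← mul_assoc,
    ← hre]
  generalize hr : R.map (algebraMap ℂ (REA N R)) = r at *
  have hsum : r * REAproof.amp (Lgen N R) * r * REAproof.amp (Lgen N R) * REAproof.amp (Lgen N R) =
      r * REAproof.amp (Lgen N R) * Q.map (algebraMap ℂ (REA N R)) * REAproof.amp (Lgen N R ^ 2) +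
      Matrix.diagonal (fun _ => algebraMap ℂ (REA N R) (q - q⁻¹)) *
        (r * REAproof.amp (Lgen N R ^ 3)) := by
    have hc : ∀ X : Matrix (Fin N × Fin N) (Fin N × Fin N) (REA N R),
        X * Matrix.diagonal (fun _ => algebraMap ℂ (REA N R) (q - q⁻¹)) =
        Matrix.diagonal (fun _ => algebraMap ℂ (REA N R) (q - q⁻¹)) * X := by
      intro X
      ext i j
      rw [Matrix.mul_diagonal, Matrix.diagonal_mul, Algebra.commutes]
    have e1 : r * REAproof.amp (Lgen N R) * r * REAproof.amp (Lgen N R) * REAproof.amp (Lgen N R) =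
        r * REAproof.amp (Lgen N R) * (Q.map (algebraMap ℂ (REA N R)) +
          Matrix.diagonal (fun _ => algebraMap ℂ (REA N R) (q - q⁻¹))) *
          REAproof.amp (Lgen N R) * REAproof.amp (Lgen N R) := by rw [← hRsplit]
    rw [e1, mul_add, hc, add_mul, add_mul]
    simp only [pow_succ, pow_zero, one_mul, REAproof.amp_mul, mul_assoc]
  have hptdiag : ∀ (x : ℂ) (X : Matrix (Fin N × Fin N) (Fin N × Fin N) (REA N R)),
      REAproof.pt C (Matrix.diagonal (fun _ => algebraMap ℂ (REA N R) x) * X) =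
      Matrix.diagonal (fun _ => algebraMap ℂ (REA N R) x) * REAproof.pt C X := by
    intro x X
    ext i j
    simp only [REAproof.pt, Matrix.diagonal_mul, Finset.mul_sum]
    refine Finset.sum_congr rfl fun a _ => Finset.sum_congr rfl fun b _ => ?_
    rw [← mul_assoc, ← mul_assoc, Algebra.commutes]
  have hptadd : ∀ X Y : Matrix (Fin N × Fin N) (Fin N × Fin N) (REA N R),
      REAproof.pt C (X + Y) = REAproof.pt C X + REAproof.pt C Y := by
    intro X Y
    ext i j
    simp only [REAproof.pt, Matrix.add_apply, mul_add, Finset.sum_add_distrib]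
  have htradd : ∀ X Y : Matrix (Fin N) (Fin N) (REA N R),
      trR1 N C (X + Y) = trR1 N C X + trR1 N C Y := by
    intro X Y
    simp only [trR1, Matrix.add_apply, mul_add, Finset.sum_add_distrib]
  rw [hsum, hptadd, hptdiag, REAproof.pt_mul_amp, REAproof.pt_mul_amp, hX, hpt', one_mul, htradd,
    REAproof.trR1_diag, REAproof.trR1_diag]
end

section
/- Let R be a skew-invertible Hecke symmetry on V = ℂ^N with parameter q (q ≠ 0, q ≠ ±1) and let L̂(R) be the associated modified reflection equation algebra with generating matrix L̂. Then Tr_{R(123)}( L̂_{\bar{1→3}} · R₂ R₁ R₂ ) = Tr_R( L̂ ) · Tr_R( L̂² ) + (q − q⁻¹) · Tr_R( L̂³ ), an identity in L̂(R). -/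
open scoped BigOperators

namespace S13

def e3 (N : ℕ) : (Fin N × Fin N) × Fin N ≃ (Fin 3 → Fin N) where
  toFun p := ![p.1.1, p.1.2, p.2]
  invFun f := ((f 0, f 1), f 2)
  left_inv p := by simp
  right_inv f := by ext i; fin_cases i <;> rfl

lemma sum3 {A : Type*} [AddCommMonoid A] (N : ℕ) (f : (Fin 3 → Fin N) → A) :
    ∑ t, f t = ∑ x, ∑ y, ∑ z, f ![x, y, z] := by
  rw [← (e3 N).sum_comp, Fintype.sum_prod_type, Fintype.sum_prod_type]
  rfl

lemma a0 {A : Type*} [Semiring A] (N : ℕ) (P : Matrix (Fin N × Fin N) (Fin N × Fin N) A)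
    (a b c x y z : Fin N) :
    ampl2 N 3 P 0 ![a, b, c] ![x, y, z] = if c = z then P (a, b) (x, y) else 0 := by
  simp [ampl2, Fin.forall_fin_succ]

lemma a1 {A : Type*} [Semiring A] (N : ℕ) (P : Matrix (Fin N × Fin N) (Fin N × Fin N) A)
    (a b c x y z : Fin N) :
    ampl2 N 3 P 1 ![a, b, c] ![x, y, z] = if a = x then P (b, c) (y, z) else 0 := by
  simp [ampl2, Fin.forall_fin_succ]

lemma ext3 {A : Type*} {N : ℕ} {M M' : Matrix (Fin 3 → Fin N) (Fin 3 → Fin N) A}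
    (h : ∀ a b c x y z, M ![a, b, c] ![x, y, z] = M' ![a, b, c] ![x, y, z]) : M = M' := by
  ext i j
  obtain ⟨⟨⟨a, b⟩, c⟩, rfl⟩ := (e3 N).surjective i
  obtain ⟨⟨⟨x, y⟩, z⟩, rfl⟩ := (e3 N).surjective j
  exact h a b c x y z

/-- X ⊗ I on pairs -/
def one1 {A : Type*} [Semiring A] {N : ℕ} (X : Matrix (Fin N) (Fin N) A) :
    Matrix (Fin N × Fin N) (Fin N × Fin N) A := fun p r => if p.2 = r.2 then X p.1 r.1 else 0

lemma ampl1_eq {A : Type*} [Semiring A] (N : ℕ) (X : Matrix (Fin N) (Fin N) A) :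
    ampl1 N 3 X 0 = ampl2 N 3 (one1 X) 0 := by
  apply ext3
  intro a b c x y z
  rw [a0]
  simp [ampl1, one1, Fin.forall_fin_succ]
  split_ifs <;> simp_all

lemma mul0 {A : Type*} [Semiring A] (N : ℕ) (P Q : Matrix (Fin N × Fin N) (Fin N × Fin N) A) :
    ampl2 N 3 P 0 * ampl2 N 3 Q 0 = ampl2 N 3 (P * Q) 0 := by
  apply ext3
  intro a b c x y z
  simp [Matrix.mul_apply, sum3, a0, Fintype.sum_prod_type, ite_mul]

lemma mul1 {A : Type*} [Semiring A] (N : ℕ) (P Q : Matrix (Fin N × Fin N) (Fin N × Fin N) A) :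
    ampl2 N 3 P 1 * ampl2 N 3 Q 1 = ampl2 N 3 (P * Q) 1 := by
  apply ext3
  intro a b c x y z
  simp only [Matrix.mul_apply, sum3, a1, Fintype.sum_prod_type]
  rw [Finset.sum_eq_single a]
  · by_cases h : a = x <;> simp [h]
  · intro d _ hd; simp [hd.symm]
  · simp

lemma vec3_eq {N : ℕ} (a b c x y z : Fin N) :
    (![a, b, c] = ![x, y, z]) ↔ (a = x ∧ b = y ∧ c = z) := by
  constructor
  · intro h
    exact ⟨congrFun h 0, congrFun h 1, congrFun h 2⟩
  · rintro ⟨rfl, rfl, rfl⟩; rfl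

lemma one0 {A : Type*} [Semiring A] (N : ℕ) :
    ampl2 N 3 (1 : Matrix (Fin N × Fin N) (Fin N × Fin N) A) 0 = 1 := by
  apply ext3
  intro a b c x y z
  rw [a0, Matrix.one_apply, Matrix.one_apply]
  simp only [vec3_eq, Prod.mk.injEq]
  split_ifs <;> simp_all

lemma one1' {A : Type*} [Semiring A] (N : ℕ) :
    ampl2 N 3 (1 : Matrix (Fin N × Fin N) (Fin N × Fin N) A) 1 = 1 := by
  apply ext3
  intro a b c x y z
  rw [a1, Matrix.one_apply, Matrix.one_apply]
  simp only [vec3_eq, Prod.mk.injEq]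
  split_ifs <;> simp_all

lemma map_ampl {A : Type*} [Ring A] [Algebra ℂ A] (N k : ℕ)
    (P : Matrix (Fin N × Fin N) (Fin N × Fin N) ℂ) :
    ampl2 N 3 (P.map (algebraMap ℂ A)) k = (ampl2 N 3 P k).map (algebraMap ℂ A) := by
  ext i j
  simp only [ampl2, Matrix.map_apply]
  split_ifs <;> simp

lemma comm1 {A : Type*} [Ring A] [Algebra ℂ A] (N : ℕ)
    (P : Matrix (Fin N × Fin N) (Fin N × Fin N) ℂ) (X : Matrix (Fin N) (Fin N) A) :
    ampl2 N 3 (P.map (algebraMap ℂ A)) 1 * ampl2 N 3 (one1 X) 0 =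
      ampl2 N 3 (one1 X) 0 * ampl2 N 3 (P.map (algebraMap ℂ A)) 1 := by
  apply ext3
  intro a b c x y z
  simp only [Matrix.mul_apply, sum3, a0, a1, one1, Matrix.map_apply]
  rw [Finset.sum_eq_single a, Finset.sum_eq_single y, Finset.sum_eq_single z,
    Finset.sum_eq_single x, Finset.sum_eq_single b, Finset.sum_eq_single c]
  · simp [Algebra.commutes]
  all_goals simp +contextual [eq_comm]
  
/-- the property of C with respect to R: R-trace of R is the identity -/
def Good {N : ℕ} (R : Matrix (Fin N × Fin N) (Fin N × Fin N) ℂ) (C : Matrix (Fin N) (Fin N) ℂ) :=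
  ∀ i j, ∑ a, ∑ b, C a b * R (i, b) (j, a) = if i = j then 1 else 0

lemma entry {A : Type*} [Ring A] [Algebra ℂ A] (N : ℕ)
    (R : Matrix (Fin N × Fin N) (Fin N × Fin N) ℂ)
    (P Q : Matrix (Fin N × Fin N) (Fin N × Fin N) A) (a b c x y z : Fin N) :
    (ampl2 N 3 P 0 * ampl2 N 3 (R.map (algebraMap ℂ A)) 1 * ampl2 N 3 Q 0)
        ![a, b, c] ![x, y, z] =
      ∑ s, ∑ t, ∑ u, algebraMap ℂ A (R (t, c) (u, z)) * (P (a, b) (s, t) * Q (s, u) (x, y)) := by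
  simp only [Matrix.mul_apply, sum3, a0, a1, Matrix.map_apply]
  refine Finset.sum_congr rfl fun s _ => ?_
  rw [Finset.sum_comm]
  refine Eq.trans ?_ Finset.sum_comm
  refine Eq.trans Finset.sum_comm ?_
  refine Finset.sum_congr rfl fun u _ => ?_
  rw [Finset.sum_eq_single z]
  · simp only [if_true]
    rw [Finset.sum_eq_single s]
    · rw [Finset.sum_mul]
      refine Finset.sum_congr rfl fun t _ => ?_
      rw [Finset.sum_eq_single c]
      · simp only [if_true]
        rw [← Algebra.commutes, mul_assoc]
      · intro d _ hd; simp [hd.symm]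
      · simp
    · intro d _ hd; simp [hd]
    · simp
  · intro d _ hd; simp [hd]
  · simp

lemma ptr {A : Type*} [Ring A] [Algebra ℂ A] (N : ℕ)
    {R : Matrix (Fin N × Fin N) (Fin N × Fin N) ℂ} {C : Matrix (Fin N) (Fin N) ℂ}
    (hG : Good R C)
    (P Q : Matrix (Fin N × Fin N) (Fin N × Fin N) A) (a b x y : Fin N) :
    ∑ z, ∑ c, algebraMap ℂ A (C z c) *
      (ampl2 N 3 P 0 * ampl2 N 3 (R.map (algebraMap ℂ A)) 1 * ampl2 N 3 Q 0)
        ![a, b, c] ![x, y, z] = (P * Q) (a, b) (x, y) := by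
  simp only [entry, Finset.mul_sum, ← mul_assoc, ← map_mul]
  simp only [mul_assoc]
  calc _ = ∑ s, ∑ t, ∑ u, ∑ z, ∑ c,
        algebraMap ℂ A (C z c * R (t, c) (u, z)) * (P (a, b) (s, t) * Q (s, u) (x, y)) := by
        rw [Finset.sum_congr rfl fun z _ => Finset.sum_comm, Finset.sum_comm]
        refine Finset.sum_congr rfl fun s _ => ?_
        rw [Finset.sum_congr rfl fun z _ => Finset.sum_comm, Finset.sum_comm]
        refine Finset.sum_congr rfl fun t _ => ?_
        rw [Finset.sum_congr rfl fun z _ => Finset.sum_comm, Finset.sum_comm]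
    _ = ∑ s, ∑ t, ∑ u, algebraMap ℂ A (if t = u then 1 else 0) *
          (P (a, b) (s, t) * Q (s, u) (x, y)) := by
        simp only [← Finset.sum_mul, ← map_sum]
        refine Finset.sum_congr rfl fun s _ => Finset.sum_congr rfl fun t _ =>
          Finset.sum_congr rfl fun u _ => ?_
        rw [hG t u]
    _ = _ := by
        simp [Matrix.mul_apply, Fintype.sum_prod_type]

noncomputable def tr2 {A : Type*} [Ring A] [Algebra ℂ A] (N : ℕ) (C : Matrix (Fin N) (Fin N) ℂ)
    (M : Matrix (Fin N × Fin N) (Fin N × Fin N) A) : A :=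
  ∑ x, ∑ y, ∑ a, ∑ b, algebraMap ℂ A (C x a * C y b) * M (a, b) (x, y)

lemma trR3 {A : Type*} [Ring A] [Algebra ℂ A] (N : ℕ)
    {R : Matrix (Fin N × Fin N) (Fin N × Fin N) ℂ} {C : Matrix (Fin N) (Fin N) ℂ}
    (hG : Good R C)
    (P Q : Matrix (Fin N × Fin N) (Fin N × Fin N) A) :
    trRn N 3 C (ampl2 N 3 P 0 * ampl2 N 3 (R.map (algebraMap ℂ A)) 1 * ampl2 N 3 Q 0) =
      tr2 N C (P * Q) := by
  simp only [trRn, tr2, ← ptr N hG P Q]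
  rw [sum3]
  simp only [sum3, Fin.prod_univ_three, Finset.mul_sum, ← mul_assoc, ← map_mul]
  refine Finset.sum_congr rfl fun x _ => Finset.sum_congr rfl fun y _ => ?_
  rw [Finset.sum_comm]
  refine Finset.sum_congr rfl fun a _ => ?_
  rw [Finset.sum_comm]
  rfl

lemma tr2_add {A : Type*} [Ring A] [Algebra ℂ A] (N : ℕ) (C : Matrix (Fin N) (Fin N) ℂ)
    (M M' : Matrix (Fin N × Fin N) (Fin N × Fin N) A) :
    tr2 N C (M + M') = tr2 N C M + tr2 N C M' := by
  simp [tr2, mul_add, Finset.sum_add_distrib]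

lemma tr2_sub {A : Type*} [Ring A] [Algebra ℂ A] (N : ℕ) (C : Matrix (Fin N) (Fin N) ℂ)
    (M M' : Matrix (Fin N × Fin N) (Fin N × Fin N) A) :
    tr2 N C (M - M') = tr2 N C M - tr2 N C M' := by
  simp [tr2, mul_sub, Finset.sum_sub_distrib]

lemma tr2_smul {A : Type*} [Ring A] [Algebra ℂ A] (N : ℕ) (C : Matrix (Fin N) (Fin N) ℂ)
    (c : ℂ) (M : Matrix (Fin N × Fin N) (Fin N × Fin N) A) :
    tr2 N C (c • M) = algebraMap ℂ A c * tr2 N C M := by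
  simp only [tr2, Finset.mul_sum, Matrix.smul_apply, Algebra.smul_def]
  simp only [← mul_assoc, ← map_mul, mul_comm c]

lemma one1_mul {A : Type*} [Ring A] {N : ℕ} (X Y : Matrix (Fin N) (Fin N) A) :
    one1 X * one1 Y = one1 (X * Y) := by
  ext ⟨a, b⟩ ⟨x, y⟩
  simp [one1, Matrix.mul_apply, Fintype.sum_prod_type]

/-- trace of a product with a second factor on position 1 -/
lemma tr2_mul_one1 {A : Type*} [Ring A] [Algebra ℂ A] (N : ℕ) (C : Matrix (Fin N) (Fin N) ℂ)
    (M : Matrix (Fin N × Fin N) (Fin N × Fin N) A) (Z : Matrix (Fin N) (Fin N) A) :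
    tr2 N C (M * one1 Z) = ∑ x, ∑ a, algebraMap ℂ A (C x a) *
      ∑ k, (∑ y, ∑ b, algebraMap ℂ A (C y b) * M (a, b) (k, y)) * Z k x := by
  simp only [tr2]
  refine Finset.sum_congr rfl fun x _ => ?_
  rw [Finset.sum_comm]
  refine Finset.sum_congr rfl fun a _ => ?_
  have : ∀ b y, (M * one1 Z) (a, b) (x, y) = ∑ k, M (a, b) (k, y) * Z k x := by
    intro b y
    simp [one1, Matrix.mul_apply, Fintype.sum_prod_type]
  simp only [this, map_mul, Finset.mul_sum, Finset.sum_mul]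
  rw [Finset.sum_congr rfl fun z _ => Finset.sum_comm, Finset.sum_comm]
  simp only [mul_assoc]

lemma tr2_R {A : Type*} [Ring A] [Algebra ℂ A] (N : ℕ)
    {R : Matrix (Fin N × Fin N) (Fin N × Fin N) ℂ} {C : Matrix (Fin N) (Fin N) ℂ}
    (hG : Good R C) (Y Z : Matrix (Fin N) (Fin N) A) :
    tr2 N C (one1 Y * R.map (algebraMap ℂ A) * one1 Z) = trR1 N C (Y * Z) := by
  rw [tr2_mul_one1, trR1]
  refine Finset.sum_congr rfl fun x _ => Finset.sum_congr rfl fun a _ => ?_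
  rw [Matrix.mul_apply]
  congr 1
  refine Finset.sum_congr rfl fun k _ => ?_
  congr 1
  have : ∀ b y, (one1 Y * R.map (algebraMap ℂ A)) (a, b) (k, y) =
      ∑ s, algebraMap ℂ A (R (s, b) (k, y)) * Y a s := by
    intro b y
    simp [one1, Matrix.mul_apply, Fintype.sum_prod_type, Algebra.commutes]
  simp only [this, Finset.mul_sum, ← mul_assoc, ← map_mul]
  rw [Finset.sum_congr rfl fun z _ => Finset.sum_comm, Finset.sum_comm]
  simp only [← Finset.sum_mul, ← map_sum]
  rw [Finset.sum_congr rfl fun s _ => by rw [hG s k]]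
  simp

/-- scalar key identity -/
def Key {N : ℕ} (R Ri : Matrix (Fin N × Fin N) (Fin N × Fin N) ℂ)
    (C : Matrix (Fin N) (Fin N) ℂ) :=
  ∀ j k a b, ∑ y, ∑ c, C y c * ∑ s, R (j, c) (b, s) * Ri (a, s) (k, y) =
    if j = k then C a b else 0

lemma tr2_RR {A : Type*} [Ring A] [Algebra ℂ A] (N : ℕ)
    {R Ri : Matrix (Fin N × Fin N) (Fin N × Fin N) ℂ} {C : Matrix (Fin N) (Fin N) ℂ}
    (hK : Key R Ri C) (X Z : Matrix (Fin N) (Fin N) A) :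
    tr2 N C (R.map (algebraMap ℂ A) * one1 X * Ri.map (algebraMap ℂ A) * one1 Z) =
      trR1 N C X * trR1 N C Z := by
  rw [tr2_mul_one1]
  have h1 : ∀ j k, ∑ y, ∑ c, algebraMap ℂ A (C y c) *
      (R.map (algebraMap ℂ A) * one1 X * Ri.map (algebraMap ℂ A)) (j, c) (k, y) =
      if j = k then trR1 N C X else 0 := by
    intro j k
    have : ∀ c y, (R.map (algebraMap ℂ A) * one1 X * Ri.map (algebraMap ℂ A)) (j, c) (k, y) =
        ∑ a, ∑ b, algebraMap ℂ A (∑ s, R (j, c) (b, s) * Ri (a, s) (k, y)) * X b a := by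
      intro c y
      simp only [Matrix.mul_apply, Fintype.sum_prod_type, one1, Matrix.map_apply, mul_ite,
        mul_zero, Finset.sum_ite_eq', Finset.mem_univ, if_true, map_sum, map_mul, Finset.sum_mul]
      refine Finset.sum_congr rfl fun a _ => ?_
      rw [Finset.sum_comm]
      refine Finset.sum_congr rfl fun b _ => Finset.sum_congr rfl fun s _ => ?_
      rw [mul_assoc, ← Algebra.commutes, mul_assoc]
    simp only [this, Finset.mul_sum (s := Finset.univ) (f := fun a => ∑ b, _ * X b a),
      Finset.mul_sum (s := Finset.univ) (f := fun b => _ * X b _), ← mul_assoc, ← map_mul]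
    rw [Finset.sum_congr rfl fun z _ => Finset.sum_comm, Finset.sum_comm]
    rw [Finset.sum_congr rfl fun a _ => Finset.sum_congr rfl fun z _ => Finset.sum_comm]
    rw [Finset.sum_congr rfl fun a _ => Finset.sum_comm]
    simp only [← Finset.sum_mul, ← map_sum]
    rw [Finset.sum_congr rfl fun a _ => Finset.sum_congr rfl fun b _ => by rw [hK j k a b]]
    split_ifs <;> simp [trR1]
  simp only [h1, ite_mul, zero_mul, Finset.sum_ite_eq, Finset.mem_univ, if_true]
  conv_rhs => rw [trR1.eq_1 N C Z]
  simp only [Finset.mul_sum]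
  refine Finset.sum_congr rfl fun x _ => Finset.sum_congr rfl fun a _ => ?_
  rw [← mul_assoc, ← mul_assoc, Algebra.commutes]

lemma key {N : ℕ} {R Ri : Matrix (Fin N × Fin N) (Fin N × Fin N) ℂ}
    {C : Matrix (Fin N) (Fin N) ℂ} (hG : Good R C)
    (h1 : R * Ri = 1) (h2 : Ri * R = 1)
    (hbraid : ampl2 N 3 R 0 * ampl2 N 3 R 1 * ampl2 N 3 R 0 =
      ampl2 N 3 R 1 * ampl2 N 3 R 0 * ampl2 N 3 R 1)
    (Ψ : Matrix (Fin N × Fin N) (Fin N × Fin N) ℂ)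
    (hΨ : ∀ i j k m : Fin N, ∑ a : Fin N, ∑ b : Fin N,
        R (i, b) (j, a) * Ψ (a, k) (b, m) = if i = m ∧ k = j then 1 else 0)
    (hC : ∀ i j : Fin N, C i j = ∑ k : Fin N, Ψ (i, k) (j, k)) : Key R Ri C := by
  have hb : ampl2 N 3 Ri 0 * ampl2 N 3 R 1 * ampl2 N 3 R 0 =
      ampl2 N 3 R 1 * ampl2 N 3 R 0 * ampl2 N 3 Ri 1 := by
    have e0 : ampl2 N 3 Ri 0 * ampl2 N 3 R 0 = 1 := by rw [mul0, h2, one0]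
    have e1 : ampl2 N 3 R 1 * ampl2 N 3 Ri 1 = 1 := by rw [mul1, h1, one1']
    calc _ = ampl2 N 3 Ri 0 * (ampl2 N 3 R 1 * ampl2 N 3 R 0 * ampl2 N 3 R 1) * ampl2 N 3 Ri 1 := by
            simp only [mul_assoc, e1, mul_one]
      _ = _ := by rw [← hbraid]; simp only [← mul_assoc, e0, one_mul]
  -- first claim
  have c1 : ∀ m l j k, ∑ a, ∑ b, R (m, b) (l, a) *
      (∑ y, ∑ c, C y c * ∑ s, R (j, c) (b, s) * Ri (a, s) (k, y)) =
      if m = l ∧ j = k then 1 else 0 := by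
    intro m l j k
    have := ptr (A := ℂ) N hG Ri R m j l k
    rw [h2] at this
    have hid : R.map (algebraMap ℂ ℂ) = R := by ext; simp
    rw [hid, hb, Matrix.one_apply] at this
    simp only [Prod.mk.injEq] at this
    rw [← this]
    have : ∀ c y, (ampl2 N 3 R 1 * ampl2 N 3 R 0 * ampl2 N 3 Ri 1) ![m, j, c] ![l, k, y] =
        ∑ a, ∑ b, R (m, b) (l, a) * ∑ s, R (j, c) (b, s) * Ri (a, s) (k, y) := by
      intro c y
      simp only [Matrix.mul_apply, sum3, a0, a1]
      rw [Finset.sum_eq_single l]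
      · refine Finset.sum_congr rfl fun a _ => ?_
        simp only [if_true, Finset.mul_sum]
        rw [Finset.sum_comm]
        refine Finset.sum_congr rfl fun s _ => ?_
        rw [Finset.sum_eq_single m]
        · simp only [if_true, Finset.sum_mul]
          refine Finset.sum_congr rfl fun b _ => ?_
          rw [Finset.sum_eq_single s]
          · simp; ring
          · intro d _ hd; simp [hd]
          · simp
        · intro d _ hd; simp [hd.symm]
        · simp
      · intro d _ hd; simp [hd]
      · simp
    simp only [this, Algebra.algebraMap_self, RingHom.id_apply]
    simp only [Finset.mul_sum (s := Finset.univ) (f := fun a => ∑ b, R (m, b) (l, a) * _),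
      Finset.mul_sum (s := Finset.univ) (f := fun b => R (m, b) (l, _) * _)]
    conv_rhs =>
      rw [Finset.sum_congr rfl fun z _ => Finset.sum_comm, Finset.sum_comm]
      rw [Finset.sum_congr rfl fun a _ => Finset.sum_congr rfl fun z _ => Finset.sum_comm]
      rw [Finset.sum_congr rfl fun a _ => Finset.sum_comm]
    simp only [Finset.mul_sum, mul_left_comm]
  -- two-sided skew inverse
  let M : Matrix (Fin N × Fin N) (Fin N × Fin N) ℂ := fun p r => R (p.1, r.2) (p.2, r.1)
  let M' : Matrix (Fin N × Fin N) (Fin N × Fin N) ℂ := fun p r => Ψ (p.1, r.2) (p.2, r.1)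
  have hM : M * M' = 1 := by
    ext ⟨i, j⟩ ⟨m, k⟩
    rw [Matrix.mul_apply, Fintype.sum_prod_type, Matrix.one_apply]
    simp only [M, M', hΨ, Prod.mk.injEq, eq_comm (a := k)]
  have hM' : M' * M = 1 := mul_eq_one_comm.mp hM
  intro j k a b
  let F : Matrix (Fin N × Fin N) Unit ℂ := fun p _ =>
    ∑ y, ∑ c, C y c * ∑ s, R (j, c) (p.2, s) * Ri (p.1, s) (k, y)
  have hF : M * F = Matrix.of fun p _ => if p.1 = p.2 ∧ j = k then 1 else 0 := by
    ext ⟨m, l⟩ u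
    rw [Matrix.of_apply, ← c1 m l j k]
    rw [Matrix.mul_apply, Fintype.sum_prod_type]
  have hF2 : F = M' * (M * F) := by rw [← Matrix.mul_assoc, hM', Matrix.one_mul]
  have := congrFun (congrFun hF2 (a, b)) ()
  rw [hF] at this
  simp only [F] at this
  rw [this]
  rw [Matrix.mul_apply, Fintype.sum_prod_type, hC]
  simp only [M', Matrix.of_apply]
  split_ifs with h <;> simp [h]

lemma rel (N : ℕ) (R : Matrix (Fin N × Fin N) (Fin N × Fin N) ℂ) :
    R.map (algebraMap ℂ (MREA N R)) * one1 (Lhatgen N R) * R.map (algebraMap ℂ (MREA N R)) *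
        one1 (Lhatgen N R) -
      one1 (Lhatgen N R) * R.map (algebraMap ℂ (MREA N R)) * one1 (Lhatgen N R) *
        R.map (algebraMap ℂ (MREA N R)) =
    R.map (algebraMap ℂ (MREA N R)) * one1 (Lhatgen N R) -
      one1 (Lhatgen N R) * R.map (algebraMap ℂ (MREA N R)) := by
  let f := RingQuot.mkAlgHom ℂ (MREArel N R)
  have hL : (L1F N).map f = one1 (Lhatgen N R) := by
    ext p r
    simp only [L1F, one1, Lhatgen, Matrix.map_apply]
    split_ifs <;> simp [f]
  have hR : (R.map (algebraMap ℂ (FreeAlgebra ℂ (Fin N × Fin N)))).map f =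
      R.map (algebraMap ℂ (MREA N R)) := by
    ext p r
    simp [f]
  have h := fun p r => RingQuot.mkAlgHom_rel ℂ (MREArel.rel (N := N) (R := R) p r)
  have h' := Matrix.ext (M := Matrix.map _ f) (N := Matrix.map _ f) h
  have e : ∀ M : Matrix (Fin N × Fin N) (Fin N × Fin N) (FreeAlgebra ℂ (Fin N × Fin N)),
    M.map f = f.toRingHom.mapMatrix M := fun _ => rfl
  rw [← hL, ← hR]
  simp only [e, ← map_mul, ← map_sub] at h' ⊢
  exact h'

end S13

/-- STATEMENT 12: Tr_{R(123)}( L̂_{\bar{1→3}} · R₂R₁R₂ ) =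
Tr_R(L)·Tr_R(L²) + (q − q⁻¹)·Tr_R(L³) in the modified RE algebra L̂(R). -/
theorem statement_13 (N : ℕ) (hN : 1 ≤ N) (q : ℂ) (hq0 : q ≠ 0) (hq1 : q ≠ 1) (hqm1 : q ≠ -1)
    (R : Matrix (Fin N × Fin N) (Fin N × Fin N) ℂ)
    (hbraid : ampl2 N 3 R 0 * ampl2 N 3 R 1 * ampl2 N 3 R 0 =
      ampl2 N 3 R 1 * ampl2 N 3 R 0 * ampl2 N 3 R 1)
    (hHecke : (q • (1 : Matrix (Fin N × Fin N) (Fin N × Fin N) ℂ) - R) * (q⁻¹ • 1 + R) = 0)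
    (Ψ : Matrix (Fin N × Fin N) (Fin N × Fin N) ℂ)
    (hΨ : ∀ i j k m : Fin N, ∑ a : Fin N, ∑ b : Fin N,
        R (i, b) (j, a) * Ψ (a, k) (b, m) = if i = m ∧ k = j then 1 else 0)
    (C : Matrix (Fin N) (Fin N) ℂ)
    (hC : ∀ i j : Fin N, C i j = ∑ k : Fin N, Ψ (i, k) (j, k)) :
    trRn N 3 C
      (Ltot N 3 R q (Lhatgen N R) *
        ampl2 N 3 (R.map (algebraMap ℂ (MREA N R))) 1 *
        ampl2 N 3 (R.map (algebraMap ℂ (MREA N R))) 0 *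
        ampl2 N 3 (R.map (algebraMap ℂ (MREA N R))) 1) =
      trR1 N C (Lhatgen N R) * trR1 N C (Lhatgen N R ^ 2) +
        algebraMap ℂ (MREA N R) (q - q⁻¹) * trR1 N C (Lhatgen N R ^ 3) := by
  have hG : S13.Good R C := by
    intro i j
    simp only [hC, Finset.sum_mul]
    rw [Finset.sum_congr rfl fun z _ => Finset.sum_comm, Finset.sum_comm]
    simp only [mul_comm (Ψ _ _), hΨ]
    by_cases h : i = j
    · subst h; simp [eq_comm]
    · rw [if_neg h]
      apply Finset.sum_eq_zero
      intro k _
      rw [if_neg]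
      rintro ⟨rfl, h2⟩
      exact h h2
  set Ri := R - (q - q⁻¹) • (1 : Matrix (Fin N × Fin N) (Fin N × Fin N) ℂ) with hRi
  have h1 : R * Ri = 1 := by
    have : R * Ri - 1 = - ((q • (1 : Matrix (Fin N × Fin N) (Fin N × Fin N) ℂ) - R) *
        (q⁻¹ • 1 + R)) := by
      simp only [hRi, mul_sub, sub_mul, mul_add, smul_mul_assoc, mul_smul_comm, one_mul, mul_one,
        smul_smul, mul_inv_cancel₀ hq0, inv_mul_cancel₀ hq0, sub_smul, smul_sub, smul_add, one_smul]
      abel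
    rw [hHecke, neg_zero] at this
    exact sub_eq_zero.mp this
  have h2 : Ri * R = 1 := mul_eq_one_comm.mp h1
  have hK := S13.key hG h1 h2 hbraid Ψ hΨ hC
  have hrel := S13.rel N R
  set L := Lhatgen N R with hL
  set r := R.map (algebraMap ℂ (MREA N R)) with hr
  set ri := Ri.map (algebraMap ℂ (MREA N R)) with hri
  have hrr : r * ri = 1 := by
    rw [hr, hri, ← Matrix.map_mul, h1]; simp
  have hrr' : ri * r = 1 := by
    rw [hr, hri, ← Matrix.map_mul, h2]; simp
  have hrri : r = ri + (q - q⁻¹) • (1 : Matrix (Fin N × Fin N) (Fin N × Fin N) (MREA N R)) := by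
    ext i j
    simp only [hr, hri, hRi, Matrix.map_apply, Matrix.sub_apply, Matrix.smul_apply,
      Matrix.add_apply, Matrix.one_apply]
    split_ifs <;> simp [Algebra.smul_def]
  have br : ampl2 N 3 r 0 * ampl2 N 3 r 1 * ampl2 N 3 r 0 =
      ampl2 N 3 r 1 * ampl2 N 3 r 0 * ampl2 N 3 r 1 := by
    simp only [hr, S13.map_ampl, ← Matrix.map_mul, hbraid]
  have hcomm := S13.comm1 N R L
  rw [← hr] at hcomm
  have e0 : ampl2 N 3 ri 0 * ampl2 N 3 r 0 = 1 := by rw [S13.mul0, hrr', S13.one0]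
  have e1 : ampl2 N 3 ri 1 * ampl2 N 3 r 1 = 1 := by rw [S13.mul1, hrr', S13.one1']
  have hT : Ltot N 3 R q L * ampl2 N 3 r 1 * ampl2 N 3 r 0 * ampl2 N 3 r 1 =
      ampl2 N 3 (S13.one1 L * r) 0 * ampl2 N 3 r 1 *
        ampl2 N 3 (S13.one1 L * (r * S13.one1 L)) 0 := by
    have hl : Ltot N 3 R q L = ampl2 N 3 (S13.one1 L) 0 *
        (ampl2 N 3 r 0 * ampl2 N 3 (S13.one1 L) 0 * ampl2 N 3 ri 0) *
        (ampl2 N 3 r 1 * (ampl2 N 3 r 0 * ampl2 N 3 (S13.one1 L) 0 * ampl2 N 3 ri 0) *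
          ampl2 N 3 ri 1) := by
      simp [Ltot, List.range_succ, Lbar, S13.ampl1_eq, hr, hri, hRi]
      simp only [mul_assoc]
    rw [hl]
    simp only [← S13.mul0]
    generalize ampl2 N 3 r 0 = r0 at *
    generalize ampl2 N 3 r 1 = r1 at *
    generalize ampl2 N 3 ri 0 = i0 at *
    generalize ampl2 N 3 ri 1 = i1 at *
    generalize ampl2 N 3 (S13.one1 L) 0 = l at *
    calc _ = l * r0 * l * i0 * r1 * r0 * l * i0 * (i1 * r1) * r0 * r1 := by
            simp only [mul_assoc]
      _ = l * r0 * l * i0 * r1 * r0 * l * (i0 * r0) * r1 := by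
            rw [e1]; simp only [mul_assoc, one_mul]
      _ = l * r0 * l * i0 * r1 * r0 * (l * r1) := by
            rw [e0]; simp only [mul_assoc, one_mul]
      _ = l * r0 * l * i0 * (r1 * r0 * r1) * l := by
            rw [← hcomm]; simp only [mul_assoc]
      _ = l * r0 * l * (i0 * r0) * r1 * r0 * l := by
            rw [← br]; simp only [mul_assoc]
      _ = l * r0 * (l * r1) * r0 * l := by
            rw [e0]; simp only [mul_assoc, one_mul]
      _ = _ := by rw [← hcomm]; simp only [mul_assoc]
  rw [hT, S13.trR3 N hG]
  have hP : S13.one1 L * r * (S13.one1 L * (r * S13.one1 L)) =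
      r * S13.one1 L * ri * S13.one1 (L ^ 2) +
        (q - q⁻¹) • (S13.one1 1 * r * S13.one1 (L ^ 3)) -
        S13.one1 1 * r * S13.one1 (L ^ 2) + S13.one1 L * r * S13.one1 L := by
    have o : S13.one1 (1 : Matrix (Fin N) (Fin N) (MREA N R)) = 1 := by
      ext ⟨a, b⟩ ⟨x, y⟩
      simp only [S13.one1, Matrix.one_apply, Prod.mk.injEq]
      split_ifs <;> simp_all
    have hx : r * S13.one1 L * r * S13.one1 (L ^ 2) =
        r * S13.one1 L * ri * S13.one1 (L ^ 2) +
        (q - q⁻¹) • (S13.one1 1 * r * S13.one1 (L ^ 3)) := by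
      have hy : r * S13.one1 L * r =
          r * S13.one1 L * ri + (q - q⁻¹) • (r * S13.one1 L) := by
        conv_lhs => rw [hrri, mul_add, ← hrri]
        rw [mul_smul_comm, mul_one]
      rw [hy, o, add_mul, smul_mul_assoc, mul_assoc r (S13.one1 L) (S13.one1 (L ^ 2)),
        S13.one1_mul, one_mul, show L * L ^ 2 = L ^ 3 from (pow_succ' L 2).symm]
    rw [← hx, o]
    have h3 := congrArg (· * S13.one1 L) hrel
    simp only [sub_mul] at h3
    rw [pow_two, ← S13.one1_mul]
    have h4 : S13.one1 L * r * (S13.one1 L * (r * S13.one1 L)) =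
      S13.one1 L * r * S13.one1 L * r * S13.one1 L := by simp only [mul_assoc]
    rw [h4, ← sub_eq_zero]
    rw [← sub_eq_zero] at h3
    rw [← neg_eq_zero, ← h3]
    simp only [mul_assoc, one_mul]
    abel
  rw [hP, S13.tr2_add, S13.tr2_sub, S13.tr2_add, S13.tr2_smul, S13.tr2_R N hG, S13.tr2_R N hG,
    S13.tr2_R N hG, S13.tr2_RR N hK]
  simp only [one_mul, pow_two]
  abel
end

section
/- Let R be a skew-invertible Hecke symmetry on V = ℂ^N with parameter q (q ≠ 0, q ≠ ±1). Then the reflection equation algebra L(R) and the modified reflection equation algebra L̂(R) are isomorphic as unital ℂ-algebras: there is an algebra isomorphism L(R) → L̂(R) determined on generators by l_i^j ↦ δ_i^j·1 − (q − q⁻¹)·l̂_i^j, i.e., by the matrix relation L = I − (q − q⁻¹) L̂. -/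
open scoped BigOperators

/-- The matrix X⊗I over an algebra. -/
def E1aux {A : Type*} [Semiring A] (N : ℕ) (X : Matrix (Fin N) (Fin N) A) :
    Matrix (Fin N × Fin N) (Fin N × Fin N) A :=
  fun p r => if p.2 = r.2 then X p.1 r.1 else 0

lemma E1aux_sub {A : Type*} [Ring A] [Algebra ℂ A] (N : ℕ) (c d : ℂ)
    (X : Matrix (Fin N) (Fin N) A) :
    E1aux N (fun i j => c • ((if i = j then (1 : A) else 0) - d • X i j)) =
      c • (1 - d • E1aux N X) := by
  ext ⟨a, b⟩ ⟨a', b'⟩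
  by_cases h1 : a = a' <;> by_cases h2 : b = b' <;>
    simp [E1aux, Matrix.one_apply, h1, h2]

lemma map_L1F {A : Type*} [Ring A] [Algebra ℂ A] (N : ℕ)
    (φ : FreeAlgebra ℂ (Fin N × Fin N) →ₐ[ℂ] A) :
    φ.mapMatrix (L1F N) = E1aux N (fun i j => φ (FreeAlgebra.ι ℂ (i, j))) := by
  ext p r
  by_cases h : p.2 = r.2 <;> simp [L1F, E1aux, h]

lemma map_R {A : Type*} [Ring A] [Algebra ℂ A] (N : ℕ)
    (R : Matrix (Fin N × Fin N) (Fin N × Fin N) ℂ)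
    (φ : FreeAlgebra ℂ (Fin N × Fin N) →ₐ[ℂ] A) :
    φ.mapMatrix (R.map (algebraMap ℂ (FreeAlgebra ℂ (Fin N × Fin N)))) =
      R.map (algebraMap ℂ A) := by
  ext p r
  simp

lemma rea_iff {A : Type*} [Ring A] [Algebra ℂ A] (N : ℕ)
    (R : Matrix (Fin N × Fin N) (Fin N × Fin N) ℂ)
    (φ : FreeAlgebra ℂ (Fin N × Fin N) →ₐ[ℂ] A)
    (r : Matrix (Fin N × Fin N) (Fin N × Fin N) A) (hr : r = R.map (algebraMap ℂ A))
    (X : Matrix (Fin N × Fin N) (Fin N × Fin N) A)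
    (hX : X = E1aux N (fun i j => φ (FreeAlgebra.ι ℂ (i, j)))) :
    (∀ ⦃x y⦄, REArel N R x y → φ x = φ y) ↔ r * X * r * X = X * r * X * r := by
  rw [hr, hX, ← map_R N R φ, ← map_L1F]
  simp only [← map_mul]
  constructor
  · intro h
    ext p s
    exact h (REArel.rel p s)
  · rintro h _ _ ⟨p, s⟩
    exact congrFun (congrFun h p) s

lemma mrea_iff {A : Type*} [Ring A] [Algebra ℂ A] (N : ℕ)
    (R : Matrix (Fin N × Fin N) (Fin N × Fin N) ℂ)
    (φ : FreeAlgebra ℂ (Fin N × Fin N) →ₐ[ℂ] A)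
    (r : Matrix (Fin N × Fin N) (Fin N × Fin N) A) (hr : r = R.map (algebraMap ℂ A))
    (X : Matrix (Fin N × Fin N) (Fin N × Fin N) A)
    (hX : X = E1aux N (fun i j => φ (FreeAlgebra.ι ℂ (i, j)))) :
    (∀ ⦃x y⦄, MREArel N R x y → φ x = φ y) ↔
      r * X * r * X - X * r * X * r = r * X - X * r := by
  rw [hr, hX, ← map_R N R φ, ← map_L1F]
  simp only [← map_mul, ← map_sub]
  constructor
  · intro h
    ext p s
    exact h (MREArel.rel p s)
  · rintro h _ _ ⟨p, s⟩
    exact congrFun (congrFun h p) s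

lemma alg_key {S : Type*} [Ring S] [Algebra ℂ S] (l : ℂ) (r M : S)
    (hr : r * r = 1 + l • r) :
    r * (1 - l • M) * r * (1 - l • M) - (1 - l • M) * r * (1 - l • M) * r =
      (l * l) • ((r * M * r * M - M * r * M * r) - (r * M - M * r)) := by
  have h1 : r * r * M = M + l • (r * M) := by rw [hr]; simp [add_mul]
  have h2 : M * (r * r) = M + l • (M * r) := by rw [hr]; simp [mul_add]
  have : r * (1 - l • M) * r * (1 - l • M) - (1 - l • M) * r * (1 - l • M) * r =
      (l * l) • (r * M * r * M - M * r * M * r) - l • (r * r * M - M * (r * r)) := by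
    simp only [mul_sub, sub_mul, mul_one, one_mul, smul_mul_assoc, mul_smul_comm, smul_sub,
      smul_smul, mul_assoc]
    abel
  rw [this, h1, h2]
  simp only [smul_sub, smul_add, smul_smul]
  abel

lemma alg_iff {S : Type*} [Ring S] [Algebra ℂ S] (l : ℂ) (hl : l ≠ 0) (r M : S)
    (hr : r * r = 1 + l • r) :
    r * (1 - l • M) * r * (1 - l • M) = (1 - l • M) * r * (1 - l • M) * r ↔
      r * M * r * M - M * r * M * r = r * M - M * r := by
  rw [← sub_eq_zero, alg_key l r M hr, smul_eq_zero, sub_eq_zero]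
  simp [hl]

lemma hecke_map {A : Type*} [Ring A] [Algebra ℂ A] (N : ℕ) (q : ℂ) (hq0 : q ≠ 0)
    (R : Matrix (Fin N × Fin N) (Fin N × Fin N) ℂ)
    (hHecke : (q • (1 : Matrix (Fin N × Fin N) (Fin N × Fin N) ℂ) - R) * (q⁻¹ • 1 + R) = 0) :
    R.map (algebraMap ℂ A) * R.map (algebraMap ℂ A) =
      1 + (q - q⁻¹) • R.map (algebraMap ℂ A) := by
  have h : R * R = 1 + (q - q⁻¹) • R := by
    have h2 : (q • (1 : Matrix (Fin N × Fin N) (Fin N × Fin N) ℂ) - R) * (q⁻¹ • 1 + R) =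
        1 + (q - q⁻¹) • R - R * R := by
      simp only [mul_add, sub_mul, mul_one, one_mul, smul_mul_assoc, mul_smul_comm, smul_sub,
        smul_smul, sub_smul, inv_mul_cancel₀ hq0, one_smul]
      abel
    rw [h2, sub_eq_zero] at hHecke
    exact hHecke.symm
  have := congrArg (Algebra.ofId ℂ A).mapMatrix h
  rw [map_mul, map_add, map_one, map_smul] at this
  exact this

/-- L(R) and L̂(R) are isomorphic as unital ℂ-algebras, via
l_i^j ↦ δ_i^j·1 − (q − q⁻¹)·l̂_i^j. -/
theorem statement_14 (N : ℕ) (hN : 1 ≤ N) (q : ℂ) (hq0 : q ≠ 0) (hq1 : q ≠ 1) (hqm1 : q ≠ -1)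
    (R : Matrix (Fin N × Fin N) (Fin N × Fin N) ℂ)
    (hbraid : ampl2 N 3 R 0 * ampl2 N 3 R 1 * ampl2 N 3 R 0 =
      ampl2 N 3 R 1 * ampl2 N 3 R 0 * ampl2 N 3 R 1)
    (hHecke : (q • (1 : Matrix (Fin N × Fin N) (Fin N × Fin N) ℂ) - R) * (q⁻¹ • 1 + R) = 0)
    (Ψ : Matrix (Fin N × Fin N) (Fin N × Fin N) ℂ)
    (hΨ : ∀ i j k m : Fin N, ∑ a : Fin N, ∑ b : Fin N,
        R (i, b) (j, a) * Ψ (a, k) (b, m) = if i = m ∧ k = j then 1 else 0) :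
    ∃ f : REA N R ≃ₐ[ℂ] MREA N R,
      ∀ i j : Fin N,
        f (Lgen N R i j) =
          (if i = j then (1 : MREA N R) else 0) - (q - q⁻¹) • Lhatgen N R i j := by
  have hl : q - q⁻¹ ≠ 0 := by
    intro h
    have h2 : q * q = 1 := by
      rw [sub_eq_zero] at h
      nth_rewrite 2 [h]
      exact mul_inv_cancel₀ hq0
    rcases mul_self_eq_one_iff.mp h2 with h | h
    · exact hq1 h
    · exact hqm1 h
  set l := q - q⁻¹ with hldef
  let φ : FreeAlgebra ℂ (Fin N × Fin N) →ₐ[ℂ] MREA N R :=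
    FreeAlgebra.lift ℂ (fun p => (1 : ℂ) •
      ((if p.1 = p.2 then (1 : MREA N R) else 0) - l • Lhatgen N R p.1 p.2))
  let ψ : FreeAlgebra ℂ (Fin N × Fin N) →ₐ[ℂ] REA N R :=
    FreeAlgebra.lift ℂ (fun p => l⁻¹ •
      ((if p.1 = p.2 then (1 : REA N R) else 0) - (1 : ℂ) • Lgen N R p.1 p.2))
  have hφ : ∀ ⦃x y⦄, REArel N R x y → φ x = φ y := by
    rw [rea_iff N R φ _ rfl (1 - l • E1aux N (Lhatgen N R))
      (by simp only [φ, FreeAlgebra.lift_ι_apply]; rw [E1aux_sub, one_smul]),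
      alg_iff l hl _ _ (hecke_map N q hq0 R hHecke)]
    exact (mrea_iff N R (RingQuot.mkAlgHom ℂ (MREArel N R)) _ rfl _ rfl).1
      (fun x y h => RingQuot.mkAlgHom_rel ℂ h)
  have hψ : ∀ ⦃x y⦄, MREArel N R x y → ψ x = ψ y := by
    rw [mrea_iff N R ψ _ rfl (l⁻¹ • (1 - (1 : ℂ) • E1aux N (Lgen N R)))
      (by simp only [ψ, FreeAlgebra.lift_ι_apply]; rw [E1aux_sub]),
      ← alg_iff l hl _ _ (hecke_map N q hq0 R hHecke)]
    rw [smul_smul, mul_inv_cancel₀ hl, one_smul, one_smul, sub_sub_cancel]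
    exact (rea_iff N R (RingQuot.mkAlgHom ℂ (REArel N R)) _ rfl _ rfl).1
      (fun x y h => RingQuot.mkAlgHom_rel ℂ h)
  let F : REA N R →ₐ[ℂ] MREA N R := RingQuot.liftAlgHom ℂ ⟨φ, hφ⟩
  let G : MREA N R →ₐ[ℂ] REA N R := RingQuot.liftAlgHom ℂ ⟨ψ, hψ⟩
  have hF : ∀ i j, F (Lgen N R i j) =
      (if i = j then (1 : MREA N R) else 0) - l • Lhatgen N R i j := by
    intro i j
    simp only [F, Lgen, RingQuot.liftAlgHom_mkAlgHom_apply, φ, FreeAlgebra.lift_ι_apply,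
      one_smul]
  have hG : ∀ i j, G (Lhatgen N R i j) =
      l⁻¹ • ((if i = j then (1 : REA N R) else 0) - Lgen N R i j) := by
    intro i j
    simp only [G, Lhatgen, RingQuot.liftAlgHom_mkAlgHom_apply, ψ, FreeAlgebra.lift_ι_apply,
      one_smul]
  have hFG : F.comp G = AlgHom.id ℂ _ := by
    apply RingQuot.ringQuot_ext'
    apply FreeAlgebra.hom_ext
    funext ⟨i, j⟩
    change F (G (Lhatgen N R i j)) = Lhatgen N R i j
    rw [hG, map_smul, map_sub, hF]
    by_cases h : i = j <;> simp [h, smul_smul, hl]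
  have hGF : G.comp F = AlgHom.id ℂ _ := by
    apply RingQuot.ringQuot_ext'
    apply FreeAlgebra.hom_ext
    funext ⟨i, j⟩
    change G (F (Lgen N R i j)) = Lgen N R i j
    rw [hF, map_sub, map_smul, hG]
    by_cases h : i = j <;> simp [h, smul_smul, hl]
  exact ⟨AlgEquiv.ofAlgHom F G hFG hGF, hF⟩
end
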